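/- Let k be a field, let X and C be separated schemes of finite type over k, let c = (c₁, c₂) : C → X ×ₖ X be a morphism, and let U ⊆ X be an open subscheme such that: (1) c₁⁻¹(U) is dense in C; (2) the restriction of c₁ to c₁⁻¹(U) is a proper morphism c₁⁻¹(U) → U; (3) the closed set X \ U is locally c-invariant. Then there exists a compactification of c with locally invariant boundary: proper k-schemes X̄ and C̄, open immersions j : X ↪ X̄ and j_C : C ↪ C̄, and a morphism c̄ = (c̄₁, c̄₂) : C̄ → X̄ ×ₖ X̄ with c̄ ∘ j_C = (j ×ₖ j) ∘ c, such that the closed set X̄ \ j(U) is locally c̄-invariant. -/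

import Mathlib

open AlgebraicGeometry CategoryTheory

universe u

namespace NagataAux

open Scheme Limits

/-- The sections of an ideal sheaf over an affine open. -/
def secs {X : Scheme.{u}} (I : X.IdealSheafData) (U : X.Opens) (hU : IsAffineOpen U) :
    Ideal Γ(X, U) := I.ideal ⟨U, hU⟩

theorem secs_map {X : Scheme.{u}} (I : X.IdealSheafData) {U V : X.Opens} (hU : IsAffineOpen U)
    (hV : IsAffineOpen V) (i : U ≤ V) :
    (secs I V hV).map (X.presheaf.map (homOfLE i).op).hom = secs I U hU :=
  I.map_ideal (U := ⟨U, hU⟩) (V := ⟨V, hV⟩) i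

theorem secs_map' {X : Scheme.{u}} (I : X.IdealSheafData) {U V : X.Opens} (hU : IsAffineOpen U)
    (hV : IsAffineOpen V) (i : Opposite.op V ⟶ Opposite.op U) :
    (secs I V hV).map (X.presheaf.map i).hom = secs I U hU :=
  I.map_ideal' (U := ⟨U, hU⟩) (V := ⟨V, hV⟩) i

theorem secs_comap_top {X Y : Scheme.{u}} [IsAffine X] [IsAffine Y] (I : Y.IdealSheafData)
    (f : X ⟶ Y) :
    secs (I.comap f) ⊤ (isAffineOpen_top X) =
      (secs I ⊤ (isAffineOpen_top Y)).map f.appTop.hom := by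
  refine le_antisymm ?_ ?_
  · have : I.comap f ≤ IdealSheafData.equivOfIsAffine.symm
        ((secs I ⊤ (isAffineOpen_top Y)).map f.appTop.hom) := by
      rw [← IdealSheafData.le_map_iff_comap_le]
      apply IdealSheafData.le_of_isAffine
      rw [IdealSheafData.ideal_map_of_isAffineHom]
      change secs I ⊤ (isAffineOpen_top Y) ≤ Ideal.comap (f.appTop).hom
        (IdealSheafData.equivOfIsAffine (IdealSheafData.equivOfIsAffine.symm
        ((secs I ⊤ (isAffineOpen_top Y)).map f.appTop.hom)))
      rw [OrderRingIso.apply_symm_apply]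
      exact Ideal.le_comap_map
    have h2 := this ⟨⊤, isAffineOpen_top X⟩
    change secs (I.comap f) ⊤ (isAffineOpen_top X) ≤ IdealSheafData.equivOfIsAffine
      (IdealSheafData.equivOfIsAffine.symm ((secs I ⊤ (isAffineOpen_top Y)).map f.appTop.hom)) at h2
    rwa [OrderRingIso.apply_symm_apply] at h2
  · refine Ideal.map_le_iff_le_comap.mpr ?_
    have := IdealSheafData.le_map_comap I f ⟨⊤, isAffineOpen_top Y⟩
    rwa [IdealSheafData.ideal_map_of_isAffineHom] at this

theorem secs_comap_opens {X Y : Scheme.{u}} (I : Y.IdealSheafData) (f : X ⟶ Y)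
    [IsOpenImmersion f] (U : X.Opens) (hU : IsAffineOpen U) :
    secs (I.comap f) U hU = (secs I (f ''ᵁ U) (hU.image_of_isOpenImmersion f)).map
      (f.appIso U).hom.hom := by
  refine (IdealSheafData.ideal_comap_of_isOpenImmersion I f ⟨U, hU⟩).trans ?_
  exact Ideal.comap_symm (I := secs I (f ''ᵁ U) (hU.image_of_isOpenImmersion f))
    ((f.appIso U).commRingCatIsoToRingEquiv)

theorem secs_comap_fromSpec {X : Scheme.{u}} (I : X.IdealSheafData) (U : X.Opens)
    (hU : IsAffineOpen U) :
    secs (I.comap hU.fromSpec) ⊤ (isAffineOpen_top _) =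
      (secs I U hU).map (Scheme.ΓSpecIso Γ(X, U)).inv.hom := by
  have e : hU.fromSpec ''ᵁ ⊤ = U := by
    rw [Scheme.Hom.image_top_eq_opensRange, IsAffineOpen.opensRange_fromSpec]
  rw [secs_comap_opens, ← secs_map' I ((isAffineOpen_top _).image_of_isOpenImmersion _) hU
    (eqToHom e).op, Ideal.map_map, ← CommRingCat.hom_comp]
  congr 2
  have := hU.fromSpec_app_self
  rw [Scheme.Hom.appIso_hom, Scheme.Hom.naturality_assoc, this]
  simp only [Category.assoc, ← Functor.map_comp]
  refine (congr_arg ((Scheme.ΓSpecIso Γ(X, U)).inv ≫ ·) ?_).trans (Category.comp_id _)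
  exact (congr_arg ((Spec Γ(X, U)).presheaf.map) (Subsingleton.elim _ (𝟙 _))).trans
    (CategoryTheory.Functor.map_id _ _)

theorem secs_comap {X Y : Scheme.{u}} (I : Y.IdealSheafData) (f : X ⟶ Y) {U : Y.Opens}
    {V : X.Opens} (hU : IsAffineOpen U) (hV : IsAffineOpen V) (h : V ≤ f ⁻¹ᵁ U) :
    secs (I.comap f) V hV = (secs I U hU).map (f.appLE U V h).hom := by
  have h1 := secs_comap_top (I.comap hU.fromSpec) (Spec.map (f.appLE U V h))
  rw [← IdealSheafData.comap_comp, IsAffineOpen.SpecMap_appLE_fromSpec f hU hV h,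
    IdealSheafData.comap_comp, secs_comap_fromSpec, secs_comap_fromSpec, Ideal.map_map,
    ← CommRingCat.hom_comp] at h1
  rw [← Scheme.ΓSpecIso_inv_naturality, CommRingCat.hom_comp, ← Ideal.map_map] at h1
  have := congr_arg (Ideal.map (Scheme.ΓSpecIso Γ(X, V)).hom.hom) h1
  rw [Ideal.map_map, Ideal.map_map, ← CommRingCat.hom_comp] at this
  simpa [Ideal.map_id] using this

theorem ext_of_isSchemeTheoreticallyDominant {X Y Z W : Scheme.{u}} {f g : X ⟶ Y}
    (s : Y ⟶ Z) [IsSeparated s] (h : f ≫ s = g ≫ s)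
    (ι : W ⟶ X) [IsSchemeTheoreticallyDominant ι] (hU : ι ≫ f = ι ≫ g) : f = g := by
  let X' : Over Z := Over.mk (f ≫ s)
  let Y' : Over Z := Over.mk s
  let U' : Over Z := Over.mk (ι ≫ f ≫ s)
  let f' : X' ⟶ Y' := Over.homMk f
  let g' : X' ⟶ Y' := Over.homMk g
  let ι' : U' ⟶ X' := Over.homMk ι
  have : IsSeparated Y'.hom := ‹_›
  have e : (equalizer.lift ι' (by ext1; exact hU)).left ≫ (equalizer.ι f' g').left = ι := by
    rw [← Over.comp_left, equalizer.lift_ι]; rfl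
  have hk : (equalizer.ι f' g').left.ker = ⊥ := by
    rw [← le_bot_iff, ← IsSchemeTheoreticallyDominant.ker_eq_bot ι]
    conv_rhs => rw [← e]
    exact Hom.le_ker_comp _ _
  have : IsIso (equalizer.ι f' g').left :=
    IsClosedImmersion.isIso_of_ker_eq (equalizer.ι f' g').left (𝟙 X) (equalizer.ι f' g').left
      (by simp) (by rw [hk, Hom.ker_eq_bot_of_isIso])
  rw [← cancel_epi (equalizer.ι f' g').left]
  exact congrArg CommaMorphism.left (equalizer.condition f' g')

/-- An ideal sheaf is an effective Cartier ideal if it is locally generated by a nonzerodivisor. -/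
def IsCartier {X : Scheme.{u}} (J : X.IdealSheafData) : Prop :=
  ∀ x : X, ∃ (D : X.Opens) (hD : IsAffineOpen D), x ∈ D ∧ ∃ s ∈ nonZeroDivisors Γ(X, D),
    secs J D hD = Ideal.span {s}

theorem flat_appLE {X Y : Scheme.{u}} (f : X ⟶ Y) [Flat f] {U : Y.Opens} {V : X.Opens}
    (hU : IsAffineOpen U) (hV : IsAffineOpen V) (h : V ≤ f ⁻¹ᵁ U) : (f.appLE U V h).hom.Flat :=
  HasRingHomProperty.appLE @Flat f inferInstance ⟨U, hU⟩ ⟨V, hV⟩ h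

theorem map_mem_nonZeroDivisors_of_flat {A B : Type*} [CommRing A] [CommRing B] (φ : A →+* B)
    (hφ : φ.Flat) {s : A} (hs : s ∈ nonZeroDivisors A) : φ s ∈ nonZeroDivisors B := by
  algebraize [φ]
  have := Module.Flat.isSMulRegular_of_nonZeroDivisors (M := B) hs
  rw [mem_nonZeroDivisors_iff_right]
  intro x hx
  apply this
  simpa [Algebra.smul_def, RingHom.algebraMap_toAlgebra, mul_comm] using hx

theorem secs_comap_of_flat {X Y : Scheme.{u}} (J : Y.IdealSheafData) (f : X ⟶ Y) [Flat f]
    {U : Y.Opens} {V : X.Opens} (hU : IsAffineOpen U) (hV : IsAffineOpen V) (h : V ≤ f ⁻¹ᵁ U)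
    {s : Γ(Y, U)} (hs : s ∈ nonZeroDivisors Γ(Y, U)) (hJ : secs J U hU = Ideal.span {s}) :
    (f.appLE U V h).hom s ∈ nonZeroDivisors Γ(X, V) ∧
    secs (J.comap f) V hV = Ideal.span {(f.appLE U V h).hom s} := by
  refine ⟨map_mem_nonZeroDivisors_of_flat _ (flat_appLE f hU hV h) hs, ?_⟩
  rw [secs_comap J f hU hV h, hJ, Ideal.map_span, Set.image_singleton]

theorem exists_affine_mem_le {X : Scheme.{u}} (O : X.Opens) (x : X) (hx : x ∈ O) :
    ∃ (D : X.Opens), IsAffineOpen D ∧ x ∈ D ∧ D ≤ O := by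
  obtain ⟨_, ⟨D, hD, rfl⟩, hx, h⟩ := X.isBasis_affineOpens.exists_subset_of_mem_open hx O.2
  exact ⟨D, hD, hx, h⟩

theorem IsCartier.comap_of_flat {X Y : Scheme.{u}} {J : Y.IdealSheafData} (hJ : IsCartier J)
    (f : X ⟶ Y) [Flat f] : IsCartier (J.comap f) := by
  intro x
  obtain ⟨U, hU, hx, s, hs, h⟩ := hJ (f x)
  obtain ⟨V, hV, hxV, hVU⟩ := exists_affine_mem_le (f ⁻¹ᵁ U) x hx
  obtain ⟨h1, h2⟩ := secs_comap_of_flat J f hU hV hVU hs h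
  exact ⟨V, hV, hxV, _, h1, h2⟩

/-- A Cartier ideal is principal on small affine opens. -/
theorem IsCartier.exists_le {X : Scheme.{u}} {J : X.IdealSheafData} (hJ : IsCartier J)
    (O : X.Opens) (x : X) (hx : x ∈ O) :
    ∃ (D : X.Opens) (hD : IsAffineOpen D), x ∈ D ∧ D ≤ O ∧ ∃ s ∈ nonZeroDivisors Γ(X, D),
    secs J D hD = Ideal.span {s} := by
  obtain ⟨U, hU, hxU, s, hs, h⟩ := hJ x
  obtain ⟨V, hV, hxV, hVU⟩ := exists_affine_mem_le (U ⊓ O) x ⟨hxU, hx⟩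
  obtain ⟨h1, h2⟩ := secs_comap_of_flat J (𝟙 X) hU hV (hVU.trans inf_le_left) hs h
  rw [IdealSheafData.comap_id] at h2
  exact ⟨V, hV, hxV, hVU.trans inf_le_right, _, h1, h2⟩

theorem IsCartier.of_cover {X : Scheme.{u}} {J : X.IdealSheafData}
    (h : ∀ x : X, ∃ (U : Scheme.{u}) (f : U ⟶ X), IsOpenImmersion f ∧ x ∈ Set.range f ∧
      IsCartier (J.comap f)) : IsCartier J := by
  intro x
  obtain ⟨U, f, hf, ⟨y, rfl⟩, hJ⟩ := h x
  obtain ⟨D, hD, hy, s, hs, h⟩ := hJ y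
  let e := (f.appIso D).commRingCatIsoToRingEquiv
  refine ⟨f ''ᵁ D, hD.image_of_isOpenImmersion f, ⟨y, hy, rfl⟩, e.symm s, ?_, ?_⟩
  · exact map_mem_nonZeroDivisors_of_flat e.symm.toRingHom
        (RingHom.Flat.of_bijective e.symm.bijective) hs
  · rw [secs_comap_opens] at h
    have := congr_arg (Ideal.map e.symm.toRingHom) h
    rw [Ideal.map_span, Set.image_singleton, Ideal.map_map] at this
    have e2 : e.symm.toRingHom.comp (f.appIso D).hom.hom = RingHom.id _ :=
      RingHom.ext fun x => e.symm_apply_apply x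
    rw [e2, Ideal.map_id] at this
    exact this

theorem isCartier_top {X : Scheme.{u}} : IsCartier (⊤ : X.IdealSheafData) := by
  intro x
  obtain ⟨V, hV, hxV, -⟩ := exists_affine_mem_le ⊤ x trivial
  exact ⟨V, hV, hxV, 1, one_mem _, by rw [Ideal.span_singleton_one]; rfl⟩

theorem secs_mul {X : Scheme.{u}} (J K : X.IdealSheafData) (D : X.Opens) (hD : IsAffineOpen D) :
    secs (J * K) D hD = secs J D hD * secs K D hD := rfl

theorem secs_pow {X : Scheme.{u}} (J : X.IdealSheafData) (n : ℕ) (D : X.Opens)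
    (hD : IsAffineOpen D) : secs (J ^ n) D hD = secs J D hD ^ n := rfl

/-- Ideal sheaves with equal sections on an affine neighbourhood of each point are equal. -/
theorem ideal_ext {X : Scheme.{u}} {J K : X.IdealSheafData}
    (h : ∀ x : X, ∃ (D : X.Opens) (hD : IsAffineOpen D), x ∈ D ∧ secs J D hD = secs K D hD) :
    J = K := by
  choose D hD hx h using h
  exact IdealSheafData.ext_of_iSup_eq_top (fun x => ⟨D x, hD x⟩)
    (top_le_iff.mp fun x _ => TopologicalSpace.Opens.mem_iSup.mpr ⟨x, hx x⟩) h

theorem ideal_le {X : Scheme.{u}} {J K : X.IdealSheafData}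
    (h : ∀ x : X, ∃ (D : X.Opens) (hD : IsAffineOpen D), x ∈ D ∧ secs J D hD ≤ secs K D hD) :
    J ≤ K := by
  choose D hD hx h using h
  exact IdealSheafData.le_of_iSup_eq_top (fun x => ⟨D x, hD x⟩)
    (top_le_iff.mp fun x _ => TopologicalSpace.Opens.mem_iSup.mpr ⟨x, hx x⟩) h

theorem exists_affine_pair {X Y : Scheme.{u}} (f : X ⟶ Y) (x : X) :
    ∃ (U : Y.Opens) (V : X.Opens), IsAffineOpen U ∧ IsAffineOpen V ∧ x ∈ V ∧ V ≤ f ⁻¹ᵁ U := by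
  obtain ⟨U, hU, hxU, -⟩ := exists_affine_mem_le ⊤ (f x) trivial
  obtain ⟨V, hV, hxV, h⟩ := exists_affine_mem_le (f ⁻¹ᵁ U) x hxU
  exact ⟨U, V, hU, hV, hxV, h⟩

theorem comap_mul {X Y : Scheme.{u}} (J K : Y.IdealSheafData) (f : X ⟶ Y) :
    (J * K).comap f = J.comap f * K.comap f := by
  refine ideal_ext fun x => ?_
  obtain ⟨U, V, hU, hV, hx, h⟩ := exists_affine_pair f x
  refine ⟨V, hV, hx, ?_⟩
  rw [secs_mul, secs_comap _ f hU hV h, secs_comap _ f hU hV h, secs_comap _ f hU hV h, secs_mul,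
    Ideal.map_mul]

theorem comap_pow {X Y : Scheme.{u}} (J : Y.IdealSheafData) (n : ℕ) (f : X ⟶ Y) :
    (J ^ n).comap f = J.comap f ^ n := by
  refine ideal_ext fun x => ?_
  obtain ⟨U, V, hU, hV, hx, h⟩ := exists_affine_pair f x
  refine ⟨V, hV, hx, ?_⟩
  rw [secs_pow, secs_comap _ f hU hV h, secs_comap _ f hU hV h, secs_pow, Ideal.map_pow]

/-- The complement of the support of a Cartier ideal is schematically dense. -/
theorem IsCartier.isSchemeTheoreticallyDominant {X : Scheme.{u}} {J : X.IdealSheafData}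
    (hJ : IsCartier J) (U : X.Opens) (hU : (J.support : Set X)ᶜ ⊆ U) :
    IsSchemeTheoreticallyDominant U.ι := by
  refine ⟨le_bot_iff.mp (ideal_le fun x => ?_)⟩
  obtain ⟨D, hD, hx, s, hs, h⟩ := hJ x
  refine ⟨D, hD, hx, ?_⟩
  intro a ha
  have ha' := Hom.ideal_ker_le U.ι ⟨D, hD⟩ ha
  have hle : X.basicOpen s ≤ D ⊓ U := by
    refine le_inf (X.basicOpen_le s) fun y hy => hU ?_
    have := IdealSheafData.mem_support_iff_of_mem (I := J) (U := ⟨D, hD⟩) (X.basicOpen_le s hy)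
    intro hy'
    have h2 := this.mp hy'
    erw [Scheme.mem_zeroLocus_iff] at h2
    exact h2 s (by change s ∈ secs J D hD; rw [h]; exact Ideal.mem_span_singleton_self s) hy
  have hz : X.presheaf.map (homOfLE (X.basicOpen_le s)).op a = 0 := by
    have h0 : X.presheaf.map (homOfLE (show U.ι ''ᵁ U.ι ⁻¹ᵁ D ≤ D from Scheme.Hom.image_preimage_le
        _ _)).op a = 0 := by
      have : U.ι.app D a = 0 := ha'
      rwa [Scheme.Opens.ι_app] at this
    have hle' : X.basicOpen s ≤ U.ι ''ᵁ U.ι ⁻¹ᵁ D := by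
      rw [Scheme.Hom.image_preimage_eq_opensRange_inf, Scheme.Opens.opensRange_ι, inf_comm]
      exact hle
    have := congr_arg (X.presheaf.map (homOfLE hle').op) h0
    rw [map_zero, ← CommRingCat.comp_apply, ← Functor.map_comp] at this
    exact this
  obtain ⟨n, hn⟩ := exists_pow_mul_eq_zero_of_res_basicOpen_eq_zero_of_isAffineOpen X hD a s hz
  have := (mem_nonZeroDivisors_iff_left.mp (pow_mem hs n)) a hn
  simp [this]

theorem exists_mem_basicOpen_of_span_eq_top {X : Scheme.{u}} {D : X.Opens} (hD : IsAffineOpen D)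
    {S : Set Γ(X, D)} (hS : Ideal.span S = ⊤) {x : X} (hx : x ∈ D) :
    ∃ f ∈ S, x ∈ X.basicOpen f := by
  have := (hD.iSup_basicOpen_eq_self_iff (s := S)).mpr hS
  rw [← this] at hx
  obtain ⟨⟨f, hf⟩, h⟩ := TopologicalSpace.Opens.mem_iSup.mp hx
  exact ⟨f, hf, h⟩

theorem span_cofactors_eq_top {A : Type*} [CommRing A] (J K : Ideal A) (s : A)
    (hs : s ∈ nonZeroDivisors A) (h : J * K = Ideal.span {s}) :
    Ideal.span {u | ∃ j ∈ J, ∃ k ∈ K, j * k = s * u} = ⊤ := by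
  have h1 : J * K ≤ Ideal.span {s} * Ideal.span {u | ∃ j ∈ J, ∃ k ∈ K, j * k = s * u} := by
    rw [Ideal.mul_le]
    intro j hj k hk
    obtain ⟨u, hu⟩ := Ideal.mem_span_singleton'.mp (h ▸ Ideal.mul_mem_mul hj hk)
    rw [← hu, mul_comm u s]
    refine Ideal.mul_mem_mul (Ideal.mem_span_singleton_self s) (Ideal.subset_span ?_)
    exact ⟨j, hj, k, hk, by rw [← hu, mul_comm]⟩
  have h2 : s ∈ J * K := h ▸ Ideal.mem_span_singleton_self s
  obtain ⟨n, hn, e⟩ := Ideal.mem_span_singleton_mul.mp (h1 h2)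
  have : n = 1 := by
    have h3 : s * (n - 1) = 0 := by rw [mul_sub, e, mul_one, sub_self]
    exact sub_eq_zero.mp ((mem_nonZeroDivisors_iff_left.mp hs) _ h3)
  rw [Ideal.eq_top_iff_one, ← this]
  exact hn

theorem eq_span_of_mul_eq_span {A : Type*} [CommRing A] {J K : Ideal A} {j k : A}
    (hs : j * k ∈ nonZeroDivisors A) (h : J * K = Ideal.span {j * k}) (hj : j ∈ J) (hk : k ∈ K) :
    j ∈ nonZeroDivisors A ∧ J = Ideal.span {j} := by
  obtain ⟨hj', hk'⟩ := mul_mem_nonZeroDivisors.mp hs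
  refine ⟨hj', le_antisymm (fun a ha => ?_) ((Ideal.span_singleton_le_iff_mem _).mpr hj)⟩
  obtain ⟨b, hb⟩ := Ideal.mem_span_singleton'.mp (h ▸ Ideal.mul_mem_mul ha hk)
  rw [Ideal.mem_span_singleton']
  refine ⟨b, ?_⟩
  have : (b * j - a) * k = 0 := by rw [sub_mul, ← hb]; ring
  exact sub_eq_zero.mp ((mem_nonZeroDivisors_iff_right.mp hk') _ this)

theorem secs_basicOpen {X : Scheme.{u}} (J : X.IdealSheafData) {D : X.Opens} (hD : IsAffineOpen D)
    (u : Γ(X, D)) : secs J (X.basicOpen u) (hD.basicOpen u) =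
      (secs J D hD).map (X.presheaf.map (homOfLE (X.basicOpen_le u)).op).hom :=
  (secs_map J _ _ _).symm

theorem flat_res {X : Scheme.{u}} {D E : X.Opens} (hD : IsAffineOpen D) (hE : IsAffineOpen E)
    (h : E ≤ D) : (X.presheaf.map (homOfLE h).op).hom.Flat := by
  have := flat_appLE (𝟙 X) hD hE h
  rwa [show Scheme.Hom.appLE (𝟙 X) D E h = X.presheaf.map (homOfLE h).op from
    Category.id_comp _] at this

theorem isUnit_res_basicOpen {X : Scheme.{u}} {D : X.Opens} (u : Γ(X, D)) :
    IsUnit ((X.presheaf.map (homOfLE (X.basicOpen_le u)).op).hom u) :=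
  X.toRingedSpace.isUnit_res_basicOpen u

theorem IsCartier.of_mul_left {X : Scheme.{u}} {J K : X.IdealSheafData} (h : IsCartier (J * K)) :
    IsCartier J := by
  intro x
  obtain ⟨D, hD, hx, s, hs, hJK⟩ := h x
  obtain ⟨u, ⟨j, hj, k, hk, e⟩, hxu⟩ := exists_mem_basicOpen_of_span_eq_top hD
    (span_cofactors_eq_top _ _ s hs hJK) hx
  let ρ := (X.presheaf.map (homOfLE (X.basicOpen_le u)).op).hom
  have hu : IsUnit (ρ u) := isUnit_res_basicOpen u
  have hρ : ρ j * ρ k = ρ s * ρ u := by rw [← map_mul, e, map_mul]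
  have hs' : ρ s ∈ nonZeroDivisors _ :=
    map_mem_nonZeroDivisors_of_flat ρ (flat_res hD (hD.basicOpen u) _) hs
  have := eq_span_of_mul_eq_span (J := secs J _ (hD.basicOpen u)) (K := secs K _ (hD.basicOpen u))
    (j := ρ j) (k := ρ k) (by rw [hρ]; exact mul_mem hs' hu.mem_nonZeroDivisors) ?_ ?_ ?_
  · exact ⟨_, hD.basicOpen u, hxu, _, this.1, this.2⟩
  · rw [← secs_mul, secs_basicOpen _ hD, hJK, Ideal.map_span, Set.image_singleton, hρ,
      Ideal.span_singleton_mul_right_unit hu]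
  · rw [secs_basicOpen _ hD]; exact Ideal.mem_map_of_mem _ hj
  · rw [secs_basicOpen _ hD]; exact Ideal.mem_map_of_mem _ hk

theorem IsCartier.of_mul_right {X : Scheme.{u}} {J K : X.IdealSheafData} (h : IsCartier (J * K)) :
    IsCartier K := by
  rw [mul_comm] at h; exact h.of_mul_left

section

open HomogeneousLocalization

/-- Projective space over `A` with `n` homogeneous coordinates, presented by its standard charts
`Spec (ring i)`, on which `t i j` is the ratio of the coordinates `j` and `i`. -/
structure ProjSpace (A : CommRingCat.{u}) (n : ℕ) where
  carrier : Scheme.{u}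
  str : carrier ⟶ Spec A
  proper : IsProper str
  ring : Fin n → CommRingCat.{u}
  alg : ∀ i, A ⟶ ring i
  chart : ∀ i, Spec (ring i) ⟶ carrier
  isOpenImmersion : ∀ i, IsOpenImmersion (chart i)
  covers : ∀ x, ∃ i, x ∈ Set.range (chart i)
  chart_str : ∀ i, chart i ≫ str = Spec.map (alg i)
  t : ∀ i, Fin n → ring i
  t_self : ∀ i, t i i = 1
  hom_ext : ∀ (i) {E : CommRingCat.{u}} (a b : ring i ⟶ E), alg i ≫ a = alg i ≫ b →
    (∀ j, a (t i j) = b (t i j)) → a = b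
  exists_hom : ∀ (i) {E : CommRingCat.{u}} (ψ : A ⟶ E) (v : Fin n → E), v i = 1 →
    ∃ a : ring i ⟶ E, alg i ≫ a = ψ ∧ ∀ j, a (t i j) = v j
  preimage : ∀ i k, chart i ⁻¹ᵁ (chart k).opensRange = PrimeSpectrum.basicOpen (t i k)
  mul_t : ∀ (i k) {E : CommRingCat.{u}} (a : ring i ⟶ E) (b : ring k ⟶ E),
    Spec.map a ≫ chart i = Spec.map b ≫ chart k → ∀ j, a (t i j) = a (t i k) * b (t k j)

attribute [local instance] MvPolynomial.gradedAlgebra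

section
variable (A : Type u) [CommRing A] (n : ℕ)

abbrev grading : ℕ → Submodule A (MvPolynomial (Fin n) A) :=
  MvPolynomial.homogeneousSubmodule (Fin n) A

theorem X_mem (i : Fin n) : (MvPolynomial.X i : MvPolynomial (Fin n) A) ∈ grading A n 1 :=
  MvPolynomial.isHomogeneous_X A i

instance : Algebra.FiniteType (grading A n 0) (MvPolynomial (Fin n) A) := by
  have : IsScalarTower A (grading A n 0) (MvPolynomial (Fin n) A) :=
    ⟨fun x y z => smul_mul_assoc x (y : MvPolynomial (Fin n) A) z⟩
  exact Algebra.FiniteType.of_restrictScalars_finiteType A _ _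

theorem algebraMap_bijective : Function.Bijective (algebraMap A (grading A n 0)) := by
  constructor
  · intro a b h
    have := congrArg (fun x : grading A n 0 => (x : MvPolynomial (Fin n) A)) h
    exact MvPolynomial.C_injective _ _ this
  · rintro ⟨x, hx⟩
    have h := hx
    rw [grading, MvPolynomial.homogeneousSubmodule_zero, Submodule.mem_one] at h
    obtain ⟨a, ha⟩ := h
    exact ⟨a, Subtype.ext ha⟩

noncomputable abbrev toBase : Proj (grading A n) ⟶ Spec (.of A) :=
  Proj.toSpecZero (grading A n) ≫ Spec.map (CommRingCat.ofHom (algebraMap A (grading A n 0)))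

instance : IsProper (toBase A n) := by
  have : IsIso (CommRingCat.ofHom (algebraMap A (grading A n 0))) :=
    (RingEquiv.ofBijective _ (algebraMap_bijective A n)).toCommRingCatIso.isIso_hom
  infer_instance

noncomputable abbrev ratio (i j : Fin n) : Away (grading A n) (MvPolynomial.X i) :=
  Away.mk _ (X_mem A n i) 1 (MvPolynomial.X j) (by simpa using X_mem A n j)

theorem eval₂_mul_of_isHomogeneous {σ A E : Type*} [Finite σ] [CommRing A] [CommRing E]
    (f : A →+* E) (g : σ → E)
    (c : E) {d : ℕ} {p : MvPolynomial σ A} (hp : p.IsHomogeneous d) :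
    p.eval₂ f (fun j => c * g j) = c ^ d * p.eval₂ f g := by
  have := Fintype.ofFinite σ
  rw [MvPolynomial.eval₂_eq', MvPolynomial.eval₂_eq', Finset.mul_sum]
  refine Finset.sum_congr rfl fun m hm => ?_
  have h : m.degree = d := by
    by_contra h
    exact (MvPolynomial.mem_support_iff.mp hm) (hp.coeff_eq_zero h)
  simp_rw [mul_pow]
  rw [Finset.prod_mul_distrib, Finset.prod_pow_eq_pow_sum, ← h, Finsupp.degree_eq_sum]
  ring

abbrev Loc (i : Fin n) := Localization.Away (MvPolynomial.X i : MvPolynomial (Fin n) A)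

theorem X_mul_ratio (i j : Fin n) :
    algebraMap (MvPolynomial (Fin n) A) (Loc A n i) (MvPolynomial.X i) * (ratio A n i j).val =
      algebraMap (MvPolynomial (Fin n) A) (Loc A n i) (MvPolynomial.X j) := by
  rw [Away.val_mk, Localization.mk_eq_mk']
  simp_rw [pow_one]
  exact IsLocalization.mk'_spec' (Loc A n i) (MvPolynomial.X j)
    (⟨MvPolynomial.X i, _⟩ : Submonoid.powers (MvPolynomial.X i))

theorem val_zero_algebraMap (i : Fin n) (a : A) :
    (fromZeroRingHom (grading A n) (Submonoid.powers (MvPolynomial.X i))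
        (algebraMap A (grading A n 0) a)).val =
      algebraMap (MvPolynomial (Fin n) A) (Loc A n i) (MvPolynomial.C a) :=
  Localization.mk_one_eq_algebraMap _

/-- A homogeneous polynomial divided by a power of `X i` is the polynomial in the ratios. -/
theorem mk_eq (i : Fin n) (d : ℕ) (p : MvPolynomial (Fin n) A) (hp : p ∈ grading A n (d • 1)) :
    Away.mk (grading A n) (X_mem A n i) d p hp =
      MvPolynomial.eval₂ ((fromZeroRingHom (grading A n) _).comp (algebraMap A _)) (ratio A n i)
          p := by
  apply HomogeneousLocalization.val_injective
  rw [← HomogeneousLocalization.algebraMap_apply (y := MvPolynomial.eval₂ _ _ _),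
    MvPolynomial.hom_eval₂, Away.val_mk]
  have hp' : p.IsHomogeneous d := by simpa using hp
  rw [Localization.mk_eq_mk', IsLocalization.mk'_eq_iff_eq_mul, mul_comm]
  simp only [map_pow]
  rw [← eval₂_mul_of_isHomogeneous _ _ _ hp']
  have h' : ∀ j, algebraMap (MvPolynomial (Fin n) A) (Loc A n i) (MvPolynomial.X i) *
      algebraMap (Away (grading A n) (MvPolynomial.X i)) (Loc A n i) (ratio A n i j) =
      algebraMap (MvPolynomial (Fin n) A) (Loc A n i) (MvPolynomial.X j) := X_mul_ratio A n i
  simp_rw [h']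
  have h : ((algebraMap (Away (grading A n) (MvPolynomial.X i)) (Loc A n i)).comp
      ((fromZeroRingHom (grading A n) (Submonoid.powers (MvPolynomial.X i))).comp (algebraMap A _)))
          =
      (algebraMap (MvPolynomial (Fin n) A) (Loc A n i)).comp MvPolynomial.C := by
    ext a
    exact val_zero_algebraMap A n i a
  rw [h]
  exact DFunLike.congr_fun (MvPolynomial.ringHom_ext (by simp) (by simp) :
    algebraMap (MvPolynomial (Fin n) A) (Loc A n i) = MvPolynomial.eval₂Hom
      ((algebraMap (MvPolynomial (Fin n) A) (Loc A n i)).comp MvPolynomial.C) _) p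

/-- The ring map out of a chart given by coordinates with `i`-th coordinate one. -/
noncomputable def awayHom {E : Type*} [CommRing E] (ψ : A →+* E) (v : Fin n → E) (i : Fin n)
    (hi : v i = 1) :
    Away (grading A n) (MvPolynomial.X i) →+* E :=
  (IsLocalization.Away.lift (S := Localization.Away (MvPolynomial.X i : MvPolynomial (Fin n) A))
      (MvPolynomial.X i) (g := MvPolynomial.eval₂Hom ψ v) (by simp [hi])).comp (algebraMap _ _)

theorem awayHom_zero {E : Type*} [CommRing E] (ψ : A →+* E) (v : Fin n → E) (i : Fin n)
    (hi : v i = 1) (a : A) :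
    awayHom A n ψ v i hi (fromZeroRingHom _ _ (algebraMap A (grading A n 0) a)) = ψ a := by
  rw [awayHom, RingHom.comp_apply, HomogeneousLocalization.algebraMap_apply, val_zero_algebraMap]
  simp

theorem awayHom_ratio {E : Type*} [CommRing E] (ψ : A →+* E) (v : Fin n → E) (i : Fin n)
    (hi : v i = 1) (j : Fin n) :
    awayHom A n ψ v i hi (ratio A n i j) = v j := by
  simp [awayHom, Localization.mk_eq_mk']
  rw [IsLocalization.Away.lift, IsLocalization.lift_mk'_spec]
  simp [hi]

theorem ratio_self (i : Fin n) : ratio A n i i = 1 := by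
  apply HomogeneousLocalization.val_injective
  rw [Away.val_mk, HomogeneousLocalization.val_one]
  simp_rw [pow_one]
  exact Localization.mk_self (M := MvPolynomial (Fin n) A)
    (⟨MvPolynomial.X i, _⟩ : Submonoid.powers (MvPolynomial.X i : MvPolynomial (Fin n) A))

theorem awayMap_ratio (i k j : Fin n) :
    awayMap (grading A n) (X_mem A n k) rfl (ratio A n i j) =
      awayMap (grading A n) (X_mem A n k) rfl (ratio A n i k) *
        awayMap (grading A n) (f := MvPolynomial.X k) (X_mem A n i) (mul_comm _ _)
            (ratio A n k j) := by
  rw [awayMap_mk, awayMap_mk, awayMap_mk]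
  apply HomogeneousLocalization.val_injective
  rw [HomogeneousLocalization.val_mul, Away.val_mk, Away.val_mk, Away.val_mk, Localization.mk_mul,
    Localization.mk_eq_mk_iff, Localization.r_iff_exists]
  refine ⟨1, ?_⟩
  simp
  ring

theorem isLocalizationElem_eq (i k : Fin n) :
    Away.isLocalizationElem (X_mem A n i) (X_mem A n k) = ratio A n i k := by
  apply HomogeneousLocalization.val_injective
  simp [Away.val_mk]

theorem away_hom_ext (i : Fin n) {E : Type*} [CommRing E]
    (a b : Away (grading A n) (MvPolynomial.X i) →+* E)
    (h : a.comp ((fromZeroRingHom (grading A n) _).comp (algebraMap A _)) =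
      b.comp ((fromZeroRingHom (grading A n) _).comp (algebraMap A _)))
    (h' : ∀ j, a (ratio A n i j) = b (ratio A n i j)) : a = b := by
  ext x
  obtain ⟨d, p, hp, rfl⟩ := Away.mk_surjective _ (X_mem A n i) x
  rw [mk_eq, MvPolynomial.hom_eval₂, MvPolynomial.hom_eval₂, h]
  congr 1
  funext j
  exact h' j

noncomputable def projSpace : ProjSpace (.of A) n where
  carrier := Proj (grading A n)
  str := toBase A n
  proper := inferInstance
  ring i := .of (Away (grading A n) (MvPolynomial.X i))
  alg i := CommRingCat.ofHom ((fromZeroRingHom (grading A n) _).comp (algebraMap A _))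
  chart i := Proj.awayι (grading A n) (MvPolynomial.X i) (X_mem A n i) one_pos
  isOpenImmersion i := inferInstance
  covers x := by
    have h : ⨆ i, Proj.basicOpen (grading A n) (MvPolynomial.X i) = ⊤ := by
      refine Proj.iSup_basicOpen_eq_top' _ _ (fun i => ⟨1, X_mem A n i⟩) ?_
      refine top_le_iff.mp fun p _ => ?_
      have : p ∈ Algebra.adjoin A (Set.range
          (MvPolynomial.X : Fin n → MvPolynomial (Fin n) A)) := by
        rw [MvPolynomial.adjoin_range_X]; trivial
      induction this using Algebra.adjoin_induction with
      | mem x hx => exact Algebra.subset_adjoin hx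
      | algebraMap r =>
        exact Subalgebra.algebraMap_mem (Algebra.adjoin (grading A n 0) _)
            (algebraMap A (grading A n 0) r)
      | add x y _ _ hx hy => exact add_mem (hx trivial) (hy trivial)
      | mul x y _ _ hx hy => exact mul_mem (hx trivial) (hy trivial)
    have hx : x ∈ ⨆ i, Proj.basicOpen (grading A n) (MvPolynomial.X i) := h ▸ trivial
    obtain ⟨i, hi⟩ := TopologicalSpace.Opens.mem_iSup.mp hx
    refine ⟨i, ?_⟩
    rw [← Proj.opensRange_awayι _ _ (X_mem A n i) one_pos] at hi
    exact hi
  chart_str i := by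
    rw [toBase, Proj.awayι_toSpecZero_assoc, ← Spec.map_comp, ← CommRingCat.ofHom_comp]
  t i j := ratio A n i j
  t_self := ratio_self A n
  hom_ext i E a b h h' := by
    ext1
    exact away_hom_ext A n i _ _ (congrArg CommRingCat.Hom.hom h) h'
  exists_hom i E ψ v hv := ⟨CommRingCat.ofHom (awayHom A n ψ.hom v i hv), by
    ext a
    exact awayHom_zero A n ψ.hom v i hv a, awayHom_ratio A n ψ.hom v i hv⟩
  preimage i k := by
    rw [Proj.opensRange_awayι, Proj.awayι_preimage_basicOpen _ (X_mem A n i) one_pos (X_mem A n k)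
        one_pos,
      isLocalizationElem_eq]
  mul_t i k E a b h j := by
    let l := pullback.lift _ _ h ≫ (Proj.pullbackAwayιIso (grading A n) (X_mem A n i) one_pos
        (X_mem A n k) one_pos rfl).hom
    obtain ⟨c, hc⟩ := Spec.map_surjective l
    have h1 : Spec.map a = Spec.map c ≫ Spec.map
        (CommRingCat.ofHom (awayMap (grading A n) (X_mem A n k) rfl)) := by
      rw [hc, Category.assoc, Proj.pullbackAwayιIso_hom_SpecMap_awayMap_left, pullback.lift_fst]
    have h2 : Spec.map b = Spec.map c ≫ Spec.map
        (CommRingCat.ofHom (awayMap (grading A n) (X_mem A n i) (mul_comm _ _))) := by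
      rw [hc, Category.assoc, Proj.pullbackAwayιIso_hom_SpecMap_awayMap_right, pullback.lift_snd]
    rw [← Spec.map_comp] at h1 h2
    rw [Spec.map_injective h1, Spec.map_injective h2]
    have := congrArg c.hom (awayMap_ratio A n i k j)
    rw [map_mul] at this
    exact this
end

end

theorem ProjSpace.alg_eq {A : CommRingCat.{u}} {n : ℕ} (P : ProjSpace A n) {i k : Fin n}
    {E : CommRingCat.{u}} {a : P.ring i ⟶ E} {b : P.ring k ⟶ E}
    (h : Spec.map a ≫ P.chart i = Spec.map b ≫ P.chart k) : P.alg i ≫ a = P.alg k ≫ b := by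
  apply Spec.map_injective
  rw [Spec.map_comp, Spec.map_comp, ← P.chart_str, ← P.chart_str, reassoc_of% h]

theorem ProjSpace.glue_eq {A : CommRingCat.{u}} {n : ℕ} (P : ProjSpace A n) {i k : Fin n}
    {E : CommRingCat.{u}} (a : P.ring i ⟶ E) (b : P.ring k ⟶ E) (hab : P.alg i ≫ a = P.alg k ≫ b)
    (h : ∀ j, a (P.t i j) = a (P.t i k) * b (P.t k j)) :
    Spec.map a ≫ P.chart i = Spec.map b ≫ P.chart k := by
  have hu : IsUnit (a (P.t i k)) := by
    refine IsUnit.of_mul_eq_one (b (P.t k i)) ?_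
    rw [← h i, P.t_self, map_one]
  have := P.isOpenImmersion k
  have hr : Set.range (Spec.map a ≫ P.chart i) ⊆ Set.range (P.chart k) := by
    rintro _ ⟨x, rfl⟩
    have hx : (Spec.map a) x ∈ P.chart i ⁻¹ᵁ (P.chart k).opensRange := by
      rw [P.preimage]
      intro hx
      exact x.2.ne_top (Ideal.eq_top_of_isUnit_mem _ hx hu)
    simpa using hx
  obtain ⟨c, hc⟩ := Spec.map_surjective (IsOpenImmersion.lift (P.chart k) _ hr)
  have hc' : Spec.map a ≫ P.chart i = Spec.map c ≫ P.chart k := by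
    rw [hc, IsOpenImmersion.lift_fac]
  have hcb : c = b := by
    refine P.hom_ext k c b ((P.alg_eq hc').symm.trans hab) fun j => ?_
    have := P.mul_t i k a c hc' j
    rw [h j] at this
    exact (hu.mul_left_cancel this).symm
  rw [hc', hcb]

theorem toImage_dominant {X Y : Scheme.{u}} (f : X ⟶ Y) [QuasiCompact f] :
    IsSchemeTheoreticallyDominant f.toImage := by
  refine ⟨le_bot_iff.mp (ideal_le fun x => ?_)⟩
  obtain ⟨U, hU, hx, -⟩ := exists_affine_mem_le ⊤ (f.imageι x) trivial
  refine ⟨f.imageι ⁻¹ᵁ U, hU.preimage f.imageι, hx, ?_⟩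
  have h : secs f.toImage.ker (f.imageι ⁻¹ᵁ U) (hU.preimage f.imageι) = RingHom.ker
      (f.toImage.app (f.imageι ⁻¹ᵁ U)).hom := f.toImage.ker_apply _
  rw [h, (RingHom.injective_iff_ker_eq_bot _).mp (f.toImage_app_injective ⟨U, hU⟩)]
  exact bot_le

theorem exists_spec_mem_le {X : Scheme.{u}} (O : X.Opens) (x : X) (hx : x ∈ O) :
    ∃ (F : CommRingCat.{u}) (q : Spec F ⟶ X), IsOpenImmersion q ∧ x ∈ Set.range q ∧
      Set.range q ⊆ O := by
  obtain ⟨D, hD, hxD, h⟩ := exists_affine_mem_le O x hx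
  refine ⟨_, hD.fromSpec, inferInstance, ?_, ?_⟩
  · rw [hD.range_fromSpec]; exact hxD
  · rw [hD.range_fromSpec]; exact h

theorem eq_zero_of_dominant {X : Scheme.{u}} {E : CommRingCat.{u}} (s : X ⟶ Spec E)
    [QuasiCompact s] [IsSchemeTheoreticallyDominant s] (x : E)
    (h : ∀ p : X, ∃ (F : CommRingCat.{u}) (q : Spec F ⟶ X), IsOpenImmersion q ∧ p ∈ Set.range q ∧
      ∀ ψ : E ⟶ F, Spec.map ψ = q ≫ s → ψ x = 0) : x = 0 := by
  choose F q hq hp hx using h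
  have hinj := s.app_injective ⊤
  apply (ConcreteCategory.bijective_of_isIso (Scheme.ΓSpecIso E).inv).1
  apply hinj
  rw [map_zero, map_zero]
  let 𝒰 : X.OpenCover := .mkOfCovers X (fun p => Spec (F p)) q (fun p => ⟨p, hp p⟩) hq
  refine 𝒰.ext_elem _ _ fun p => ?_
  obtain ⟨ψ, hψ⟩ := Spec.map_surjective (q p ≫ s)
  have h1 := hx p ψ hψ
  have h2 : (Scheme.ΓSpecIso E).inv ≫ (q p ≫ s).appTop = ψ ≫ (Scheme.ΓSpecIso (F p)).inv := by
    rw [← hψ, Scheme.ΓSpecIso_inv_naturality]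
  have h3 := ConcreteCategory.congr_hom h2 x
  simp only [ConcreteCategory.comp_apply, h1, map_zero] at h3
  rw [map_zero]
  exact h3

section
variable (A : Type u) [CommRing A] {n : ℕ} (f : Fin n → A)

noncomputable def loc (i : Fin n) : CommRingCat.of A ⟶ CommRingCat.of (Localization.Away (f i)) :=
  CommRingCat.ofHom (algebraMap A (Localization.Away (f i)))

theorem isUnit_loc (i : Fin n) : IsUnit (loc A f i (f i)) :=
  IsLocalization.Away.algebraMap_isUnit (S := Localization.Away (f i)) (f i)

theorem exists_pr (i : Fin n) :
    ∃ a : (projSpace A n).ring i ⟶ CommRingCat.of (Localization.Away (f i)),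
      (projSpace A n).alg i ≫ a = loc A f i ∧
        ∀ j, loc A f i (f j) = loc A f i (f i) * a ((projSpace A n).t i j) := by
  obtain ⟨v, hv⟩ := isUnit_loc A f i
  obtain ⟨a, ha, ha'⟩ := (projSpace A n).exists_hom i (loc A f i)
    (fun j => (v⁻¹ : _) * loc A f i (f j)) (by rw [← hv]; simp)
  refine ⟨a, ha, fun j => ?_⟩
  rw [ha', ← hv]; simp

noncomputable def pr (i : Fin n) :
    (projSpace A n).ring i ⟶ CommRingCat.of (Localization.Away (f i)) :=
  (exists_pr A f i).choose

theorem alg_pr (i : Fin n) : (projSpace A n).alg i ≫ pr A f i = loc A f i :=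
  (exists_pr A f i).choose_spec.1

theorem pr_t (i j : Fin n) :
    loc A f i (f j) = loc A f i (f i) * pr A f i ((projSpace A n).t i j) :=
  (exists_pr A f i).choose_spec.2 j

/-- The map to projective space given by the `f j`, defined where some `f i` is invertible. -/
noncomputable def unitMap :
    (∐ fun i : Fin n => Spec (CommRingCat.of (Localization.Away (f i)))) ⟶
      (projSpace A n).carrier :=
  Sigma.desc fun i => Spec.map (pr A f i) ≫ (projSpace A n).chart i

theorem ι_unitMap (i : Fin n) :
    Sigma.ι (fun i : Fin n => Spec (CommRingCat.of (Localization.Away (f i)))) i ≫ unitMap A f =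
      Spec.map (pr A f i) ≫ (projSpace A n).chart i := by
  simp [unitMap]

instance : QuasiCompact (unitMap A f) := by
  have := (projSpace A n).proper
  have : QuasiCompact (unitMap A f ≫ (projSpace A n).str) := inferInstance
  exact .of_comp _ (projSpace A n).str

noncomputable def blow : Scheme.{u} := (unitMap A f).image

noncomputable def blowι : blow A f ⟶ (projSpace A n).carrier := (unitMap A f).imageι

noncomputable def blowDom :
    (∐ fun i : Fin n => Spec (CommRingCat.of (Localization.Away (f i)))) ⟶ blow A f :=
  (unitMap A f).toImage

theorem blowDom_ι : blowDom A f ≫ blowι A f = unitMap A f := (unitMap A f).toImage_imageι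

instance : IsClosedImmersion (blowι A f) := inferInstanceAs (IsClosedImmersion (unitMap A f).imageι)
instance : QuasiCompact (blowDom A f) :=
  inferInstanceAs (QuasiCompact (unitMap A f).toImage)
instance : IsSchemeTheoreticallyDominant (blowDom A f) := toImage_dominant (unitMap A f)

noncomputable def blowπ : blow A f ⟶ Spec (.of A) := blowι A f ≫ (projSpace A n).str

instance : IsProper (blowπ A f) := by
  have := (projSpace A n).proper
  unfold blowπ; infer_instance

theorem ι_blowDom_ι (i : Fin n) :
    Sigma.ι (fun i : Fin n => Spec (CommRingCat.of (Localization.Away (f i)))) i ≫ blowDom A f ≫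
      blowι A f = Spec.map (pr A f i) ≫ (projSpace A n).chart i := by
  rw [blowDom_ι, ι_unitMap]

/-- An element of an open affine subscheme of the blow-up vanishes if it vanishes wherever some
`f i` is invertible. -/
theorem blow_eq_zero {E : CommRingCat.{u}} (l : Spec E ⟶ blow A f) [Flat l] (x : E)
    (h : ∀ (F : CommRingCat.{u}) (ψ : E ⟶ F) (i : Fin n)
      (a : CommRingCat.of (Localization.Away (f i)) ⟶ F),
      Spec.map ψ ≫ l ≫ blowι A f = Spec.map (pr A f i ≫ a) ≫ (projSpace A n).chart i → ψ x = 0) :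
    x = 0 := by
  refine eq_zero_of_dominant (pullback.snd (blowDom A f) l) x fun p => ?_
  let p' := pullback.fst (blowDom A f) l p
  obtain ⟨i, y, hy⟩ : ∃ (i : Fin n) (y : Spec (CommRingCat.of (Localization.Away (f i)))),
      Sigma.ι (fun i : Fin n => Spec (CommRingCat.of (Localization.Away (f i)))) i y = p' :=
    ⟨_, (sigmaOpenCover _).covers p'⟩
  let ι : Spec (CommRingCat.of (Localization.Away (f i))) ⟶ _ :=
    Sigma.ι (fun i : Fin n => Spec (CommRingCat.of (Localization.Away (f i)))) i
  obtain ⟨F, q, hq, hpq, hr⟩ := exists_spec_mem_le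
    (pullback.fst (blowDom A f) l ⁻¹ᵁ (ι.opensRange)) p ⟨y, hy⟩
  refine ⟨F, q, hq, hpq, fun ψ hψ => ?_⟩
  have hr' : Set.range (q ≫ pullback.fst (blowDom A f) l) ⊆ Set.range ι := by
    rintro _ ⟨z, rfl⟩
    have := hr ⟨z, rfl⟩
    simpa using this
  obtain ⟨a, ha⟩ := Spec.map_surjective (IsOpenImmersion.lift ι _ hr')
  refine h F ψ i a ?_
  rw [Spec.map_comp, Category.assoc, ← ι_blowDom_ι, ha, IsOpenImmersion.lift_fac_assoc, hψ,
    Category.assoc, ← pullback.condition_assoc, Category.assoc]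

/-- On the `k`-th chart, the blow-up ideal is generated by the regular element `f k`. -/
theorem blow_rel {E : CommRingCat.{u}} (l : Spec E ⟶ blow A f) [Flat l] (k : Fin n)
    (b : (projSpace A n).ring k ⟶ E)
    (hb : l ≫ blowι A f = Spec.map b ≫ (projSpace A n).chart k) :
    ((projSpace A n).alg k ≫ b) (f k) ∈ nonZeroDivisors E ∧
      ∀ j, ((projSpace A n).alg k ≫ b) (f j) =
        ((projSpace A n).alg k ≫ b) (f k) * b ((projSpace A n).t k j) := by
  have key : ∀ (F : CommRingCat.{u}) (ψ : E ⟶ F) (i : Fin n)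
      (a : CommRingCat.of (Localization.Away (f i)) ⟶ F),
      Spec.map ψ ≫ l ≫ blowι A f = Spec.map (pr A f i ≫ a) ≫ (projSpace A n).chart i →
      IsUnit (ψ (((projSpace A n).alg k ≫ b) (f k))) ∧
      ∀ j, ψ (((projSpace A n).alg k ≫ b) (f j)) =
        ψ (((projSpace A n).alg k ≫ b) (f k)) * ψ (b ((projSpace A n).t k j)) := by
    intro F ψ i a h
    rw [hb, ← Spec.map_comp_assoc] at h
    have h1 := (projSpace A n).alg_eq h
    rw [← Category.assoc, ← Category.assoc, alg_pr] at h1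
    have h2 : ∀ x, ψ (((projSpace A n).alg k ≫ b) x) = a (loc A f i x) := fun x =>
      ConcreteCategory.congr_hom h1 x
    have h3 := (projSpace A n).mul_t i k _ _ h.symm
    simp only [ConcreteCategory.comp_apply] at h3
    have h4 : ∀ j, a (loc A f i (f j)) = a (loc A f i (f i)) * a
        (pr A f i ((projSpace A n).t i j)) :=
      fun j => by rw [pr_t, map_mul]
    have h5 : ∀ j, a (loc A f i (f j)) = a (loc A f i (f k)) * ψ (b ((projSpace A n).t k j)) := by
      intro j
      rw [h4 j, h3 j, h4 k, mul_assoc]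
    refine ⟨?_, fun j => ?_⟩
    · rw [h2]
      refine isUnit_of_mul_isUnit_left (y := ψ (b ((projSpace A n).t k i))) ?_
      rw [← h5]
      exact (isUnit_loc A f i).map a.hom
    · rw [h2, h2, h5]
  refine ⟨?_, fun j => ?_⟩
  · rw [mem_nonZeroDivisors_iff_right]
    intro x hx
    refine blow_eq_zero A f l x fun F ψ i a h => ?_
    have := congrArg ψ hx
    rw [map_mul, map_zero] at this
    exact (key F ψ i a h).1.mul_left_eq_zero.mp this
  · rw [← sub_eq_zero]
    refine blow_eq_zero A f l _ fun F ψ i a h => ?_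
    rw [map_sub, map_mul, (key F ψ i a h).2 j, sub_self]

end

theorem hom_ext_local {X Y : Scheme.{u}} {f g : X ⟶ Y}
    (h : ∀ p : X, ∃ (F : CommRingCat.{u}) (q : Spec F ⟶ X), IsOpenImmersion q ∧ p ∈ Set.range q ∧
      q ≫ f = q ≫ g) : f = g := by
  choose F q hq hp hx using h
  let 𝒰 : X.OpenCover := .mkOfCovers X (fun p => Spec (F p)) q (fun p => ⟨p, hp p⟩) hq
  exact 𝒰.hom_ext _ _ hx

theorem exists_spec_lift {X Y : Scheme.{u}} (f : X ⟶ Y) {Z : Scheme.{u}} (q : Z ⟶ Y)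
    [IsOpenImmersion q] (x : X) (hx : f x ∈ Set.range q) (O : X.Opens) (hO : x ∈ O) :
    ∃ (F : CommRingCat.{u}) (r : Spec F ⟶ X) (l : Spec F ⟶ Z), IsOpenImmersion r ∧
      x ∈ Set.range r ∧ Set.range r ⊆ O ∧ r ≫ f = l ≫ q := by
  obtain ⟨F, r, hr, hxr, h⟩ := exists_spec_mem_le (f ⁻¹ᵁ q.opensRange ⊓ O) x ⟨hx, hO⟩
  have hr' : Set.range (r ≫ f) ⊆ Set.range q := by
    rintro _ ⟨z, rfl⟩
    simpa using (h ⟨z, rfl⟩).1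
  exact ⟨F, r, IsOpenImmersion.lift q (r ≫ f) hr', hr, hxr, fun z hz => (h hz).2,
    (IsOpenImmersion.lift_fac _ _ _).symm⟩

theorem specMap_dominant {A B : CommRingCat.{u}} (φ : A ⟶ B) (h : Function.Injective φ) :
    IsSchemeTheoreticallyDominant (Spec.map φ) := by
  refine ⟨le_bot_iff.mp (ideal_le fun x => ⟨⊤, isAffineOpen_top _, trivial, ?_⟩)⟩
  have e : secs (Spec.map φ).ker ⊤ (isAffineOpen_top _) = RingHom.ker (Spec.map φ).appTop.hom :=
    (Spec.map φ).ker_apply _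
  rw [e]
  intro s hs
  have h1 := ConcreteCategory.congr_hom (Scheme.ΓSpecIso_naturality φ) s
  simp only [ConcreteCategory.comp_apply] at h1
  rw [show (Spec.map φ).appTop s = 0 from hs, map_zero] at h1
  have h2 := h (h1.symm.trans (map_zero φ.hom).symm)
  have h3 : s = 0 := (ConcreteCategory.bijective_of_isIso (Scheme.ΓSpecIso A).hom).1
    (h2.trans (map_zero _).symm)
  rw [h3]; exact zero_mem _

/-- If a family generates an invertible ideal sheaf on an affine open, then locally one of its
members is a regular generator. -/
theorem IsCartier.exists_generator {X : Scheme.{u}} {J : X.IdealSheafData} (hJ : IsCartier J)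
    {D : X.Opens} (hD : IsAffineOpen D) {ι : Type*} (v : ι → Γ(X, D))
    (hv : secs J D hD = Ideal.span (Set.range v)) (x : X) (hx : x ∈ D) :
    ∃ (i : ι) (E : X.Opens) (hE : IsAffineOpen E) (hED : E ≤ D), x ∈ E ∧
      (X.presheaf.map (homOfLE hED).op).hom (v i) ∈ nonZeroDivisors Γ(X, E) ∧
      secs J E hE = Ideal.span {(X.presheaf.map (homOfLE hED).op).hom (v i)} := by
  obtain ⟨D', hD', hx', hDD', s, hs, h⟩ := hJ.exists_le D x hx
  have h1 := secs_map J hD' hD hDD'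
  rw [hv, h, Ideal.map_span] at h1
  let w : ι → Γ(X, D') := fun i => (X.presheaf.map (homOfLE hDD').op).hom (v i)
  have h2 : Ideal.span (Set.range w) = Ideal.span {s} := by
    rw [← h1, ← Set.range_comp]; rfl
  have h3 : ∀ i, ∃ u, u * s = w i := fun i =>
    Ideal.mem_span_singleton'.mp (h2 ▸ Ideal.subset_span ⟨i, rfl⟩)
  choose u hu using h3
  have h4 : Ideal.span (Set.range u) = ⊤ := by
    rw [Ideal.eq_top_iff_one]
    have h5 : Ideal.span (Set.range w) = Ideal.span {s} * Ideal.span (Set.range u) := by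
      rw [Ideal.span_mul_span', Set.singleton_mul, ← Set.range_comp]
      congr 2
      ext i
      rw [← hu i, mul_comm]; rfl
    have h6 : s ∈ Ideal.span {s} * Ideal.span (Set.range u) := by
      rw [← h5, h2]; exact Ideal.mem_span_singleton_self s
    obtain ⟨c, hc, hcs⟩ := Ideal.mem_span_singleton_mul.mp h6
    have : c = 1 := (mul_cancel_left_mem_nonZeroDivisors hs).mp (by rw [hcs, mul_one])
    exact this ▸ hc
  obtain ⟨_, ⟨i, rfl⟩, hxi⟩ := exists_mem_basicOpen_of_span_eq_top hD' h4 hx'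
  let ρ := (X.presheaf.map (homOfLE (X.basicOpen_le (u i))).op).hom
  have hρ : ρ (w i) = (X.presheaf.map (homOfLE ((X.basicOpen_le (u i)).trans hDD')).op).hom
      (v i) := by
    change (X.presheaf.map _ ≫ X.presheaf.map _).hom (v i) = _
    rw [← Functor.map_comp]; rfl
  have hun : IsUnit (ρ (u i)) := isUnit_res_basicOpen (u i)
  have hsn : ρ s ∈ nonZeroDivisors _ :=
    map_mem_nonZeroDivisors_of_flat _ (flat_res hD' (hD'.basicOpen (u i)) _) hs
  refine ⟨i, X.basicOpen (u i), hD'.basicOpen (u i), (X.basicOpen_le (u i)).trans hDD', hxi, ?_, ?_⟩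
  · rw [← hρ, ← hu, map_mul]
    exact mul_mem hun.mem_nonZeroDivisors hsn
  · rw [secs_basicOpen J hD' (u i), h, Ideal.map_span, Set.image_singleton, ← hρ, ← hu, map_mul]
    exact (Ideal.span_singleton_mul_left_unit hun _).symm

theorem secs_comap_spec {A E : CommRingCat.{u}} {ι : Type*} (f : ι → A)
    {I : (Spec A).IdealSheafData} (hI : secs I ⊤ (isAffineOpen_top _) =
      (Ideal.span (Set.range f)).map (Scheme.ΓSpecIso A).inv.hom) (ψ : A ⟶ E) :
    secs (I.comap (Spec.map ψ)) ⊤ (isAffineOpen_top _) =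
      (Ideal.span (Set.range fun i => ψ (f i))).map (Scheme.ΓSpecIso E).inv.hom := by
  rw [secs_comap_top, hI, Ideal.map_map, ← CommRingCat.hom_comp, ← Scheme.ΓSpecIso_inv_naturality,
    CommRingCat.hom_comp, ← Ideal.map_map]
  congr 1
  rw [Ideal.map_span, ← Set.range_comp]
  rfl

theorem isCartier_of_secs_spec {E : CommRingCat.{u}} {J : (Spec E).IdealSheafData} (s : E)
    (hs : s ∈ nonZeroDivisors E) (h : secs J ⊤ (isAffineOpen_top _) =
      (Ideal.span {s}).map (Scheme.ΓSpecIso E).inv.hom) : IsCartier J := by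
  refine fun x => ⟨⊤, isAffineOpen_top _, trivial, (Scheme.ΓSpecIso E).inv.hom s, ?_, ?_⟩
  · let e := (Scheme.ΓSpecIso E).symm.commRingCatIsoToRingEquiv
    exact map_mem_nonZeroDivisors_of_flat e.toRingHom (RingHom.Flat.of_bijective e.bijective) hs
  · rw [h, Ideal.map_span, Set.image_singleton]

theorem span_range_eq_of_dvd {E : Type*} [CommRing E] {ι : Type*} (w : ι → E) (k : ι)
    (h : ∀ j, ∃ b, w j = w k * b) : Ideal.span (Set.range w) = Ideal.span {w k} := by
  apply le_antisymm
  · rw [Ideal.span_le]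
    rintro _ ⟨j, rfl⟩
    obtain ⟨b, hb⟩ := h j
    exact Ideal.mem_span_singleton.mpr ⟨b, hb⟩
  · rw [Ideal.span_singleton_le_iff_mem]
    exact Ideal.subset_span ⟨k, rfl⟩

/-- Locally on the source, pulling back an ideal to an invertible one makes one of the given
generators a regular generator. -/
theorem IsCartier.exists_spec {A : CommRingCat.{u}} {ι : Type*} (f : ι → A)
    {I : (Spec A).IdealSheafData} (hI : secs I ⊤ (isAffineOpen_top _) =
      (Ideal.span (Set.range f)).map (Scheme.ΓSpecIso A).inv.hom) {T : Scheme.{u}}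
    (g : T ⟶ Spec A) (hg : IsCartier (I.comap g)) (x : T) (O : T.Opens) (hx : x ∈ O) :
    ∃ (F : CommRingCat.{u}) (q : Spec F ⟶ T) (ψ : A ⟶ F) (i : ι), IsOpenImmersion q ∧
      x ∈ Set.range q ∧ Set.range q ⊆ O ∧ q ≫ g = Spec.map ψ ∧ ψ (f i) ∈ nonZeroDivisors F ∧
      ∀ j, ∃ b, ψ (f j) = ψ (f i) * b := by
  obtain ⟨D, hD, hxD, hDO⟩ := exists_affine_mem_le O x hx
  have hle : D ≤ g ⁻¹ᵁ ⊤ := le_top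
  have h1 : secs (I.comap g) D hD = Ideal.span (Set.range fun i =>
      ((Scheme.ΓSpecIso A).inv ≫ g.appLE ⊤ D hle) (f i)) := by
    rw [secs_comap I g (isAffineOpen_top _) hD hle, hI, Ideal.map_map, ← CommRingCat.hom_comp,
      Ideal.map_span, ← Set.range_comp]
    rfl
  obtain ⟨i, E, hE, hED, hxE, hn, hs⟩ := hg.exists_generator hD _ h1 x hxD
  let ψ : A ⟶ Γ(T, E) := (Scheme.ΓSpecIso A).inv ≫ g.appLE ⊤ D hle ≫
    T.presheaf.map (homOfLE hED).op
  refine ⟨Γ(T, E), hE.fromSpec, ψ, i, inferInstance, ?_, ?_, ?_, hn, fun j => ?_⟩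
  · rw [hE.range_fromSpec]; exact hxE
  · rw [hE.range_fromSpec]; exact hED.trans hDO
  · have := IsAffineOpen.SpecMap_appLE_fromSpec g (isAffineOpen_top (Spec A)) hE (hED.trans hle)
    rw [← this, IsAffineOpen.fromSpec_top, Scheme.isoSpec_Spec_inv, ← Spec.map_comp]
    congr 2
    exact (Scheme.Hom.appLE_map _ _ _).symm
  · have h2 := secs_map (I.comap g) hE hD hED
    rw [hs, h1, Ideal.map_span] at h2
    have h3 : ψ (f j) ∈ Ideal.span {ψ (f i)} :=
      h2 ▸ Ideal.subset_span ⟨_, ⟨j, rfl⟩, rfl⟩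
    obtain ⟨b, hb⟩ := Ideal.mem_span_singleton.mp h3
    exact ⟨b, hb⟩

theorem exists_injective_isUnit {E : CommRingCat.{u}} (s : E) (hs : s ∈ nonZeroDivisors E) :
    ∃ (L : CommRingCat.{u}) (r : E ⟶ L), Function.Injective r ∧ IsUnit (r s) :=
  ⟨.of (Localization.Away s), CommRingCat.ofHom (algebraMap E _),
    IsLocalization.injective _ (Submonoid.powers_le.mpr hs : Submonoid.powers s ≤ _),
    IsLocalization.Away.algebraMap_isUnit (S := Localization.Away s) s⟩

theorem isUnit_of_span_eq_top {E : CommRingCat.{u}} {J : (Spec E).IdealSheafData} (s : E)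
    (h : secs J ⊤ (isAffineOpen_top _) = (Ideal.span {s}).map (Scheme.ΓSpecIso E).inv.hom)
    (hJ : J = ⊤) : IsUnit s := by
  have h1 : (Ideal.span {s}).map (Scheme.ΓSpecIso E).inv.hom = ⊤ := by
    rw [← h, hJ]; rfl
  have h2 := congrArg (Ideal.map (Scheme.ΓSpecIso E).hom.hom) h1
  rw [Ideal.map_map, ← CommRingCat.hom_comp, Iso.inv_hom_id, CommRingCat.hom_id, Ideal.map_id,
    Ideal.map_top, Ideal.span_singleton_eq_top] at h2
  exact h2

section
variable (A : Type u) [CommRing A] {n : ℕ} (f : Fin n → A)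

theorem exists_blow_chart (x : blow A f) : ∃ (E : CommRingCat.{u}) (l : Spec E ⟶ blow A f)
    (k : Fin n) (b : (projSpace A n).ring k ⟶ E), IsOpenImmersion l ∧ x ∈ Set.range l ∧
      l ≫ blowι A f = Spec.map b ≫ (projSpace A n).chart k := by
  obtain ⟨k, hk⟩ := (projSpace A n).covers (blowι A f x)
  have := (projSpace A n).isOpenImmersion k
  obtain ⟨E, l, m, hl, hx, -, h⟩ := exists_spec_lift (blowι A f) ((projSpace A n).chart k) x hk ⊤
    trivial
  obtain ⟨b, rfl⟩ := Spec.map_surjective m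
  exact ⟨E, l, k, b, hl, hx, h⟩

theorem chart_blowπ {E : CommRingCat.{u}} (l : Spec E ⟶ blow A f)
    (k : Fin n) (b : (projSpace A n).ring k ⟶ E)
    (hb : l ≫ blowι A f = Spec.map b ≫ (projSpace A n).chart k) :
    l ≫ blowπ A f = Spec.map ((projSpace A n).alg k ≫ b) := by
  rw [blowπ, reassoc_of% hb, (projSpace A n).chart_str, Spec.map_comp]

theorem isCartier_blow {I : (Spec (.of A)).IdealSheafData} (hI : secs I ⊤ (isAffineOpen_top _) =
      (Ideal.span (Set.range f)).map (Scheme.ΓSpecIso (.of A)).inv.hom) :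
    IsCartier (I.comap (blowπ A f)) := by
  refine .of_cover fun x => ?_
  obtain ⟨E, l, k, b, hl, hx, hb⟩ := exists_blow_chart A f x
  refine ⟨_, l, hl, hx, ?_⟩
  rw [← IdealSheafData.comap_comp, chart_blowπ A f l k b hb]
  obtain ⟨h1, h2⟩ := blow_rel A f l k b hb
  refine isCartier_of_secs_spec _ h1 ?_
  rw [secs_comap_spec (A := .of A) f hI, span_range_eq_of_dvd _ k fun j => ⟨_, h2 j⟩]

theorem exists_loc_lift {E : CommRingCat.{u}} (ψ : CommRingCat.of A ⟶ E) (i : Fin n)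
    (h : IsUnit (ψ (f i))) :
    ∃ c : CommRingCat.of (Localization.Away (f i)) ⟶ E, loc A f i ≫ c = ψ :=
  ⟨CommRingCat.ofHom (IsLocalization.Away.lift (f i) (g := ψ.hom) h),
    CommRingCat.hom_ext (IsLocalization.Away.lift_comp (f i) h)⟩

theorem exists_lift_spec {E : CommRingCat.{u}} (ψ : CommRingCat.of A ⟶ E) (i : Fin n)
    (hi : ψ (f i) ∈ nonZeroDivisors E) (h : ∀ j, ∃ b, ψ (f j) = ψ (f i) * b) :
    ∃ l : Spec E ⟶ blow A f, l ≫ blowπ A f = Spec.map ψ := by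
  choose v hv using h
  have hv1 : v i = 1 := by
    refine (mul_cancel_left_mem_nonZeroDivisors hi).mp ?_
    rw [← hv, mul_one]
  obtain ⟨a, ha, hav⟩ := (projSpace A n).exists_hom i ψ v hv1
  obtain ⟨L, r, hr, hu⟩ := exists_injective_isUnit _ hi
  obtain ⟨c, hc⟩ := exists_loc_lift A f (ψ ≫ r) i hu
  have hac : a ≫ r = pr A f i ≫ c := by
    refine (projSpace A n).hom_ext i _ _ ?_ fun j => ?_
    · rw [reassoc_of% ha, reassoc_of% alg_pr, hc]
    · refine hu.mul_left_cancel ?_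
      have h1 : ∀ x, c (loc A f i x) = r (ψ x) := fun x => ConcreteCategory.congr_hom hc x
      have h2 := congrArg c (pr_t A f i j)
      rw [map_mul, h1, h1] at h2
      rw [ConcreteCategory.comp_apply, ConcreteCategory.comp_apply, ← h2, hav, ← map_mul, ← hv]
  have hker : (blowι A f).ker ≤ (Spec.map a ≫ (projSpace A n).chart i).ker := by
    have := specMap_dominant r hr
    have e : (Spec.map r ≫ Spec.map a ≫ (projSpace A n).chart i).ker =
        (Spec.map a ≫ (projSpace A n).chart i).ker := by
      rw [Scheme.Hom.ker_comp, (Spec.map r).ker_eq_bot, IdealSheafData.map_bot]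
    rw [← e, ← Spec.map_comp_assoc, hac, Spec.map_comp_assoc, ← ι_blowDom_ι, ← Category.assoc,
      ← Category.assoc]
    exact Scheme.Hom.le_ker_comp _ _
  refine ⟨IsClosedImmersion.lift _ _ hker, ?_⟩
  rw [blowπ, IsClosedImmersion.lift_fac_assoc, Category.assoc, (projSpace A n).chart_str,
    ← Spec.map_comp, ha]

/-- Over the locus where `f i` is invertible, the blow-up has at most one point over each point of
the base. -/
theorem blow_lift_unique {E : CommRingCat.{u}} (l : Spec E ⟶ blow A f) (i : Fin n)
    (c : CommRingCat.of (Localization.Away (f i)) ⟶ E)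
    (hl : l ≫ blowπ A f = Spec.map (loc A f i ≫ c)) :
    l ≫ blowι A f = Spec.map (pr A f i ≫ c) ≫ (projSpace A n).chart i := by
  refine hom_ext_local fun p => ?_
  obtain ⟨E', l', k, b, hl', hp, hb⟩ := exists_blow_chart A f (l p)
  obtain ⟨F, q, m, hq, hpq, -, h⟩ := exists_spec_lift l l' p hp ⊤ trivial
  obtain ⟨d, rfl⟩ := Spec.map_surjective m
  obtain ⟨e, rfl⟩ := Spec.map_surjective q
  refine ⟨F, Spec.map e, hq, hpq, ?_⟩
  rw [reassoc_of% h, hb, ← Spec.map_comp_assoc, ← Spec.map_comp_assoc]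
  have h1 : ((projSpace A n).alg k ≫ b) ≫ d = loc A f i ≫ c ≫ e := by
    apply Spec.map_injective
    rw [Spec.map_comp, ← chart_blowπ A f l' k b hb, ← reassoc_of% h, hl, ← Spec.map_comp,
      Category.assoc]
  have h2 : ∀ x, d (((projSpace A n).alg k ≫ b) x) = e (c (loc A f i x)) := fun x =>
    ConcreteCategory.congr_hom h1 x
  have hu : IsUnit (e (c (loc A f i (f i)))) := ((isUnit_loc A f i).map c.hom).map e.hom
  have h3 : ∀ j, e (c (loc A f i (f j))) =
      e (c (loc A f i (f k))) * d (b ((projSpace A n).t k j)) := fun j => by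
    rw [← h2, (blow_rel A f l' k b hb).2 j, map_mul, h2]
  refine ((projSpace A n).glue_eq _ _ ?_ fun j => ?_).symm
  · rw [Category.assoc, reassoc_of% alg_pr, ← h1, Category.assoc]
  · simp only [ConcreteCategory.comp_apply]
    refine hu.mul_left_cancel ?_
    have h4 : ∀ j, e (c (loc A f i (f i))) * e (c (pr A f i ((projSpace A n).t i j))) =
      e (c (loc A f i (f j))) := fun j => by rw [pr_t A f i j, map_mul, map_mul]
    rw [← mul_assoc, h4, h4, h3]

theorem blow_hom_ext {I : (Spec (.of A)).IdealSheafData} (hI : secs I ⊤ (isAffineOpen_top _) =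
      (Ideal.span (Set.range f)).map (Scheme.ΓSpecIso (.of A)).inv.hom) {T : Scheme.{u}}
    (l₁ l₂ : T ⟶ blow A f) (h : l₁ ≫ blowπ A f = l₂ ≫ blowπ A f)
    (hT : IsCartier (I.comap (l₁ ≫ blowπ A f))) : l₁ = l₂ := by
  let J := I.comap (l₁ ≫ blowπ A f)
  let U : T.Opens := ⟨(J.support : Set T)ᶜ, J.support.isClosed.isOpen_compl⟩
  have := hT.isSchemeTheoreticallyDominant U subset_rfl
  refine ext_of_isSchemeTheoreticallyDominant (blowπ A f) h U.ι (hom_ext_local fun p => ?_)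
  have hU : IsCartier (I.comap (U.ι ≫ l₁ ≫ blowπ A f)) := by
    rw [IdealSheafData.comap_comp]; exact hT.comap_of_flat U.ι
  obtain ⟨F, q, ψ, i, hq, hp, -, hψ, -, hb⟩ :=
    hU.exists_spec (A := .of A) f hI _ p ⊤ trivial
  have hu : IsUnit (ψ (f i)) := by
    refine isUnit_of_span_eq_top (J := I.comap (Spec.map ψ)) _ ?_ ?_
    · rw [secs_comap_spec (A := .of A) f hI, span_range_eq_of_dvd _ i hb]
    · rw [← IdealSheafData.support_eq_bot_iff, ← hψ, ← Category.assoc, IdealSheafData.comap_comp,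
        IdealSheafData.support_comap]
      rw [eq_bot_iff]
      intro x hx
      exact (q x).2 hx
  obtain ⟨c, hc⟩ := exists_loc_lift A f ψ i hu
  refine ⟨F, q, hq, hp, ?_⟩
  rw [← cancel_mono (blowι A f)]
  rw [blow_lift_unique A f (q ≫ U.ι ≫ l₁) i c (by rw [hc, ← hψ]; simp),
    blow_lift_unique A f (q ≫ U.ι ≫ l₂) i c (by rw [hc, ← hψ]; simp [h])]

end

theorem hom_ext_of_cover {T B : Scheme.{u}} {ι : Type u} {Z : ι → Scheme.{u}} (q : ∀ i, Z i ⟶ T)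
    (hq : ∀ i, IsOpenImmersion (q i)) (hc : ∀ x, ∃ i, x ∈ Set.range (q i)) (f g : T ⟶ B)
    (h : ∀ i, q i ≫ f = q i ≫ g) : f = g :=
  Scheme.Cover.hom_ext (Cover.mkOfCovers ι Z q (fun x => by simpa using hc x) hq : T.OpenCover)
    _ _ h

theorem exists_glue {T B : Scheme.{u}} {ι : Type u} {Z : ι → Scheme.{u}} (q : ∀ i, Z i ⟶ T)
    (hq : ∀ i, IsOpenImmersion (q i)) (hc : ∀ x, ∃ i, x ∈ Set.range (q i)) (l : ∀ i, Z i ⟶ B)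
    (h : ∀ i j, pullback.fst (q i) (q j) ≫ l i = pullback.snd (q i) (q j) ≫ l j) :
    ∃ g : T ⟶ B, ∀ i, q i ≫ g = l i := by
  let 𝒰 : T.OpenCover := Cover.mkOfCovers ι Z q (fun x => by simpa using hc x) hq
  have h' : ∀ i j : 𝒰.I₀, pullback.fst (𝒰.f i) (𝒰.f j) ≫ l i = pullback.snd (𝒰.f i) (𝒰.f j) ≫ l j :=
      h
  exact ⟨𝒰.glueMorphisms l h', fun i => 𝒰.ι_glueMorphisms l h' i⟩

/-- The universal property of the blow-up of an ideal sheaf, together with properness. -/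
structure IsBlowup {Y B : Scheme.{u}} (I : Y.IdealSheafData) (π : B ⟶ Y) : Prop where
  proper : IsProper π
  cartier : IsCartier (I.comap π)
  lift : ∀ (T : Scheme.{u}) (g : T ⟶ Y), IsCartier (I.comap g) → ∃ l : T ⟶ B, l ≫ π = g
  unique : ∀ (T : Scheme.{u}) (l₁ l₂ : T ⟶ B), l₁ ≫ π = l₂ ≫ π →
    IsCartier (I.comap (l₁ ≫ π)) → l₁ = l₂

namespace IsBlowup

theorem pullback_snd {Y B V : Scheme.{u}} {I : Y.IdealSheafData} {π : B ⟶ Y} (h : IsBlowup I π)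
    (j : V ⟶ Y) [IsOpenImmersion j] : IsBlowup (I.comap j) (pullback.snd π j) where
  proper := have := h.proper; inferInstance
  cartier := by
    rw [← IdealSheafData.comap_comp, ← pullback.condition, IdealSheafData.comap_comp]
    exact h.cartier.comap_of_flat _
  lift T g hg := by
    rw [← IdealSheafData.comap_comp] at hg
    obtain ⟨l, hl⟩ := h.lift T _ hg
    exact ⟨pullback.lift l g hl, pullback.lift_snd _ _ _⟩
  unique T l₁ l₂ hl hT := by
    refine pullback.hom_ext (h.unique T _ _ ?_ ?_) hl
    · rw [Category.assoc, Category.assoc, pullback.condition, ← Category.assoc, hl, Category.assoc]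
    · rwa [Category.assoc, pullback.condition, ← Category.assoc, IdealSheafData.comap_comp]

theorem exists_iso {Y B B' : Scheme.{u}} {I : Y.IdealSheafData} {π : B ⟶ Y} {π' : B' ⟶ Y}
    (h : IsBlowup I π) (h' : IsBlowup I π') : ∃ e : B ≅ B', e.hom ≫ π' = π := by
  obtain ⟨a, ha⟩ := h'.lift B π h.cartier
  obtain ⟨b, hb⟩ := h.lift B' π' h'.cartier
  refine ⟨⟨a, b, ?_, ?_⟩, ha⟩
  · refine h.unique _ _ _ (by simp [ha, hb]) ?_
    rw [Category.assoc, hb, ha]; exact h.cartier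
  · refine h'.unique _ _ _ (by simp [ha, hb]) ?_
    rw [Category.assoc, ha, hb]; exact h'.cartier

theorem isPullback {Y B V B' : Scheme.{u}} {I : Y.IdealSheafData} {π : B ⟶ Y} (h : IsBlowup I π)
    (j : V ⟶ Y) [IsOpenImmersion j] {π' : B' ⟶ V} (h' : IsBlowup (I.comap j) π')
    (l : B' ⟶ B) (hl : l ≫ π = π' ≫ j) : IsPullback l π' π j := by
  obtain ⟨e, he⟩ := h'.exists_iso (h.pullback_snd j)
  refine IsPullback.of_iso (IsPullback.of_hasPullback π j) e.symm (Iso.refl _) (Iso.refl _)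
    (Iso.refl _) ?_ ?_ (by simp) (by simp)
  · rw [Iso.refl_hom, Category.comp_id, Iso.symm_hom]
    have he' : e.inv ≫ π' = pullback.snd π j := by rw [← he, Iso.inv_hom_id_assoc]
    have hc := (h.pullback_snd j).cartier
    refine h.unique _ _ _ ?_ ?_
    · rw [Category.assoc, pullback.condition, hl, reassoc_of% he']
    · rwa [pullback.condition, IdealSheafData.comap_comp]
  · simp [← he]

theorem of_cover {Y B : Scheme.{u}} {I : Y.IdealSheafData} {π : B ⟶ Y} {K : Type u}
    {V : K → Scheme.{u}} (v : ∀ i, V i ⟶ Y) (hv : ∀ i, IsOpenImmersion (v i))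
    (hc : ∀ x, ∃ i, x ∈ Set.range (v i))
    {D : K → Scheme.{u}} (ι : ∀ i, D i ⟶ B) (p : ∀ i, D i ⟶ V i)
    (hp : ∀ i, IsPullback (ι i) (p i) π (v i))
    (h : ∀ i, IsBlowup (I.comap (v i)) (p i)) : IsBlowup I π := by
  have hcov : ∀ {T : Scheme.{u}} (g : T ⟶ Y) (x : T), ∃ i,
      x ∈ Set.range (pullback.fst g (v i)) := by
    intro T g x
    obtain ⟨i, y, hy⟩ := hc (g x)
    obtain ⟨z, hz, -⟩ := Scheme.Pullback.exists_preimage_pullback x y hy.symm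
    exact ⟨i, z, hz⟩
  have huniq : ∀ (T : Scheme.{u}) (l₁ l₂ : T ⟶ B), l₁ ≫ π = l₂ ≫ π →
      IsCartier (I.comap (l₁ ≫ π)) → l₁ = l₂ := by
    intro T l₁ l₂ hl hT
    refine hom_ext_of_cover (fun i => pullback.fst (l₁ ≫ π) (v i))
      (fun i => inferInstance) (hcov _) _ _ fun i => ?_
    have h1 : (pullback.fst (l₁ ≫ π) (v i) ≫ l₁) ≫ π =
      pullback.snd (l₁ ≫ π) (v i) ≫ v i := by rw [Category.assoc, pullback.condition]
    have h2 : (pullback.fst (l₁ ≫ π) (v i) ≫ l₂) ≫ π =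
      pullback.snd (l₁ ≫ π) (v i) ≫ v i := by rw [← h1, Category.assoc, ← hl, Category.assoc]
    have h3 : (hp i).lift _ _ h1 = (hp i).lift _ _ h2 := by
      refine (h i).unique _ _ _ (by simp) ?_
      rw [IsPullback.lift_snd, ← IdealSheafData.comap_comp, ← pullback.condition,
        IdealSheafData.comap_comp]
      exact hT.comap_of_flat _
    have h4 := congrArg (· ≫ ι i) h3
    simpa using h4
  refine ⟨?_, ?_, ?_, huniq⟩
  · refine IsZariskiLocalAtTarget.of_openCover
      (Cover.mkOfCovers K V v (fun x => by simpa using hc x) hv : Y.OpenCover) fun i => ?_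
    have := (h i).proper
    have e : (hp i).isoPullback.inv ≫ p i = pullback.snd π (v i) := by simp
    change IsProper (pullback.snd π (v i))
    rw [← e]
    infer_instance
  · refine .of_cover fun x => ?_
    obtain ⟨i, y, hy⟩ := hc (π x)
    obtain ⟨z, hz, -⟩ := exists_preimage_of_isPullback (hp i) x y hy.symm
    have : IsOpenImmersion (ι i) := MorphismProperty.of_isPullback (hp i).flip inferInstance
    refine ⟨_, ι i, this, ⟨z, hz⟩, ?_⟩
    rw [← IdealSheafData.comap_comp, (hp i).w, IdealSheafData.comap_comp]
    exact (h i).cartier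
  · intro T g hg
    have hc : ∀ i, IsCartier ((I.comap (v i)).comap (pullback.snd g (v i))) := fun i => by
      rw [← IdealSheafData.comap_comp, ← pullback.condition, IdealSheafData.comap_comp]
      exact hg.comap_of_flat _
    choose l hl using fun i => (h i).lift _ _ (hc i)
    have hl' : ∀ i, (l i ≫ ι i) ≫ π = pullback.fst g (v i) ≫ g := fun i => by
      rw [Category.assoc, (hp i).w, reassoc_of% hl i, pullback.condition]
    obtain ⟨m, hm⟩ := exists_glue (fun i => pullback.fst g (v i)) (fun i => inferInstance)
      (hcov g) (fun i => l i ≫ ι i) fun i j => by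
        refine huniq _ _ _ ?_ ?_
        · rw [Category.assoc, hl', Category.assoc, hl']
          exact pullback.condition_assoc _
        · rw [Category.assoc, hl', ← Category.assoc, IdealSheafData.comap_comp]
          exact hg.comap_of_flat _
    refine ⟨m, hom_ext_of_cover (fun i => pullback.fst g (v i)) (fun i => inferInstance)
      (hcov g) _ _ fun i => ?_⟩
    rw [reassoc_of% hm, ← hl', Category.assoc]

theorem of_iso_base {Y Y' B : Scheme.{u}} {I : Y.IdealSheafData} {π : B ⟶ Y} (h : IsBlowup I π)
    (e : Y ≅ Y') : IsBlowup (I.comap e.inv) (π ≫ e.hom) where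
  proper := have := h.proper; inferInstance
  cartier := by
    rw [← IdealSheafData.comap_comp, Category.assoc, Iso.hom_inv_id, Category.comp_id]
    exact h.cartier
  lift T g hg := by
    rw [← IdealSheafData.comap_comp] at hg
    obtain ⟨l, hl⟩ := h.lift T _ hg
    exact ⟨l, by rw [reassoc_of% hl]; simp⟩
  unique T l₁ l₂ hl hT := by
    refine h.unique T l₁ l₂ ?_ ?_
    · rwa [← cancel_mono e.hom, Category.assoc, Category.assoc]
    · rwa [← IdealSheafData.comap_comp, Category.assoc, Category.assoc, Iso.hom_inv_id,
        Category.comp_id] at hT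

end IsBlowup

theorem exists_blowup_spec (A : CommRingCat.{u}) [IsNoetherianRing A]
    (I : (Spec A).IdealSheafData) :
    ∃ (B : Scheme.{u}) (π : B ⟶ Spec A), IsBlowup I π := by
  let J : Ideal A := (secs I ⊤ (isAffineOpen_top _)).map (Scheme.ΓSpecIso A).hom.hom
  obtain ⟨n, f, hf⟩ := Submodule.fg_iff_exists_fin_generating_family.mp
    ((isNoetherianRing_iff_ideal_fg A).mp ‹_› J)
  have hI : secs I ⊤ (isAffineOpen_top _) =
      (Ideal.span (Set.range f)).map (Scheme.ΓSpecIso (.of A)).inv.hom := by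
    have e : Ideal.span (Set.range f) = J := hf
    rw [e, Ideal.map_map, ← CommRingCat.hom_comp]
    erw [Iso.hom_inv_id]
    rw [CommRingCat.hom_id, Ideal.map_id]
  refine ⟨blow A f, blowπ A f, inferInstance, isCartier_blow A f hI, fun T g hg => ?_,
    fun T l₁ l₂ => blow_hom_ext A f hI l₁ l₂⟩
  choose F q ψ i hq hx hr hψ hn hd using fun x : T => hg.exists_spec (A := .of A) f hI _ x ⊤ trivial
  choose l hl using fun x : T => exists_lift_spec A f (ψ x) (i x) (hn x) (hd x)
  have e : ∀ z, l z ≫ blowπ A f = q z ≫ g := fun z => (hl z).trans (hψ z).symm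
  obtain ⟨m, hm⟩ := exists_glue q hq (fun x => ⟨x, hx x⟩) l fun x y => by
    refine blow_hom_ext A f hI _ _ ?_ ?_
    · rw [Category.assoc, e, Category.assoc, e, pullback.condition_assoc]
    · rw [Category.assoc, e, ← Category.assoc, IdealSheafData.comap_comp]
      exact hg.comap_of_flat _
  exact ⟨m, hom_ext_of_cover q hq (fun x => ⟨x, hx x⟩) _ _ fun x => by rw [reassoc_of% hm, e]⟩

theorem exists_blowup_of_isAffine (Y : Scheme.{u}) [IsAffine Y] [IsLocallyNoetherian Y]
    (I : Y.IdealSheafData) : ∃ (B : Scheme.{u}) (π : B ⟶ Y), IsBlowup I π := by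
  have : IsNoetherianRing Γ(Y, ⊤) := IsLocallyNoetherian.component_noetherian ⟨⊤,
      isAffineOpen_top Y⟩
  obtain ⟨B, π, h⟩ := exists_blowup_spec Γ(Y, ⊤) (I.comap Y.isoSpec.inv)
  refine ⟨B, π ≫ Y.isoSpec.inv, ?_⟩
  have := h.of_iso_base Y.isoSpec.symm
  rwa [← IdealSheafData.comap_comp, Iso.symm_inv, Iso.hom_inv_id, IdealSheafData.comap_id] at this

section
variable (Y : Scheme.{u}) [IsLocallyNoetherian Y] (I : Y.IdealSheafData)

theorem exists_blowup_affineOpen (U : Y.affineOpens) :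
    ∃ (B : Scheme.{u}) (π : B ⟶ U.1), IsBlowup (I.comap U.1.ι) π := by
  have : IsAffine U.1 := U.2
  exact exists_blowup_of_isAffine _ _

noncomputable def locB (U : Y.affineOpens) : Scheme.{u} := (exists_blowup_affineOpen Y I U).choose

noncomputable def locπ (U : Y.affineOpens) : locB Y I U ⟶ U.1 :=
  (exists_blowup_affineOpen Y I U).choose_spec.choose

theorem isBlowup_locπ (U : Y.affineOpens) : IsBlowup (I.comap U.1.ι) (locπ Y I U) :=
  (exists_blowup_affineOpen Y I U).choose_spec.choose_spec

theorem exists_locMap {U V : Y.affineOpens} (h : U ≤ V) :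
    ∃ l : locB Y I U ⟶ locB Y I V, l ≫ locπ Y I V = locπ Y I U ≫ Y.homOfLE h := by
  refine (isBlowup_locπ Y I V).lift _ _ ?_
  rw [← IdealSheafData.comap_comp, Category.assoc, Scheme.homOfLE_ι, IdealSheafData.comap_comp]
  exact (isBlowup_locπ Y I U).cartier

noncomputable def locMap {U V : Y.affineOpens} (h : U ≤ V) : locB Y I U ⟶ locB Y I V :=
  (exists_locMap Y I h).choose

theorem locMap_π {U V : Y.affineOpens} (h : U ≤ V) :
    locMap Y I h ≫ locπ Y I V = locπ Y I U ≫ Y.homOfLE h := (exists_locMap Y I h).choose_spec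

theorem locMap_unique {U V : Y.affineOpens} (h : U ≤ V) (l₁ l₂ : locB Y I U ⟶ locB Y I V)
    (h₁ : l₁ ≫ locπ Y I V = locπ Y I U ≫ Y.homOfLE h)
    (h₂ : l₂ ≫ locπ Y I V = locπ Y I U ≫ Y.homOfLE h) : l₁ = l₂ := by
  refine (isBlowup_locπ Y I V).unique _ _ _ (h₁.trans h₂.symm) ?_
  rw [h₁, ← IdealSheafData.comap_comp, Category.assoc, Scheme.homOfLE_ι, IdealSheafData.comap_comp]
  exact (isBlowup_locπ Y I U).cartier

noncomputable def locFunctor : Y.affineOpens ⥤ Scheme.{u} where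
  obj U := locB Y I U
  map h := locMap Y I (leOfHom h)
  map_id U := locMap_unique Y I le_rfl _ _ (locMap_π Y I _) (by simp)
  map_comp {U V W} f g := locMap_unique Y I (leOfHom f |>.trans (leOfHom g)) _ _
      (locMap_π Y I _) (by
    rw [Category.assoc, locMap_π, reassoc_of% locMap_π, Scheme.homOfLE_homOfLE])

noncomputable def locData : Scheme.Cover.RelativeGluingData Y.directedAffineCover where
  functor := locFunctor Y I
  natTrans :=
    { app := fun U => locπ Y I U
      naturality := fun U V h => locMap_π Y I (leOfHom h) }
  equifibered := fun U V h => by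
    have h1 := isBlowup_locπ Y I U
    have h2 : U.1.ι = Y.homOfLE (leOfHom h) ≫ V.1.ι := by simp
    rw [h2, IdealSheafData.comap_comp] at h1
    exact (isBlowup_locπ Y I V).isPullback _ h1 _ (locMap_π Y I (leOfHom h))

instance : Quiver.IsThin Y.directedAffineCover.I₀ := inferInstanceAs (Quiver.IsThin Y.affineOpens)
instance : Small.{u} Y.directedAffineCover.I₀ := inferInstanceAs (Small.{u} Y.affineOpens)

theorem exists_blowup : ∃ (B : Scheme.{u}) (π : B ⟶ Y), IsBlowup I π :=
  ⟨_, (locData Y I).toBase, .of_cover (K := Y.affineOpens) (V := fun U => U.1) (fun U => U.1.ι)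
    (fun U => inferInstance)
    (fun x => by
      obtain ⟨D, hD, hx, -⟩ := exists_affine_mem_le ⊤ x trivial
      exact ⟨⟨D, hD⟩, by simpa using hx⟩) _ _
    (fun U => ((locData Y I).isPullback_natTrans_ι_toBase U).flip)
    (fun U => isBlowup_locπ Y I U)⟩

end

section

variable {X Y Z T W : Scheme.{u}}

theorem isPullback_comp_mono (f : X ⟶ Y) (g : Y ⟶ Z) [Mono g] :
    IsPullback f (𝟙 X) g (f ≫ g) :=
  IsPullback.of_isLimit' ⟨by simp⟩ (PullbackCone.IsLimit.mk _ (fun s => s.snd)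
    (fun s => by rw [← cancel_mono g, Category.assoc, s.condition]) (fun s => by simp)
    (fun s m h1 h2 => by simpa using h2))

theorem comap_map_of_isOpenImmersion (I : X.IdealSheafData) (j : X ⟶ Y) [IsOpenImmersion j]
    [QuasiCompact j] : (I.map j).comap j = I := by
  have h := isPullback_comp_mono I.subschemeι j
  refine IdealSheafData.ext (funext fun D => ?_)
  rw [IdealSheafData.ideal_comap_of_isOpenImmersion]
  conv_rhs => rw [← I.ker_subschemeι]
  rw [ker_ideal_of_isPullback_of_isOpenImmersion _ _ _ _ h]
  rfl

theorem comap_eq_top_iff {I : Y.IdealSheafData} {f : X ⟶ Y} :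
    I.comap f = ⊤ ↔ ∀ x, f x ∉ I.support := by
  rw [← IdealSheafData.support_eq_bot_iff, IdealSheafData.support_comap, SetLike.ext_iff]
  exact forall_congr' fun x => ⟨fun h h' => h.1 h', fun h => ⟨fun h' => h h', fun h' => h'.elim⟩⟩

theorem isBlowup_top (X : Scheme.{u}) : IsBlowup ⊤ (𝟙 X) where
  proper := inferInstance
  cartier := by rw [IdealSheafData.comap_top]; exact isCartier_top
  lift T g _ := ⟨g, by simp⟩
  unique T l₁ l₂ h _ := by simpa using h

theorem IsBlowup.exists_section {B : Scheme.{u}} {I : Y.IdealSheafData} {π : B ⟶ Y}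
    (h : IsBlowup I π) (j : W ⟶ Y) [IsOpenImmersion j] (hj : I.comap j = ⊤) :
    ∃ s : W ⟶ B, s ≫ π = j ∧ IsPullback s (𝟙 W) π j := by
  obtain ⟨s, hs⟩ := h.lift W j (hj ▸ isCartier_top)
  exact ⟨s, hs, h.isPullback j (hj ▸ isBlowup_top W) s (by simpa)⟩

theorem dominant_of_comp (f : X ⟶ Y) (g : Y ⟶ Z) [IsSchemeTheoreticallyDominant (f ≫ g)] :
    IsSchemeTheoreticallyDominant g := by
  refine ⟨le_bot_iff.mp ?_⟩
  rw [← (f ≫ g).ker_eq_bot]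
  exact Hom.le_ker_comp f g

theorem dominant_of_comp_isOpenImmersion (f : X ⟶ Y) (g : Y ⟶ Z) [IsOpenImmersion g]
    [QuasiCompact (f ≫ g)] [IsSchemeTheoreticallyDominant (f ≫ g)] :
    IsSchemeTheoreticallyDominant f :=
  IsSchemeTheoreticallyDominant.of_isPullback (isPullback_comp_mono f g).flip

/-- A scheme-theoretically dense open subscheme over which `p` admits a section is its own
preimage. -/
theorem isPullback_of_dominant {P : Scheme.{u}} (ι : W ⟶ Y) [IsSchemeTheoreticallyDominant ι]
    [QuasiCompact ι] (p : Y ⟶ P) [IsSeparated p] (w : W ⟶ P) [IsOpenImmersion w]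
    (h : ι ≫ p = w) : IsPullback ι (𝟙 W) p w := by
  let s : W ⟶ pullback p w := pullback.lift ι (𝟙 W) (by simpa using h)
  have hs : s ≫ pullback.fst p w = ι := pullback.lift_fst _ _ _
  have hs' : s ≫ pullback.snd p w = 𝟙 W := pullback.lift_snd _ _ _
  have h1 : QuasiCompact (s ≫ pullback.fst p w) := hs ▸ inferInstance
  have h2 : IsSchemeTheoreticallyDominant (s ≫ pullback.fst p w) := hs ▸ inferInstance
  have h3 : IsSchemeTheoreticallyDominant s := dominant_of_comp_isOpenImmersion s (pullback.fst p w)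
  have h4 : IsClosedImmersion (s ≫ pullback.snd p w) := hs' ▸ inferInstance
  have h5 : IsClosedImmersion s := .of_comp s (pullback.snd p w)
  have h6 : IsIso s := by
    refine IsClosedImmersion.isIso_of_ker_eq s (𝟙 _) s (by simp) ?_
    rw [s.ker_eq_bot]; simp
  refine IsPullback.of_iso (IsPullback.of_hasPullback p w) (asIso s).symm (Iso.refl _) (Iso.refl _)
    (Iso.refl _) ?_ ?_ (by simp) (by simp)
  · simp [← hs]
  · rw [Iso.refl_hom, Category.comp_id, Category.comp_id, Iso.symm_hom, asIso_inv,
      IsIso.eq_inv_of_hom_inv_id hs']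

theorem exists_lift_image {P : Scheme.{u}} (f : W ⟶ P) [QuasiCompact f] (ι : W ⟶ T)
    [IsSchemeTheoreticallyDominant ι] (g : T ⟶ P) (h : ι ≫ g = f) :
    ∃ l : T ⟶ f.image, l ≫ f.imageι = g ∧ ι ≫ l = f.toImage := by
  have hk : f.imageι.ker ≤ g.ker := by
    rw [IdealSheafData.ker_subschemeι, ← h, Hom.ker_comp, ι.ker_eq_bot, IdealSheafData.map_bot]
  refine ⟨IsClosedImmersion.lift f.imageι g hk, IsClosedImmersion.lift_fac _ _ _, ?_⟩
  rw [← cancel_mono f.imageι, Category.assoc, IsClosedImmersion.lift_fac, h, f.toImage_imageι]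

end

section Algebra

variable {A B E : Type u} [CommRing A] [CommRing B] [CommRing E]

theorem exists_lift_of_fraction (φ : A →+* B) (s : Set B)
    (hs : ∀ (R : Subring B), φ.range ≤ R → s ⊆ R → R = ⊤)
    (κ : A) (θ : B →+* Localization.Away κ) (hθ : θ.comp φ = algebraMap _ _)
    (N : ℕ) (ψ : A →+* E) (hψ : ψ (κ ^ N) ∈ nonZeroDivisors E)
    (h : ∀ b ∈ s, ∃ a e, algebraMap _ (Localization.Away κ) (κ ^ N) * θ b = algebraMap _ _ a ∧
      ψ a = ψ (κ ^ N) * e) (hN : N ≠ 0) : ∃ χ : B →+* E, χ.comp φ = ψ := by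
  obtain ⟨L, _, r, hr, hu⟩ : ∃ (L : Type u) (_ : CommRing L) (r : E →+* L),
      Function.Injective r ∧ IsUnit (r (ψ (κ ^ N))) := by
    obtain ⟨L, r, hr, hu⟩ := exists_injective_isUnit (E := .of E) _ hψ
    exact ⟨L, inferInstance, r.hom, hr, hu⟩
  have hu' : IsUnit ((r.comp ψ) κ) := by
    rw [map_pow, map_pow, isUnit_pow_iff hN] at hu
    exact hu
  let m : Localization.Away κ →+* L := IsLocalization.Away.lift κ hu'
  have hm : ∀ a, m (algebraMap _ _ a) = r (ψ a) := fun a => IsLocalization.Away.lift_eq κ hu' a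
  have hθ' : ∀ a, θ (φ a) = algebraMap _ _ a := fun a => DFunLike.congr_fun hθ a
  have hR := hs (r.range.comap (m.comp θ)) (by
    rintro _ ⟨a, rfl⟩
    exact ⟨ψ a, by simp [hθ', hm]⟩) (fun b hb => by
    obtain ⟨a, e, h1, h2⟩ := h b hb
    refine ⟨e, hu.mul_left_cancel ?_⟩
    rw [← map_mul, ← h2, ← hm, ← h1, map_mul, hm]; rfl)
  have hR' : ∀ b, ∃ e, r e = m (θ b) := fun b => by
    have : b ∈ r.range.comap (m.comp θ) := hR ▸ trivial
    exact this
  choose χ hχ using hR'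
  exact ⟨{ toFun := χ
           map_one' := hr (by simp [hχ])
           map_mul' := fun x y => hr (by simp [hχ])
           map_zero' := hr (by simp [hχ])
           map_add' := fun x y => hr (by simp [hχ]) },
    RingHom.ext fun a => hr (by simp [hχ, hθ', hm])⟩

theorem exists_fraction (φ : A →+* B) (κ : A) (θ : B →+* Localization.Away κ)
    (hθ : (IsLocalization.Away.map (Localization.Away κ) (Localization.Away (φ κ)) φ κ).comp θ =
      algebraMap _ _) (b : B) :
    ∃ N : ℕ, ∀ n, N ≤ n → ∃ a, algebraMap _ (Localization.Away κ) (κ ^ n) * θ b = algebraMap _ _ a ∧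
      φ (κ ^ n) * b = φ a := by
  obtain ⟨n, a, h1⟩ := IsLocalization.Away.surj κ (θ b)
  have h2 := congrArg (IsLocalization.Away.map (Localization.Away κ) (Localization.Away (φ κ)) φ κ)
      h1
  have h3 : IsLocalization.Away.map (Localization.Away κ) (Localization.Away (φ κ)) φ κ (θ b) =
    algebraMap _ _ b := DFunLike.congr_fun hθ b
  rw [map_mul, map_pow, h3] at h2
  simp only [IsLocalization.Away.map, IsLocalization.map_eq] at h2
  rw [← map_pow, ← map_mul] at h2
  obtain ⟨m, hm⟩ := IsLocalization.Away.exists_of_eq (φ κ) h2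
  refine ⟨n + m, fun l hl => ?_⟩
  obtain ⟨l, rfl⟩ := Nat.exists_eq_add_of_le hl
  refine ⟨κ ^ (m + l) * a, ?_, ?_⟩
  · rw [map_mul, ← h1]; simp only [map_pow]; ring
  · have := congrArg (φ κ ^ l * ·) hm
    simp only [map_mul, map_pow] at this ⊢
    linear_combination this

theorem exists_lifting_ideal [IsNoetherianRing A] (φ : A →+* B) (hφ : φ.FiniteType) {n : ℕ}
    (κ : Fin n → A) (θ : ∀ i, B →+* Localization.Away (κ i))
    (hθ : ∀ i, (θ i).comp φ = algebraMap _ _)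
    (hθ' : ∀ i, (IsLocalization.Away.map (Localization.Away (κ i)) (Localization.Away (φ (κ i)))
      φ (κ i)).comp (θ i) = algebraMap _ _)
    (T : Ideal A) (hT : T.map φ ≤ (Ideal.span (Set.range fun i => φ (κ i))).radical) :
    ∃ (J : Ideal A) (κ' : Fin n → A) (M : ℕ), T ^ M ≤ J ∧ (∀ i, κ' i ∈ J) ∧
      J.map φ = Ideal.span (Set.range fun i => φ (κ' i)) ∧
      ∀ (i : Fin n) (E : Type u) [CommRing E] (ψ : A →+* E), ψ (κ' i) ∈ nonZeroDivisors E →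
        J.map ψ = Ideal.span {ψ (κ' i)} → ∃ χ : B →+* E, χ.comp φ = ψ := by
  obtain ⟨s, hs⟩ : ∃ s : Finset B, ∀ (R : Subring B), φ.range ≤ R → (s : Set B) ⊆ R → R = ⊤ := by
    algebraize [φ]
    obtain ⟨s, hs⟩ := Algebra.FiniteType.out (R := A) (A := B)
    refine ⟨s, fun R h1 h2 => ?_⟩
    let R' : Subalgebra A B := { R with algebraMap_mem' := fun a => h1 ⟨a, rfl⟩ }
    have h3 : (⊤ : Subalgebra A B) ≤ R' := hs ▸ Algebra.adjoin_le h2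
    exact top_le_iff.mp fun x _ => h3 (Algebra.mem_top : x ∈ _)
  choose N hN using fun i b => exists_fraction φ (κ i) (θ i) (hθ' i) b
  let K : ℕ := (Finset.univ ×ˢ s).sup (fun p => N p.1 p.2) + 1
  have hK : ∀ i, ∀ b ∈ s, N i b ≤ K := fun i b hb =>
    (Finset.le_sup (f := fun p : Fin n × B => N p.1 p.2) (b := (i, b)) (by simp [hb])).trans
        (Nat.le_succ _)
  have h' : ∀ i (b : s), ∃ a, algebraMap _ (Localization.Away (κ i)) (κ i ^ K) * θ i b =
    algebraMap _ _ a ∧ φ (κ i ^ K) * b = φ a := fun i b => hN i b K (hK i b b.2)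
  choose a ha ha' using h'
  have hT' : T.map φ ≤ (Ideal.span (Set.range fun i => φ (κ i ^ K))).radical := by
    refine hT.trans (Ideal.radical_le_radical_iff.mpr (Ideal.span_le.mpr ?_))
    rintro _ ⟨i, rfl⟩
    exact ⟨K, Ideal.subset_span ⟨i, by simp⟩⟩
  obtain ⟨M, hM⟩ := Ideal.exists_pow_le_of_le_radical_of_fg hT'
    (Ideal.FG.map (IsNoetherian.noetherian T) φ)
  refine ⟨Ideal.span (Set.range fun i => κ i ^ K) ⊔
    Ideal.span (Set.range fun p : Fin n × s => a p.1 p.2) ⊔ T ^ M, fun i => κ i ^ K, M,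
    le_sup_right, fun i => Ideal.mem_sup_left (Ideal.mem_sup_left (Ideal.subset_span ⟨i, rfl⟩)),
    ?_, fun i E _ ψ h1 h2 => ?_⟩
  · refine le_antisymm ?_ ?_
    · rw [Ideal.map_sup, Ideal.map_sup, Ideal.map_pow]
      refine sup_le (sup_le ?_ ?_) hM
      · rw [Ideal.map_span, ← Set.range_comp]; exact le_rfl
      · rw [Ideal.map_span, Ideal.span_le]
        rintro _ ⟨_, ⟨p, rfl⟩, rfl⟩
        change φ (a p.1 p.2) ∈ Ideal.span _
        rw [← ha' p.1 p.2]
        exact Ideal.mul_mem_right _ _ (Ideal.subset_span ⟨p.1, rfl⟩)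
    · rw [Ideal.span_le]
      rintro _ ⟨i, rfl⟩
      exact Ideal.mem_map_of_mem φ (Ideal.mem_sup_left (Ideal.mem_sup_left
        (Ideal.subset_span ⟨i, rfl⟩)))
  · refine exists_lift_of_fraction φ s hs (κ i) (θ i) (hθ i) K ψ h1 (fun b hb => ?_)
      (Nat.succ_ne_zero _)
    have h3 : ψ (a i ⟨b, hb⟩) ∈ Ideal.span {ψ (κ i ^ K)} := by
      rw [← h2]
      exact Ideal.mem_map_of_mem ψ (Ideal.mem_sup_left (Ideal.mem_sup_right
        (Ideal.subset_span ⟨(i, ⟨b, hb⟩), rfl⟩)))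
    obtain ⟨e, he⟩ := Ideal.mem_span_singleton'.mp h3
    exact ⟨a i ⟨b, hb⟩, e, ha i ⟨b, hb⟩, by rw [← he, mul_comm]⟩

end Algebra

theorem exists_idealSheaf_spec {A : CommRingCat.{u}} (J : Ideal A) :
    ∃ I : (Spec A).IdealSheafData,
      secs I ⊤ (isAffineOpen_top _) = J.map (Scheme.ΓSpecIso A).inv.hom ∧
      (I.support : Set (Spec A)) = PrimeSpectrum.zeroLocus J := by
  refine ⟨IdealSheafData.ofIdealTop (J.map (Scheme.ΓSpecIso A).inv.hom), ?_, ?_⟩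
  · exact IdealSheafData.equivOfIsAffine.apply_symm_apply _
  · rw [IdealSheafData.coe_support_ofIdealTop, Spec_zeroLocus, ← Ideal.coe_comap,
        Ideal.comap_map_of_bijective]
    exact ConcreteCategory.bijective_of_isIso (Scheme.ΓSpecIso A).inv

theorem awayMap_comp_algebraMap {A B : Type u} [CommRing A] [CommRing B] (φ : A →+* B) (κ : A) :
    (IsLocalization.Away.map (Localization.Away κ) (Localization.Away (φ κ)) φ κ).comp
      (algebraMap A _) = (algebraMap B _).comp φ := by
  simp [IsLocalization.Away.map]

theorem exists_local_section {A B : CommRingCat.{u}} (φ : A ⟶ B) {W : Scheme.{u}} {Y G : Scheme.{u}}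
    (pr : G ⟶ Y)
    (ι : W ⟶ G) (w : W ⟶ Y) [IsOpenImmersion w] (H : IsPullback ι (𝟙 W) pr w)
    (a : Spec A ⟶ Y) [IsOpenImmersion a] (b : Spec B ⟶ G) [IsOpenImmersion b]
    (hab : b ≫ pr = Spec.map φ ≫ a) (κ : A)
    (hκ : ∀ p : Spec A, κ ∉ p.asIdeal → ∃ y, ι y ∈ Set.range b ∧ w y = a p) :
    ∃ θ : B →+* Localization.Away κ, θ.comp φ.hom = algebraMap _ _ ∧
      (IsLocalization.Away.map (Localization.Away κ) (Localization.Away (φ κ)) φ.hom κ).comp θ =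
      algebraMap _ _ := by
  let m : Spec (.of (Localization.Away κ)) ⟶ Spec A :=
    Spec.map (CommRingCat.ofHom (algebraMap A (Localization.Away κ)))
  have hm : ∀ p, κ ∉ (m p).asIdeal := fun p hp => by
    have : p.asIdeal = ⊤ := Ideal.eq_top_of_isUnit_mem _ hp
      (IsLocalization.Away.algebraMap_isUnit (S := Localization.Away κ) κ)
    exact p.2.ne_top this
  have hu : Set.range (m ≫ a) ⊆ Set.range w := by
    rintro _ ⟨p, rfl⟩
    obtain ⟨y, -, hy⟩ := hκ _ (hm p)
    exact ⟨y, by simpa using hy⟩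
  let v := IsOpenImmersion.lift w (m ≫ a) hu
  have hv : v ≫ w = m ≫ a := IsOpenImmersion.lift_fac _ _ _
  have hv' : Set.range (v ≫ ι) ⊆ Set.range b := by
    rintro _ ⟨p, rfl⟩
    obtain ⟨y, hy, hy'⟩ := hκ _ (hm p)
    have : v p = y := by
      apply w.isOpenEmbedding.injective
      rw [hy', ← Hom.comp_apply, hv, Hom.comp_apply]
    rw [Hom.comp_apply, this]; exact hy
  let t := IsOpenImmersion.lift b (v ≫ ι) hv'
  have ht : t ≫ b = v ≫ ι := IsOpenImmersion.lift_fac _ _ _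
  obtain ⟨θ, hθ⟩ := Spec.map_surjective t
  refine ⟨θ.hom, ?_, ?_⟩
  · rw [← CommRingCat.hom_comp]
    have : φ ≫ θ = CommRingCat.ofHom (algebraMap A (Localization.Away κ)) := by
      apply Spec.map_injective
      rw [Spec.map_comp, hθ, ← cancel_mono a, Category.assoc, ← hab, reassoc_of% ht, H.w,
        Category.id_comp, hv]
    rw [this]; rfl
  · let m' : Spec (.of (Localization.Away (φ κ))) ⟶ Spec (.of (Localization.Away κ)) :=
      Spec.map (CommRingCat.ofHom (IsLocalization.Away.map _ _ φ.hom κ))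
    let n : Spec (.of (Localization.Away (φ κ))) ⟶ Spec B :=
      Spec.map (CommRingCat.ofHom (algebraMap B (Localization.Away (φ κ))))
    have h1 : n ≫ Spec.map φ = m' ≫ m := by
      rw [← Spec.map_comp, ← Spec.map_comp]
      congr 1
      exact CommRingCat.hom_ext (awayMap_comp_algebraMap φ.hom κ).symm
    have h2 : (n ≫ b) ≫ pr = (m' ≫ v) ≫ w := by
      rw [Category.assoc, hab, reassoc_of% h1, Category.assoc, hv]
    have h3 : m' ≫ t = n := by
      rw [← cancel_mono b, Category.assoc, ht, ← H.lift_fst _ _ h2]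
      have := H.lift_snd _ _ h2
      rw [Category.comp_id] at this
      rw [this, Category.assoc]
    have h4 : θ ≫ CommRingCat.ofHom (IsLocalization.Away.map (Localization.Away κ)
        (Localization.Away (φ κ)) φ.hom κ) =
        CommRingCat.ofHom (algebraMap B (Localization.Away (φ κ))) := by
      apply Spec.map_injective
      rw [Spec.map_comp, hθ]; exact h3
    exact congrArg CommRingCat.Hom.hom h4

theorem exists_lifting_ideal_spec {A B : CommRingCat.{u}} [IsNoetherianRing A] (φ : A ⟶ B)
    (hφ : φ.hom.FiniteType)
    {W Y G : Scheme.{u}} (pr : G ⟶ Y)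
    (ι : W ⟶ G) (w : W ⟶ Y) [IsOpenImmersion w] (H : IsPullback ι (𝟙 W) pr w)
    (a : Spec A ⟶ Y) [IsOpenImmersion a] (b : Spec B ⟶ G) [IsOpenImmersion b]
    (hab : b ≫ pr = Spec.map φ ≫ a) :
    ∃ (J : Ideal A) (n : ℕ) (κ : Fin n → A), PrimeSpectrum.zeroLocus J ⊆ (a ⁻¹' Set.range w)ᶜ ∧
      (∀ i, κ i ∈ J) ∧ J.map φ.hom = Ideal.span (Set.range fun i => φ (κ i)) ∧
      ∀ (i : Fin n) (E : CommRingCat.{u}) (ψ : A ⟶ E), ψ (κ i) ∈ nonZeroDivisors E →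
        J.map ψ.hom = Ideal.span {ψ (κ i)} → ∃ χ : B ⟶ E, φ ≫ χ = ψ := by
  let Ω : Set (Spec A) := a ⁻¹' (w '' (ι ⁻¹' Set.range b))
  have hΩ : IsOpen Ω := (w.isOpenEmbedding.isOpenMap _
    (b.isOpenEmbedding.isOpen_range.preimage ι.continuous)).preimage a.continuous
  have hΩ' : ∀ p, p ∈ Ω ↔ ¬ PrimeSpectrum.vanishingIdeal Ωᶜ ≤ PrimeSpectrum.asIdeal p := fun p => by
    have h : p ∈ Ωᶜ ↔ PrimeSpectrum.vanishingIdeal Ωᶜ ≤ PrimeSpectrum.asIdeal p := by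
      conv_lhs => rw [← hΩ.isClosed_compl.closure_eq]
      exact Set.ext_iff.mp (PrimeSpectrum.zeroLocus_vanishingIdeal_eq_closure Ωᶜ).symm p
    rw [← h, Set.mem_compl_iff, not_not]
  obtain ⟨n, κ, hκ⟩ := Submodule.fg_iff_exists_fin_generating_family.mp (IsNoetherian.noetherian
    (PrimeSpectrum.vanishingIdeal Ωᶜ : Ideal A))
  have hκ' : ∀ p : Spec A, p ∈ Ω ↔ ∃ i, κ i ∉ p.asIdeal := fun p => by
    rw [hΩ', ← hκ, Submodule.span_le, Set.not_subset]
    simp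
  choose θ hθ hθ' using fun i => exists_local_section φ pr ι w H a b hab (κ i) (fun p hp => by
    obtain ⟨y, hy, hy'⟩ := (hκ' p).2 ⟨i, hp⟩
    exact ⟨y, hy, hy'⟩)
  let T : Ideal A := PrimeSpectrum.vanishingIdeal (a ⁻¹' Set.range w)ᶜ
  have hT : T.map φ.hom ≤ (Ideal.span (Set.range fun i => φ.hom (κ i))).radical := by
    rw [Ideal.radical_eq_sInf]
    refine le_sInf fun P ⟨hP, hP'⟩ => ?_
    let P' : Spec B := ⟨P, hP'⟩
    rw [Ideal.map_le_iff_le_comap]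
    have h1 : Spec.map φ P' ∉ Ω := fun h => by
      obtain ⟨i, hi⟩ := (hκ' _).1 h
      exact hi (hP (Ideal.subset_span ⟨i, rfl⟩))
    have h2 : Spec.map φ P' ∉ a ⁻¹' Set.range w := by
      rintro ⟨y, hy⟩
      have h3 : pr (b P') = w y := by rw [hy, ← Hom.comp_apply, hab, Hom.comp_apply]
      obtain ⟨y', hy', hy''⟩ := exists_preimage_of_isPullback H _ _ h3
      refine h1 ⟨y, ⟨P', ?_⟩, hy⟩
      rw [← hy', ← hy'']; rfl
    exact fun x hx => (PrimeSpectrum.mem_vanishingIdeal _ _).1 hx _ h2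
  obtain ⟨J, κ', M, h1, h2, h3, h4⟩ := exists_lifting_ideal φ.hom hφ κ θ hθ hθ' T hT
  refine ⟨J, n, κ', fun p hp hp' => ?_, h2, h3, fun i E ψ h5 h6 => ?_⟩
  · have h7 : T ≤ p.asIdeal := fun x hx => p.2.mem_of_pow_mem M (hp (h1 (Ideal.pow_mem_pow hx M)))
    have h8 : p ∈ PrimeSpectrum.zeroLocus (T : Set A) := h7
    rw [PrimeSpectrum.zeroLocus_vanishingIdeal_eq_closure, IsClosed.closure_eq] at h8
    · exact h8 hp'
    · exact ((w.isOpenEmbedding.isOpen_range.preimage a.continuous)).isClosed_compl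
  · obtain ⟨χ, hχ⟩ := h4 i E ψ.hom h5 h6
    exact ⟨CommRingCat.ofHom χ, CommRingCat.hom_ext hχ⟩

/-- The lifting property of `exists_lifting_ideal_spec` for a test scheme `T`, provided some
scheme `R` over `T` already maps to the chart `b`. -/
theorem exists_local_lift {A B : CommRingCat.{u}} [IsNoetherianRing A] (φ : A ⟶ B)
    {Y G : Scheme.{u}} (pr : G ⟶ Y) (a : Spec A ⟶ Y) [IsOpenImmersion a]
    (b : Spec B ⟶ G) [IsOpenImmersion b] (hab : b ≫ pr = Spec.map φ ≫ a)
    {J : Ideal A} {n : ℕ} {κ : Fin n → A} (hκ : ∀ i, κ i ∈ J)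
    (hJ : J.map φ.hom = Ideal.span (Set.range fun i => φ (κ i)))
    (hlift : ∀ (i : Fin n) (E : CommRingCat.{u}) (ψ : A ⟶ E), ψ (κ i) ∈ nonZeroDivisors E →
        J.map ψ.hom = Ideal.span {ψ (κ i)} → ∃ χ : B ⟶ E, φ ≫ χ = ψ)
    {I : Y.IdealSheafData} (hI : secs (I.comap a) ⊤ (isAffineOpen_top _) =
      J.map (Scheme.ΓSpecIso A).inv.hom) {T R : Scheme.{u}} (g : T ⟶ Y) (r : R ⟶ T) (ζ : R ⟶ G)
    (hζ : ζ ≫ pr = r ≫ g) (hg : IsCartier (I.comap g)) (hr : IsCartier (I.comap (r ≫ g)))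
    (x : R) (hx : ζ x ∈ Set.range b) :
    ∃ (F : CommRingCat.{u}) (q : Spec F ⟶ T) (h : Spec F ⟶ G), IsOpenImmersion q ∧
      r x ∈ Set.range q ∧ h ≫ pr = q ≫ g := by
  obtain ⟨m, f, hf⟩ := Submodule.fg_iff_exists_fin_generating_family.mp (IsNoetherian.noetherian J)
  change Ideal.span (Set.range f) = J at hf
  have hgx : g (r x) ∈ Set.range a := by
    obtain ⟨y, hy⟩ := hx
    refine ⟨Spec.map φ y, ?_⟩
    rw [← Hom.comp_apply, ← hab, Hom.comp_apply, hy, ← Hom.comp_apply, hζ, Hom.comp_apply]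
  obtain ⟨F₀, q₀, g₀, hq₀, ⟨t₀, ht₀⟩, -, hg₀⟩ := exists_spec_lift g a (r x) hgx ⊤ trivial
  have hcart : IsCartier ((I.comap a).comap g₀) := by
    rw [← IdealSheafData.comap_comp, ← hg₀, IdealSheafData.comap_comp]
    exact hg.comap_of_flat _
  obtain ⟨F₁, q₁, ψ, j, hq₁, ⟨t₁, ht₁⟩, -, hψ, hj, hjd⟩ := hcart.exists_spec f
    (hI.trans (by rw [hf])) g₀ t₀ ⊤ trivial
  have ht₁' : (q₁ ≫ q₀) t₁ = r x := by rw [Hom.comp_apply, ht₁, ht₀]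
  obtain ⟨D₀, r₀, ζ₀, hr₀, ⟨x₀, hx₀⟩, hr₀', hζ₀⟩ := exists_spec_lift ζ b x hx
    (r ⁻¹ᵁ (q₁ ≫ q₀).opensRange) ⟨t₁, ht₁'⟩
  have hcart' : IsCartier (((I.comap a).comap (Spec.map φ)).comap ζ₀) := by
    rw [← IdealSheafData.comap_comp, ← IdealSheafData.comap_comp, Category.assoc, ← hab,
      ← reassoc_of% hζ₀, hζ, IdealSheafData.comap_comp]
    exact hr.comap_of_flat _
  have hI' : secs ((I.comap a).comap (Spec.map φ)) ⊤ (isAffineOpen_top _) =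
      (Ideal.span (Set.range fun i => φ (κ i))).map (Scheme.ΓSpecIso B).inv.hom := by
    rw [secs_comap_spec f (hI.trans (by rw [hf])), ← hJ, ← hf, Ideal.map_span φ.hom,
      ← Set.range_comp]
    rfl
  obtain ⟨D, r₁, ω, i, hr₁, ⟨x₁, hx₁⟩, -, hω, hi, hid⟩ := hcart'.exists_spec _ hI' ζ₀ x₀ ⊤ trivial
  have hrange : Set.range ((r₁ ≫ r₀) ≫ r) ⊆ Set.range (q₁ ≫ q₀) := by
    rintro _ ⟨y, rfl⟩
    exact hr₀' ⟨r₁ y, rfl⟩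
  obtain ⟨ρ, hρ⟩ := Spec.map_surjective (IsOpenImmersion.lift (q₁ ≫ q₀) ((r₁ ≫ r₀) ≫ r) hrange)
  have hρ' : Spec.map ρ ≫ q₁ ≫ q₀ = (r₁ ≫ r₀) ≫ r := by
    rw [hρ, IsOpenImmersion.lift_fac]
  have hx₁' : Spec.map ρ x₁ = t₁ := by
    apply (q₁ ≫ q₀).isOpenEmbedding.injective
    rw [← Hom.comp_apply, hρ', Hom.comp_apply, Hom.comp_apply, hx₁, hx₀, ht₁']
  have hcomm : φ ≫ ω = ψ ≫ ρ := by
    apply Spec.map_injective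
    rw [Spec.map_comp, Spec.map_comp, ← hω, ← hψ, ← cancel_mono a]
    simp only [Category.assoc]
    rw [← hab, ← hg₀, ← reassoc_of% hζ₀, hζ, reassoc_of% hρ']
  have hcomm' : ∀ z, ω (φ z) = ρ (ψ z) := fun z => by
    rw [← CommRingCat.comp_apply, hcomm, CommRingCat.comp_apply]
  -- the generator `f j` on `T` and the generator `κ i` on `R` agree up to a unit near `t₁`
  have hall : ∀ z ∈ J, ∃ e, ψ z = ψ (f j) * e := by
    intro z hz
    have : J.map ψ.hom ≤ Ideal.span {ψ (f j)} := by
      rw [← hf, Ideal.map_span, Ideal.span_le]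
      rintro _ ⟨_, ⟨l, rfl⟩, rfl⟩
      obtain ⟨e, he⟩ := hjd l
      exact Ideal.mem_span_singleton'.mpr ⟨e, by rw [mul_comm]; exact he.symm⟩
    obtain ⟨e, he⟩ := Ideal.mem_span_singleton'.mp (this (Ideal.mem_map_of_mem _ hz))
    exact ⟨e, by rw [mul_comm]; exact he.symm⟩
  obtain ⟨c, hc⟩ := hall (κ i) (hκ i)
  obtain ⟨d, hd⟩ : ∃ d, ω (φ (f j)) = ω (φ (κ i)) * d := by
    have h1 : J.map (φ ≫ ω).hom ≤ Ideal.span {ω (φ (κ i))} := by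
      rw [CommRingCat.hom_comp, ← Ideal.map_map, hJ, Ideal.map_span, Ideal.span_le]
      rintro _ ⟨_, ⟨l, rfl⟩, rfl⟩
      obtain ⟨e, he⟩ := hid l
      exact Ideal.mem_span_singleton'.mpr ⟨e, by rw [mul_comm]; exact he.symm⟩
    have hfj : f j ∈ J := hf ▸ Ideal.subset_span ⟨j, rfl⟩
    obtain ⟨e, he⟩ := Ideal.mem_span_singleton'.mp (h1 (Ideal.mem_map_of_mem _ hfj))
    exact ⟨e, by rw [mul_comm]; exact he.symm⟩
  have hunit : ρ c * d = 1 := by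
    have h2 : ω (φ (κ i)) * (ρ c * d) = ω (φ (κ i)) * 1 := by
      rw [mul_one, ← mul_assoc]
      conv_rhs => rw [hcomm', hc, map_mul, ← hcomm', hd]
      ring
    exact mul_cancel_left_mem_nonZeroDivisors hi |>.mp h2
  have hct : c ∉ t₁.asIdeal := fun h => by
    have h3 : ρ c ∈ x₁.asIdeal := by rw [← hx₁'] at h; exact h
    exact x₁.2.ne_top (Ideal.eq_top_of_isUnit_mem _ h3 (IsUnit.of_mul_eq_one _ hunit))
  let E : CommRingCat.{u} := .of (Localization.Away c)
  let e : F₁ ⟶ E := CommRingCat.ofHom (algebraMap F₁ (Localization.Away c))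
  have he : IsOpenImmersion (Spec.map e) := by
    exact inferInstanceAs (IsOpenImmersion
        (Spec.map (CommRingCat.ofHom (algebraMap F₁ (Localization.Away c)))))
  have hec : IsUnit (e c) := IsLocalization.Away.algebraMap_isUnit (S := Localization.Away c) c
  have hκe : (ψ ≫ e) (κ i) ∈ nonZeroDivisors E := by
    have hfl : e.hom.Flat :=
      RingHom.flat_algebraMap_iff.mpr (inferInstanceAs (Module.Flat F₁ (Localization.Away c)))
    rw [CommRingCat.comp_apply, hc, map_mul]
    exact mul_mem (map_mem_nonZeroDivisors_of_flat e.hom hfl hj) hec.mem_nonZeroDivisors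
  obtain ⟨χ, hχ⟩ := hlift i E (ψ ≫ e) hκe (by
    refine le_antisymm ?_ ((Ideal.span_singleton_le_iff_mem _).mpr (Ideal.mem_map_of_mem _ (hκ i)))
    rw [Ideal.map_le_iff_le_comap]
    intro z hz
    obtain ⟨y, hy⟩ := hall z hz
    refine Ideal.mem_span_singleton.mpr ?_
    change (ψ ≫ e) (κ i) ∣ (ψ ≫ e) z
    rw [CommRingCat.comp_apply, CommRingCat.comp_apply, hc, hy, map_mul, map_mul]
    exact mul_dvd_mul_left _ hec.dvd)
  refine ⟨E, Spec.map e ≫ q₁ ≫ q₀, Spec.map χ ≫ b, inferInstance, ?_, ?_⟩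
  · have : t₁ ∈ Set.range (Spec.map e) := by
      have := PrimeSpectrum.localization_away_comap_range (Localization.Away c) c
      rw [show Set.range (Spec.map e) = _ from this]
      exact hct
    obtain ⟨y, hy⟩ := this
    exact ⟨y, by rw [Hom.comp_apply, hy, ht₁']⟩
  · rw [Category.assoc, hab, ← Spec.map_comp_assoc, hχ, Spec.map_comp, Category.assoc,
      Category.assoc, Category.assoc, hg₀, reassoc_of% hψ]

theorem eq_zero_of_locally {X : Scheme.{u}} (U : X.Opens) (a : Γ(X, U))
    (h : ∀ p ∈ U, ∃ (F : X.Opens) (hF : F ≤ U), p ∈ F ∧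
      (X.presheaf.map (homOfLE hF).op).hom a = 0) : a = 0 := by
  choose! F hF hp h using h
  refine X.sheaf.eq_of_locally_eq' (fun p : U => F p) U (fun p => homOfLE (hF p p.2)) ?_ _ _ ?_
  · intro x hx
    exact TopologicalSpace.Opens.mem_iSup.mpr ⟨⟨x, hx⟩, hp x hx⟩
  · intro p
    exact (h p p.2).trans (map_zero _).symm

theorem eq_zero_of_dominant_appLE {V R : Scheme.{u}} (ι : V ⟶ R) [IsSchemeTheoreticallyDominant ι]
    [QuasiCompact ι] (E : R.Opens) (a : Γ(R, E))
    (h : ∀ p ∈ ι ⁻¹ᵁ E, ∀ (F : V.Opens) (_ : IsAffineOpen F) (hF : F ≤ ι ⁻¹ᵁ E), p ∈ F →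
      ι.appLE E F hF a = 0) : a = 0 := by
  apply ι.app_injective E
  rw [map_zero]
  refine eq_zero_of_locally _ _ fun p hp => ?_
  obtain ⟨F, hF, hpF, hle⟩ := exists_affine_mem_le (ι ⁻¹ᵁ E) p hp
  exact ⟨F, hle, hpF, h p hp F hF hle hpF⟩

theorem IsCartier.comap_of_dominant {V R T : Scheme.{u}} {J : T.IdealSheafData} (hJ : IsCartier J)
    (r : R ⟶ T) (ι : V ⟶ R) [IsSchemeTheoreticallyDominant ι] [QuasiCompact ι]
    (h : J.comap (ι ≫ r) = ⊤) : IsCartier (J.comap r) := by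
  intro x
  obtain ⟨D, hD, hx, s, hs, hJD⟩ := hJ (r x)
  obtain ⟨E, hE, hxE, hED⟩ := exists_affine_mem_le (r ⁻¹ᵁ D) x hx
  refine ⟨E, hE, hxE, r.appLE D E hED s, ?_, ?_⟩
  · rw [mem_nonZeroDivisors_iff_right]
    intro a ha
    refine eq_zero_of_dominant_appLE ι E a fun p hp F hF hFE hpF => ?_
    have hle : F ≤ (ι ≫ r) ⁻¹ᵁ D := fun y hy => hED (hFE hy)
    have h1 := secs_comap J (ι ≫ r) hD hF hle
    rw [h, hJD, Ideal.map_span, Set.image_singleton] at h1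
    have h2 : IsUnit ((ι ≫ r).appLE D F hle s) := Ideal.span_singleton_eq_top.mp h1.symm
    rw [← Hom.appLE_comp_appLE _ _ D E F hED hFE] at h2
    have h3 := congrArg (ι.appLE E F hFE) ha
    rw [map_mul, map_zero] at h3
    exact h2.mul_left_eq_zero.mp h3
  · rw [secs_comap J r hD hE hED, hJD, Ideal.map_span, Set.image_singleton]

/-- If the complement of the center is `w`, any section of `pr` over it extends uniquely. -/
theorem hom_ext_of_isCartier {Y G W S : Scheme.{u}} {pr : G ⟶ Y} [IsSeparated pr] {ι : W ⟶ G}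
    {w : W ⟶ Y} [IsOpenImmersion w] [QuasiCompact w] (H : IsPullback ι (𝟙 W) pr w)
    {I : Y.IdealSheafData} (hI : (I.support : Set Y)ᶜ ⊆ Set.range w) {g : S ⟶ Y}
    (hg : IsCartier (I.comap g)) {h₁ h₂ : S ⟶ G} (e₁ : h₁ ≫ pr = g) (e₂ : h₂ ≫ pr = g) :
    h₁ = h₂ := by
  have := hg.isSchemeTheoreticallyDominant (pullback.fst g w).opensRange (by
    rw [IdealSheafData.support_comap]
    intro x hx
    obtain ⟨y, hy⟩ := hI hx
    obtain ⟨z, hz, -⟩ := Scheme.Pullback.exists_preimage_pullback x y hy.symm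
    exact ⟨z, hz⟩)
  have hd : IsSchemeTheoreticallyDominant (pullback.fst g w) := by
    rw [← (pullback.fst g w).isoOpensRange_hom_ι]; infer_instance
  refine ext_of_isSchemeTheoreticallyDominant pr (e₁.trans e₂.symm) (pullback.fst g w) ?_
  have key : ∀ h : S ⟶ G, h ≫ pr = g → pullback.fst g w ≫ h = pullback.snd g w ≫ ι := by
    intro h hh
    have h2 : (pullback.fst g w ≫ h) ≫ pr = pullback.snd g w ≫ w := by
      rw [Category.assoc, hh, pullback.condition]
    have h3 := H.lift_snd _ _ h2
    rw [Category.comp_id] at h3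
    rw [← H.lift_fst _ _ h2, h3]
  rw [key _ e₁, key _ e₂]

theorem comap_support_subset {W Y : Scheme.{u}} {I : Y.IdealSheafData} {w : W ⟶ Y}
    (h : I.comap w = ⊤) : (I.support : Set Y) ⊆ (Set.range w)ᶜ := by
  rintro _ hx ⟨y, rfl⟩
  exact comap_eq_top_iff.mp h y hx

/-- A proper birational morphism is dominated by blow-ups of the base outside the locus where it
is an isomorphism. -/
theorem exists_lifting_idealSheaf {Y G W : Scheme.{u}} [IsLocallyNoetherian Y] [CompactSpace G]
    (pr : G ⟶ Y) [IsProper pr] (ι : W ⟶ G) [IsSchemeTheoreticallyDominant ι] [QuasiCompact ι]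
    (w : W ⟶ Y) [IsOpenImmersion w] (hw : ι ≫ pr = w) :
    ∃ I : Y.IdealSheafData, (I.support : Set Y) = (Set.range w)ᶜ ∧
      ∀ (T : Scheme.{u}) (g : T ⟶ Y), IsCartier (I.comap g) → ∃ h : T ⟶ G, h ≫ pr = g := by
  have H : IsPullback ι (𝟙 W) pr w := isPullback_of_dominant ι pr w hw
  obtain ⟨I, hIw, hI⟩ : ∃ I : Y.IdealSheafData, I.comap w = ⊤ ∧ ∀ {T R : Scheme.{u}} (g : T ⟶ Y)
      (r : R ⟶ T) (ζ : R ⟶ G), ζ ≫ pr = r ≫ g → IsCartier (I.comap g) →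
      IsCartier (I.comap (r ≫ g)) → ∀ x : R, ζ x ∈ (Set.univ : Set G) →
      ∃ (F : CommRingCat.{u}) (q : Spec F ⟶ T) (h : Spec F ⟶ G), IsOpenImmersion q ∧
      r x ∈ Set.range q ∧ h ≫ pr = q ≫ g := by
    refine IsCompact.induction_on (p := fun N => ∃ I : Y.IdealSheafData, I.comap w = ⊤ ∧
      ∀ {T R : Scheme.{u}} (g : T ⟶ Y)
      (r : R ⟶ T) (ζ : R ⟶ G), ζ ≫ pr = r ≫ g → IsCartier (I.comap g) →
      IsCartier (I.comap (r ≫ g)) → ∀ x : R, ζ x ∈ N →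
      ∃ (F : CommRingCat.{u}) (q : Spec F ⟶ T) (h : Spec F ⟶ G), IsOpenImmersion q ∧
      r x ∈ Set.range q ∧ h ≫ pr = q ≫ g) isCompact_univ ?_ ?_ ?_ ?_
    · exact ⟨⊤, IdealSheafData.comap_top _, fun g r ζ _ _ _ x hx => hx.elim⟩
    · rintro s t hst ⟨I, h1, h2⟩
      exact ⟨I, h1, fun g r ζ e hg hr x hx => h2 g r ζ e hg hr x (hst hx)⟩
    · rintro s t ⟨I, h1, h2⟩ ⟨J, h1', h2'⟩
      refine ⟨I * J, by rw [comap_mul, h1, h1', IdealSheafData.mul_top], fun g r ζ e hg hr x hx =>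
          ?_⟩
      rw [comap_mul] at hg hr
      rcases hx with hx | hx
      · exact h2 g r ζ e hg.of_mul_left hr.of_mul_left x hx
      · exact h2' g r ζ e hg.of_mul_right hr.of_mul_right x hx
    · rintro z -
      obtain ⟨A, a, ha, hza, -⟩ := exists_spec_mem_le (⊤ : Y.Opens) (pr z) trivial
      obtain ⟨B, b, l, hb, hzb, -, hab⟩ := exists_spec_lift pr a z hza ⊤ trivial
      obtain ⟨φ, rfl⟩ := Spec.map_surjective l
      have hA : IsNoetherianRing A := by
        have : IsLocallyNoetherian (Spec A) := isLocallyNoetherian_of_isOpenImmersion a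
        exact isLocallyNoetherian_Spec.mp this
      have hφ : φ.hom.FiniteType := by
        have h1 : LocallyOfFiniteType (Spec.map φ ≫ a) := hab ▸ inferInstance
        have h2 : LocallyOfFiniteType (Spec.map φ) := locallyOfFiniteType_of_comp _ a
        exact HasRingHomProperty.Spec_iff.mp h2
      obtain ⟨J, n, κ, hJ, hκ, hJκ, hl⟩ := exists_lifting_ideal_spec φ hφ pr ι w H a b hab
      obtain ⟨I, hI, hI'⟩ := exists_idealSheaf_spec J
      refine ⟨Set.range b, mem_nhdsWithin_of_mem_nhds (b.isOpenEmbedding.isOpen_range.mem_nhds hzb),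
        I.map a, ?_, fun g r ζ e hg hr x hx => ?_⟩
      · rw [comap_eq_top_iff]
        intro y hy
        have h3 : IsClosed (Set.range w)ᶜ := w.isOpenEmbedding.isOpen_range.isClosed_compl
        rw [IdealSheafData.support_map] at hy
        refine closure_minimal ?_ h3 hy ⟨y, rfl⟩
        rintro _ ⟨p, hp, rfl⟩
        rw [hI'] at hp
        exact hJ hp
      · exact exists_local_lift φ pr a b hab hκ hJκ hl
          ((congrArg (fun K => secs K ⊤ (isAffineOpen_top _))
            (comap_map_of_isOpenImmersion I a)).trans hI) g r ζ e hg hr x hx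
  let Z : TopologicalSpace.Closeds Y :=
    ⟨(Set.range w)ᶜ, w.isOpenEmbedding.isOpen_range.isClosed_compl⟩
  let I' := I * IdealSheafData.vanishingIdeal Z
  have hI' : (I'.support : Set Y) = (Set.range w)ᶜ := by
    have h1 : (I'.support : Set Y) = (I.support : Set Y) ∪ (Z : Set Y) := by
      rw [IdealSheafData.support_mul, TopologicalSpace.Closeds.coe_sup,
        IdealSheafData.coe_support_vanishingIdeal]
    rw [h1]
    exact Set.union_eq_right.mpr (comap_support_subset hIw)
  have hI'w : I'.comap w = ⊤ := by
    rw [comap_eq_top_iff]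
    intro x hx
    have : w x ∈ (I'.support : Set Y) := hx
    rw [hI'] at this
    exact this ⟨x, rfl⟩
  refine ⟨I', hI', fun T g hg => ?_⟩
  let v := pullback.fst g w
  have hd : IsSchemeTheoreticallyDominant v := by
    have := hg.isSchemeTheoreticallyDominant v.opensRange (by
      rw [IdealSheafData.support_comap]
      intro x hx
      have hx' : g x ∉ (I'.support : Set Y) := hx
      rw [hI', Set.mem_compl_iff, not_not] at hx'
      obtain ⟨y, hy⟩ := hx'
      obtain ⟨z, hz, -⟩ := Scheme.Pullback.exists_preimage_pullback x y hy.symm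
      exact ⟨z, hz⟩)
    rw [← v.isoOpensRange_hom_ι]; infer_instance
  let f : pullback g w ⟶ pullback g pr := pullback.lift v (pullback.snd g w ≫ ι) (by
    rw [Category.assoc, hw, pullback.condition])
  have hf : f ≫ pullback.fst g pr = v := pullback.lift_fst _ _ _
  have hqf : QuasiCompact f := by
    have : QuasiCompact (f ≫ pullback.fst g pr) := hf ▸ inferInstance
    exact .of_comp _ (pullback.fst g pr)
  have hqf' : QuasiCompact f.toImage := by
    have : QuasiCompact (f.toImage ≫ f.imageι) := by rwa [f.toImage_imageι]
    exact .of_comp _ f.imageι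
  have hdf := toImage_dominant f
  let r : f.image ⟶ T := f.imageι ≫ pullback.fst g pr
  have hr : f.toImage ≫ r = v := by rw [f.toImage_imageι_assoc, hf]
  have hsurj : Function.Surjective r := by
    have h1 : IsClosed (Set.range r) := r.isClosedMap.isClosed_range
    have h2 : Set.range v ⊆ Set.range r := by
      rintro _ ⟨y, rfl⟩
      exact ⟨f.toImage y, by rw [← hr]; rfl⟩
    have h3 : DenseRange v := v.denseRange
    exact Set.range_eq_univ.mp (Set.univ_subset_iff.mp
      (h3.closure_range.symm.subset.trans (closure_minimal h2 h1)))
  have hg' : IsCartier (I'.comap (r ≫ g)) := by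
    rw [IdealSheafData.comap_comp]
    refine hg.comap_of_dominant r f.toImage ?_
    rw [hr, ← IdealSheafData.comap_comp, pullback.condition, IdealSheafData.comap_comp, hI'w,
      IdealSheafData.comap_top]
  have hloc : ∀ t : T, ∃ (F : CommRingCat.{u}) (q : Spec F ⟶ T) (h : Spec F ⟶ G),
      IsOpenImmersion q ∧ t ∈ Set.range q ∧ h ≫ pr = q ≫ g := fun t => by
    obtain ⟨x, rfl⟩ := hsurj t
    rw [comap_mul] at hg hg'
    exact hI g r (f.imageι ≫ pullback.snd g pr) (by simp [r, pullback.condition])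
      hg.of_mul_left hg'.of_mul_left x trivial
  choose F q h hq ht hh using hloc
  obtain ⟨m, hm⟩ := exists_glue q hq (fun x => ⟨x, ht x⟩) h fun i j => by
    refine hom_ext_of_isCartier H (I := I') (by rw [hI', compl_compl]) (hg.comap_of_flat
      (pullback.fst (q i) (q j) ≫ q i) |> fun h' => by rwa [← IdealSheafData.comap_comp] at h')
          ?_ ?_
    · rw [Category.assoc, hh, Category.assoc]
    · rw [Category.assoc, hh, ← Category.assoc, pullback.condition]
  exact ⟨m, hom_ext_of_cover q hq (fun x => ⟨x, ht x⟩) _ _ fun i => by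
    rw [← Category.assoc, hm, hh]⟩

theorem IsCartier.dominant {X V : Scheme.{u}} {J : X.IdealSheafData} (hJ : IsCartier J)
    (s : V ⟶ X) [IsOpenImmersion s] (h : (J.support : Set X)ᶜ ⊆ Set.range s) :
    IsSchemeTheoreticallyDominant s := by
  have := hJ.isSchemeTheoreticallyDominant s.opensRange h
  rw [← s.isoOpensRange_hom_ι]
  infer_instance

theorem mem_range_of_isPullback {X Y Z W : Scheme.{u}} {f : W ⟶ X} {g : W ⟶ Y} {h : X ⟶ Z}
    {k : Y ⟶ Z} (H : IsPullback f g h k) (x : X) : x ∈ Set.range f ↔ h x ∈ Set.range k := by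
  constructor
  · rintro ⟨w, rfl⟩
    exact ⟨g w, by rw [← Hom.comp_apply, ← H.w]; rfl⟩
  · rintro ⟨y, hy⟩
    obtain ⟨w, hw, -⟩ := exists_preimage_of_isPullback H x y hy.symm
    exact ⟨w, hw⟩

theorem IsBlowup.dominant_lift {Y B W : Scheme.{u}} [IsLocallyNoetherian Y] {I : Y.IdealSheafData}
    {π : B ⟶ Y} (h : IsBlowup I π) (ι : W ⟶ Y) [IsSchemeTheoreticallyDominant ι] [QuasiCompact ι]
    (hι : I.comap ι = ⊤) (l : W ⟶ B) (hl : l ≫ π = ι) : IsSchemeTheoreticallyDominant l := by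
  let V : Y.Opens := ⟨(I.support : Set Y)ᶜ, I.support.isClosed.isOpen_compl⟩
  have hV : I.comap V.ι = ⊤ := comap_eq_top_iff.mpr fun x => x.2
  obtain ⟨s, hs, hsp⟩ := h.exists_section V.ι hV
  have : IsOpenImmersion s := MorphismProperty.of_isPullback hsp.flip inferInstance
  have hsd : IsSchemeTheoreticallyDominant s := by
    refine h.cartier.dominant s fun x hx => ?_
    rw [mem_range_of_isPullback hsp]
    rw [IdealSheafData.support_comap] at hx
    exact ⟨⟨π x, hx⟩, rfl⟩
  have hr : Set.range ι ⊆ Set.range V.ι := by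
    rintro _ ⟨x, rfl⟩
    exact ⟨⟨ι x, comap_eq_top_iff.mp hι x⟩, rfl⟩
  have hι' := IsOpenImmersion.lift_fac V.ι ι hr
  set ι' := IsOpenImmersion.lift V.ι ι hr
  have h1 : IsSchemeTheoreticallyDominant (ι' ≫ V.ι) := hι' ▸ inferInstance
  have h2 : QuasiCompact (ι' ≫ V.ι) := hι' ▸ inferInstance
  have h3 := dominant_of_comp_isOpenImmersion ι' V.ι
  have h4 : l = ι' ≫ s := h.unique _ _ _ (by rw [hl, Category.assoc, hs, hι'])
    (by rw [hl, hι]; exact isCartier_top)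
  have h5 : QuasiCompact ι' := .of_comp _ V.ι
  rw [h4]
  infer_instance

/-- Blowing up a center on an open subscheme, extended so as not to meet the open subscheme `U`. -/
theorem exists_modification {P O U W : Scheme.{u}} [IsLocallyNoetherian P] (o : O ⟶ P)
    (v : U ⟶ P) (w : W ⟶ O) (w' : W ⟶ U) [IsOpenImmersion o] [IsOpenImmersion v]
    [IsSchemeTheoreticallyDominant v] (H : IsPullback w w' o v) (I : O.IdealSheafData)
    (hI : I.comap w = ⊤) :
    ∃ (P' O' : Scheme.{u}) (π : P' ⟶ P) (μ : O' ⟶ O) (o' : O' ⟶ P') (v' : U ⟶ P') (w₁ : W ⟶ O'),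
      IsProper π ∧ IsOpenImmersion o' ∧ IsOpenImmersion v' ∧ IsSchemeTheoreticallyDominant v' ∧
      IsSchemeTheoreticallyDominant w₁ ∧ IsOpenImmersion w₁ ∧
      v' ≫ π = v ∧ w₁ ≫ μ = w ∧ IsPullback o' μ π o ∧ IsPullback w₁ w' o' v' ∧ IsBlowup I μ ∧
      IsBlowup (I.map o) π ∧ (I.map o).comap v = ⊤ := by
  have hI' : (I.map o).comap v = ⊤ := by
    rw [comap_eq_top_iff]
    intro x hx
    rw [IdealSheafData.support_map] at hx
    obtain ⟨_, hy, ⟨p, hp, rfl⟩⟩ := mem_closure_iff.mp hx _ v.isOpenEmbedding.isOpen_range ⟨x, rfl⟩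
    obtain ⟨z, hz⟩ := (mem_range_of_isPullback H p).mpr hy
    exact comap_eq_top_iff.mp hI z (hz ▸ hp)
  obtain ⟨P', π, hπ⟩ := exists_blowup P (I.map o)
  obtain ⟨v', hv', hv'p⟩ := hπ.exists_section v hI'
  have : IsProper π := hπ.proper
  have hv'o : IsOpenImmersion v' := MorphismProperty.of_isPullback hv'p.flip inferInstance
  have hv'd := hπ.dominant_lift v hI' v' hv'
  have hP' : IsLocallyNoetherian P' := LocallyOfFiniteType.isLocallyNoetherian π
  have hb := hπ.pullback_snd o
  rw [comap_map_of_isOpenImmersion] at hb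
  let w₁ : W ⟶ pullback π o := pullback.lift (w' ≫ v') w (by rw [Category.assoc, hv', H.w])
  have hw₁ : w₁ ≫ pullback.snd π o = w := pullback.lift_snd _ _ _
  have hw₁' : w₁ ≫ pullback.fst π o = w' ≫ v' := pullback.lift_fst _ _ _
  have hp : IsPullback w₁ w' (pullback.fst π o) v' := by
    refine IsPullback.of_right (h₁₂ := pullback.snd π o) (h₂₂ := π) (v₁₃ := o) ?_ hw₁'
      (IsPullback.of_hasPullback π o).flip
    rwa [hw₁, hv']
  have hw₁o : IsOpenImmersion w₁ := MorphismProperty.of_isPullback hp.flip inferInstance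
  exact ⟨P', _, π, pullback.snd π o, pullback.fst π o, v', w₁, inferInstance, inferInstance,
    hv'o, hv'd, IsSchemeTheoreticallyDominant.of_isPullback hp.flip, hw₁o, hv', hw₁,
    .of_hasPullback π o, hp, hb, hπ, hI'⟩

theorem isIso_of_isOpenImmersion_of_surjective {X Y : Scheme.{u}} (f : X ⟶ Y) [IsOpenImmersion f]
    (h : Function.Surjective f) : IsIso f := by
  have : Epi f.base := (TopCat.epi_iff_surjective _).mpr h
  exact IsOpenImmersion.isIso f

theorem isPullback_of_forall {X Y N T : Scheme.{u}} (m₁ : X ⟶ T) (m₂ : Y ⟶ T) (n₁ : N ⟶ X)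
    (n₂ : N ⟶ Y) [IsOpenImmersion m₂] [IsOpenImmersion n₁] (w : n₁ ≫ m₁ = n₂ ≫ m₂)
    (h : ∀ x y, m₁ x = m₂ y → x ∈ Set.range n₁) : IsPullback n₁ n₂ m₁ m₂ := by
  let l := pullback.lift n₁ n₂ w
  have h1 : l ≫ pullback.fst m₁ m₂ = n₁ := pullback.lift_fst _ _ _
  have h2 : IsOpenImmersion (l ≫ pullback.fst m₁ m₂) := h1 ▸ inferInstance
  have h3 : IsOpenImmersion l := .of_comp l (pullback.fst m₁ m₂)
  have h4 : IsIso l := isIso_of_isOpenImmersion_of_surjective l fun z => by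
    obtain ⟨n, hn⟩ := h (pullback.fst m₁ m₂ z) (pullback.snd m₁ m₂ z) (by
      rw [← Hom.comp_apply, pullback.condition, Hom.comp_apply])
    refine ⟨n, (pullback.fst m₁ m₂).isOpenEmbedding.injective ?_⟩
    rw [← Hom.comp_apply, h1, hn]
  refine IsPullback.of_iso (IsPullback.of_hasPullback m₁ m₂) (asIso l).symm (Iso.refl _)
    (Iso.refl _) (Iso.refl _) ?_ ?_ (by simp) (by simp)
  · simp [← h1]
  · rw [Iso.refl_hom, Category.comp_id, Iso.symm_hom, asIso_inv, IsIso.eq_inv_comp]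
    exact pullback.lift_snd _ _ _

theorem exists_pushout {N M₁ M₂ : Scheme.{u}} (n₁ : N ⟶ M₁) (n₂ : N ⟶ M₂) [IsOpenImmersion n₁]
    [IsOpenImmersion n₂] : ∃ (X : Scheme.{u}) (m₁ : M₁ ⟶ X) (m₂ : M₂ ⟶ X), IsOpenImmersion m₁ ∧
      IsOpenImmersion m₂ ∧ IsPullback n₁ n₂ m₁ m₂ ∧ ∀ x, x ∈ Set.range m₁ ∨ x ∈ Set.range m₂ := by
  have h0 : ∀ {i j} (f : i ⟶ j), IsOpenImmersion ((span n₁ n₂).map f) := by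
    rintro _ _ (_ | (_ | _))
    · rw [WidePushoutShape.hom_id, CategoryTheory.Functor.map_id]; infer_instance
    · exact inferInstanceAs (IsOpenImmersion n₁)
    · exact inferInstanceAs (IsOpenImmersion n₂)
  let m₁ : M₁ ⟶ colimit (span n₁ n₂) := colimit.ι (span n₁ n₂) WalkingSpan.left
  let m₂ : M₂ ⟶ colimit (span n₁ n₂) := colimit.ι (span n₁ n₂) WalkingSpan.right
  have hm₁ : IsOpenImmersion m₁ :=
    inferInstanceAs (IsOpenImmersion (colimit.ι (span n₁ n₂) WalkingSpan.left))
  have hm₂ : IsOpenImmersion m₂ :=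
    inferInstanceAs (IsOpenImmersion (colimit.ι (span n₁ n₂) WalkingSpan.right))
  have hw : n₁ ≫ m₁ = n₂ ≫ m₂ := pushout.condition
  refine ⟨_, m₁, m₂, hm₁, hm₂, isPullback_of_forall _ _ _ _ hw ?_, fun x => ?_⟩
  · intro x y hxy
    obtain ⟨k, fi, fj, z, hz, -⟩ := (IsLocallyDirected.ι_eq_ι_iff (span n₁ n₂)).mp hxy
    rcases k with _ | (_ | _)
    · obtain rfl : fi = WalkingSpan.Hom.fst := Subsingleton.elim _ _
      exact ⟨z, hz⟩
    · exact nomatch (show WalkingSpan.left ⟶ WalkingSpan.right from fj)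
    · exact nomatch (show WalkingSpan.right ⟶ WalkingSpan.left from fi)
  · obtain ⟨i, y, hy⟩ := IsLocallyDirected.ι_jointly_surjective (span n₁ n₂) x
    rcases i with _ | (_ | _)
    · left
      refine ⟨n₁ y, ?_⟩
      rw [← hy, ← colimit.w (span n₁ n₂) WalkingSpan.Hom.fst]
      rfl
    · exact .inl ⟨y, hy⟩
    · exact .inr ⟨y, hy⟩

theorem exists_glue_two {X N M₁ M₂ T : Scheme.{u}} {n₁ : N ⟶ M₁} {n₂ : N ⟶ M₂} {m₁ : M₁ ⟶ X}
    {m₂ : M₂ ⟶ X} [IsOpenImmersion m₁] [IsOpenImmersion m₂] (H : IsPullback n₁ n₂ m₁ m₂)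
    (hc : ∀ x, x ∈ Set.range m₁ ∨ x ∈ Set.range m₂) (l₁ : M₁ ⟶ T) (l₂ : M₂ ⟶ T)
    (h : n₁ ≫ l₁ = n₂ ≫ l₂) : ∃ g : X ⟶ T, m₁ ≫ g = l₁ ∧ m₂ ≫ g = l₂ := by
  let Z : ULift.{u} Bool → Scheme.{u} := fun b => bif b.down then M₁ else M₂
  let q : ∀ i, Z i ⟶ X := fun b => match b with
    | ⟨true⟩ => m₁
    | ⟨false⟩ => m₂
  let l : ∀ i, Z i ⟶ T := fun b => match b with
    | ⟨true⟩ => l₁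
    | ⟨false⟩ => l₂
  obtain ⟨g, hg⟩ := exists_glue q (by rintro ⟨_ | _⟩ <;> assumption) (fun x => by
    rcases hc x with h | h
    · exact ⟨⟨true⟩, h⟩
    · exact ⟨⟨false⟩, h⟩) l (by
    rintro ⟨_ | _⟩ ⟨_ | _⟩
    · change pullback.fst m₂ m₂ ≫ l₂ = pullback.snd m₂ m₂ ≫ l₂
      rw [fst_eq_snd_of_mono_eq]
    · change pullback.fst m₂ m₁ ≫ l₂ = pullback.snd m₂ m₁ ≫ l₁
      rw [← H.lift_snd _ _ (pullback.condition (f := m₂) (g := m₁)).symm, Category.assoc, ← h,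
        H.lift_fst_assoc]
    · change pullback.fst m₁ m₂ ≫ l₁ = pullback.snd m₁ m₂ ≫ l₂
      rw [← H.lift_snd _ _ (pullback.condition (f := m₁) (g := m₂)), Category.assoc, ← h,
        H.lift_fst_assoc]
    · change pullback.fst m₁ m₁ ≫ l₁ = pullback.snd m₁ m₁ ≫ l₁
      rw [fst_eq_snd_of_mono_eq])
  exact ⟨g, hg ⟨true⟩, hg ⟨false⟩⟩

theorem hom_ext_two {X M₁ M₂ T : Scheme.{u}} {m₁ : M₁ ⟶ X}
    {m₂ : M₂ ⟶ X} [IsOpenImmersion m₁] [IsOpenImmersion m₂]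
    (hc : ∀ x, x ∈ Set.range m₁ ∨ x ∈ Set.range m₂) {f g : X ⟶ T}
    (h₁ : m₁ ≫ f = m₁ ≫ g) (h₂ : m₂ ≫ f = m₂ ≫ g) : f = g := by
  let Z : ULift.{u} Bool → Scheme.{u} := fun b => bif b.down then M₁ else M₂
  let q : ∀ i, Z i ⟶ X := fun b => match b with
    | ⟨true⟩ => m₁
    | ⟨false⟩ => m₂
  refine hom_ext_of_cover q (by rintro ⟨_ | _⟩ <;> assumption) (fun x => by
    rcases hc x with h | h
    · exact ⟨⟨true⟩, h⟩
    · exact ⟨⟨false⟩, h⟩) _ _ (by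
    rintro ⟨_ | _⟩
    · exact h₂
    · exact h₁)

/-- A morphism covered by finitely many universally closed ones is universally closed. -/
theorem universallyClosed_of_cover {X S : Scheme.{u}} (f : X ⟶ S) {ι : Type} [Finite ι]
    {Z : ι → Scheme.{u}} (g : ∀ i, Z i ⟶ X) (hg : ∀ i, UniversallyClosed (g i ≫ f))
    (hc : ∀ x, ∃ i, x ∈ Set.range (g i)) : UniversallyClosed f := by
  rw [universallyClosed_iff]
  intro X' Y' f' p f₀ H C hC
  have h1 : ∀ i, IsClosed ((pullback.fst f' (g i) ≫ f₀) '' (pullback.fst f' (g i) ⁻¹' C)) := by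
    intro i
    have h2 : IsPullback (pullback.snd f' (g i)) (pullback.fst f' (g i) ≫ f₀) (g i ≫ f) p := by
      exact (IsPullback.of_hasPullback f' (g i)).flip.paste_vert H.flip
    have h3 : UniversallyClosed (pullback.fst f' (g i) ≫ f₀) :=
      MorphismProperty.of_isPullback h2 (hg i)
    exact Hom.isClosedMap _ _ (hC.preimage (Hom.continuous _))
  have h2 : f₀ '' C = ⋃ i, (pullback.fst f' (g i) ≫ f₀) '' (pullback.fst f' (g i) ⁻¹' C) := by
    ext s
    rw [Set.mem_iUnion]
    constructor
    · rintro ⟨x, hx, rfl⟩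
      obtain ⟨i, z, hz⟩ := hc (f' x)
      obtain ⟨t, ht, -⟩ := Scheme.Pullback.exists_preimage_pullback x z hz.symm
      exact ⟨i, t, by rwa [Set.mem_preimage, ht], by rw [Hom.comp_apply, ht]⟩
    · rintro ⟨i, t, ht, rfl⟩
      exact ⟨_, ht, rfl⟩
  change IsClosed (f₀ '' C)
  rw [h2]
  exact isClosed_iUnion_of_finite h1

theorem preimage_range_diagonal {X M₁ M₂ N S : Scheme.{u}} (f : X ⟶ S) {n₁ : N ⟶ M₁} {n₂ : N ⟶ M₂}
    {m₁ : M₁ ⟶ X} {m₂ : M₂ ⟶ X} (H : IsPullback n₁ n₂ m₁ m₂)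
    (e : pullback (m₁ ≫ f) (m₂ ≫ f) ⟶ pullback f f)
        (he₁ : e ≫ pullback.fst f f = pullback.fst _ _ ≫ m₁)
    (he₂ : e ≫ pullback.snd f f = pullback.snd _ _ ≫ m₂) (δ : N ⟶ pullback (m₁ ≫ f) (m₂ ≫ f))
    (hδ₁ : δ ≫ pullback.fst _ _ = n₁) (hδ₂ : δ ≫ pullback.snd _ _ = n₂) :
    e ⁻¹' (Set.range (pullback.diagonal f)) = Set.range δ := by
  ext t
  constructor
  · rintro ⟨x, hx⟩
    obtain ⟨p, hp, -⟩ := Scheme.Pullback.exists_preimage_pullback t x hx.symm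
    let a := pullback.fst e (pullback.diagonal f)
    have h1 : (a ≫ pullback.fst _ _) ≫ m₁ = (a ≫ pullback.snd _ _) ≫ m₂ := by
      rw [Category.assoc, ← he₁, Category.assoc, ← he₂, pullback.condition_assoc,
        pullback.condition_assoc, pullback.diagonal_fst, pullback.diagonal_snd]
    have h2 : H.lift _ _ h1 ≫ δ = a := by
      apply pullback.hom_ext
      · rw [Category.assoc, hδ₁, H.lift_fst]
      · rw [Category.assoc, hδ₂, H.lift_snd]
    refine ⟨H.lift _ _ h1 p, ?_⟩
    rw [← Hom.comp_apply, h2, hp]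
  · rintro ⟨n, rfl⟩
    refine ⟨m₁ (n₁ n), ?_⟩
    rw [← Hom.comp_apply, ← Hom.comp_apply, ← Hom.comp_apply]
    refine congrArg (fun g : N ⟶ pullback f f => g n) (pullback.hom_ext ?_ ?_)
    · rw [Category.assoc, Category.assoc, pullback.diagonal_fst, Category.assoc, he₁,
        reassoc_of% hδ₁, Category.comp_id]
    · rw [Category.assoc, Category.assoc, pullback.diagonal_snd, Category.assoc, he₂,
        reassoc_of% hδ₂, Category.comp_id, H.w]

theorem isSeparated_of_cover {X S : Scheme.{u}} (f : X ⟶ S) {ι : Type*} {M : ι → Scheme.{u}}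
    (m : ∀ i, M i ⟶ X) (hm : ∀ i, IsOpenImmersion (m i)) (hc : ∀ x, ∃ i, x ∈ Set.range (m i))
    (h : ∀ i j, ∃ (N : Scheme.{u}) (n₁ : N ⟶ M i) (n₂ : N ⟶ M j)
      (δ : N ⟶ pullback (m i ≫ f) (m j ≫ f)), IsPullback n₁ n₂ (m i) (m j) ∧
      δ ≫ pullback.fst _ _ = n₁ ∧ δ ≫ pullback.snd _ _ = n₂ ∧ IsClosed (Set.range δ)) :
    IsSeparated f := by
  constructor
  refine .of_isPreimmersion _ ?_
  rw [← isOpen_compl_iff, isOpen_iff_forall_mem_open]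
  intro z hz
  obtain ⟨i, x, hx⟩ := hc (pullback.fst f f z)
  obtain ⟨j, y, hy⟩ := hc (pullback.snd f f z)
  obtain ⟨N, n₁, n₂, δ, H, h1, h2, h3⟩ := h i j
  let e : pullback (m i ≫ f) (m j ≫ f) ⟶ pullback f f :=
    pullback.map _ _ _ _ (m i) (m j) (𝟙 S) (by simp) (by simp)
  have he₁ : e ≫ pullback.fst f f = pullback.fst _ _ ≫ m i := pullback.lift_fst _ _ _
  have he₂ : e ≫ pullback.snd f f = pullback.snd _ _ ≫ m j := pullback.lift_snd _ _ _
  have heo : IsOpenImmersion e := by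
    have := hm i
    have := hm j
    infer_instance
  have hze : z ∈ Set.range e := by
    rw [Scheme.Pullback.range_map]
    exact ⟨⟨x, hx⟩, ⟨y, hy⟩⟩
  obtain ⟨t, rfl⟩ := hze
  have h4 := preimage_range_diagonal f H e he₁ he₂ δ h1 h2
  refine ⟨e '' (Set.range δ)ᶜ, ?_, e.isOpenEmbedding.isOpenMap _ h3.isOpen_compl,
    ⟨t, ?_, rfl⟩⟩
  · rintro _ ⟨s, hs, rfl⟩ hs'
    rw [← h4] at hs
    exact hs hs'
  · rw [← h4]
    exact hz

theorem locallyOfFiniteType_of_cover {X S : Scheme.{u}} (f : X ⟶ S) {ι : Type u}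
    {Z : ι → Scheme.{u}} (q : ∀ i, Z i ⟶ X) (hq : ∀ i, IsOpenImmersion (q i))
    (hc : ∀ x, ∃ i, x ∈ Set.range (q i)) (h : ∀ i, LocallyOfFiniteType (q i ≫ f)) :
    LocallyOfFiniteType f := by
  let 𝒰 : X.OpenCover := Cover.mkOfCovers ι Z q (fun x => by simpa using hc x) hq
  have : IsZariskiLocalAtSource (@LocallyOfFiniteType) :=
    HasRingHomProperty.instIsZariskiLocalAtSource (P := @LocallyOfFiniteType)
      (Q := RingHom.FiniteType)
  exact IsZariskiLocalAtSource.of_openCover (P := @LocallyOfFiniteType) 𝒰 h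

theorem isProper_of_pushout {X S M₁ M₂ N Y A B P₁ P₂ : Scheme.{u}} {f : X ⟶ S} {n₁ : N ⟶ M₁}
    {n₂ : N ⟶ M₂} {m₁ : M₁ ⟶ X} {m₂ : M₂ ⟶ X} [IsOpenImmersion m₁] [IsOpenImmersion m₂]
    (H : IsPullback n₁ n₂ m₁ m₂) (hc : ∀ x, x ∈ Set.range m₁ ∨ x ∈ Set.range m₂)
    (f₁ : P₁ ⟶ S) [IsProper f₁] (f₂ : P₂ ⟶ S) [IsProper f₂] (i₁ : M₁ ⟶ P₁) [IsOpenImmersion i₁]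
    (i₂ : M₂ ⟶ P₂) [IsOpenImmersion i₂] (h₁ : m₁ ≫ f = i₁ ≫ f₁) (h₂ : m₂ ≫ f = i₂ ≫ f₂)
    (p : Y ⟶ P₁) (q : Y ⟶ P₂) (hpq : p ≫ f₁ = q ≫ f₂) [IsClosedImmersion (pullback.lift p q hpq)]
    (n : N ⟶ Y) (hp : n ≫ p = n₁ ≫ i₁) (hq : n ≫ q = n₂ ≫ i₂)
    (hY : ∀ y, p y ∈ Set.range i₁ → q y ∈ Set.range i₂ → y ∈ Set.range n)
    (y : Y ⟶ X) (a : A ⟶ X) (b : B ⟶ X) (hy : UniversallyClosed (y ≫ f))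
    (ha : UniversallyClosed (a ≫ f)) (hb : UniversallyClosed (b ≫ f))
    (hs : ∀ x, x ∈ Set.range y ∨ x ∈ Set.range a ∨ x ∈ Set.range b) : IsProper f := by
  have hsep : IsSeparated f := by
    let M : Bool → Scheme.{u} := fun b => match b with
      | true => M₁
      | false => M₂
    let m : ∀ i, M i ⟶ X := fun b => match b with
      | true => m₁
      | false => m₂
    let δ : N ⟶ pullback (m₁ ≫ f) (m₂ ≫ f) := pullback.lift n₁ n₂ (by rw [reassoc_of% H.w])
    have hδ : IsClosed (Set.range δ) := by
      let g := pullback.map (m₁ ≫ f) (m₂ ≫ f) f₁ f₂ i₁ i₂ (𝟙 S) (by simpa) (by simpa)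
      have hg : IsOpenImmersion g := inferInstance
      have hg₁ : g ≫ pullback.fst f₁ f₂ = pullback.fst _ _ ≫ i₁ := pullback.lift_fst _ _ _
      have hg₂ : g ≫ pullback.snd f₁ f₂ = pullback.snd _ _ ≫ i₂ := pullback.lift_snd _ _ _
      have hδ₁ : δ ≫ pullback.fst _ _ = n₁ := pullback.lift_fst _ _ _
      have hδ₂ : δ ≫ pullback.snd _ _ = n₂ := pullback.lift_snd _ _ _
      let e := pullback.lift p q hpq
      have he₁ : e ≫ pullback.fst f₁ f₂ = p := pullback.lift_fst _ _ _
      have he₂ : e ≫ pullback.snd f₁ f₂ = q := pullback.lift_snd _ _ _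
      have h3 : δ ≫ g = n ≫ e := by
        apply pullback.hom_ext
        · rw [Category.assoc, Category.assoc, hg₁, he₁, reassoc_of% hδ₁, hp]
        · rw [Category.assoc, Category.assoc, hg₂, he₂, reassoc_of% hδ₂, hq]
      have h4 := e.isClosedEmbedding.isClosed_range.preimage g.continuous
      convert h4 using 1
      ext t
      constructor
      · rintro ⟨s, rfl⟩
        exact ⟨n s, by rw [← Hom.comp_apply, ← h3, Hom.comp_apply]⟩
      · rintro ⟨s, hs⟩
        obtain ⟨r, rfl⟩ := hY s
          ⟨pullback.fst (m₁ ≫ f) (m₂ ≫ f) t, by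
            rw [← he₁, Hom.comp_apply, hs]; exact congrArg (fun φ : _ ⟶ P₁ => φ t) hg₁.symm⟩
          ⟨pullback.snd (m₁ ≫ f) (m₂ ≫ f) t, by
            rw [← he₂, Hom.comp_apply, hs]; exact congrArg (fun φ : _ ⟶ P₂ => φ t) hg₂.symm⟩
        refine ⟨r, g.isOpenEmbedding.injective ?_⟩
        rw [← hs, ← Hom.comp_apply, h3, Hom.comp_apply]
    have hM₁ : IsSeparated (m₁ ≫ f) := h₁ ▸ inferInstance
    have hM₂ : IsSeparated (m₂ ≫ f) := h₂ ▸ inferInstance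
    refine isSeparated_of_cover f m (by rintro (_ | _) <;> assumption) (fun x => ?_) ?_
    · rcases hc x with h | h
      · exact ⟨true, h⟩
      · exact ⟨false, h⟩
    · rintro (_ | _) (_ | _)
      · exact ⟨M₂, 𝟙 _, 𝟙 _, pullback.diagonal (m₂ ≫ f), IsKernelPair.id_of_mono m₂,
          pullback.diagonal_fst _, pullback.diagonal_snd _,
          (pullback.diagonal (m₂ ≫ f)).isClosedEmbedding.isClosed_range⟩
      · refine ⟨N, n₂, n₁, δ ≫ (pullbackSymmetry _ _).hom, H.flip, ?_, ?_, ?_⟩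
        · exact (Category.assoc _ _ _).trans (by
            rw [pullbackSymmetry_hom_comp_fst]; exact pullback.lift_snd _ _ _)
        · exact (Category.assoc _ _ _).trans (by
            rw [pullbackSymmetry_hom_comp_snd]; exact pullback.lift_fst _ _ _)
        · have h5 := (pullbackSymmetry (m₁ ≫ f) (m₂ ≫ f)).hom.isClosedMap _ hδ
          rwa [← Set.range_comp] at h5
      · exact ⟨N, n₁, n₂, δ, H, pullback.lift_fst _ _ _, pullback.lift_snd _ _ _, hδ⟩
      · exact ⟨M₁, 𝟙 _, 𝟙 _, pullback.diagonal (m₁ ≫ f), IsKernelPair.id_of_mono m₁,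
          pullback.diagonal_fst _, pullback.diagonal_snd _,
          (pullback.diagonal (m₁ ≫ f)).isClosedEmbedding.isClosed_range⟩
  have huc : UniversallyClosed f := by
    let Z : Option Bool → Scheme.{u} := fun b => match b with
      | none => Y
      | some true => A
      | some false => B
    let g : ∀ i, Z i ⟶ X := fun i => match i with
      | none => y
      | some true => a
      | some false => b
    refine universallyClosed_of_cover f g (by rintro (_ | _ | _) <;> assumption) fun x => ?_
    rcases hs x with h | h | h
    · exact ⟨none, h⟩
    · exact ⟨some true, h⟩
    · exact ⟨some false, h⟩
  have hft : LocallyOfFiniteType f := by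
    let M : ULift.{u} Bool → Scheme.{u} := fun b => match b with
      | ⟨true⟩ => M₁
      | ⟨false⟩ => M₂
    let m : ∀ i, M i ⟶ X := fun b => match b with
      | ⟨true⟩ => m₁
      | ⟨false⟩ => m₂
    have hM₁ : LocallyOfFiniteType (m₁ ≫ f) := h₁ ▸ inferInstance
    have hM₂ : LocallyOfFiniteType (m₂ ≫ f) := h₂ ▸ inferInstance
    refine locallyOfFiniteType_of_cover f m (by rintro ⟨_ | _⟩ <;> assumption) (fun x => ?_)
      (by rintro ⟨_ | _⟩ <;> assumption)
    rcases hc x with h | h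
    · exact ⟨⟨true⟩, h⟩
    · exact ⟨⟨false⟩, h⟩
  exact {}

/-- Gluing two proper schemes along a common open subscheme of a correspondence `Y`. -/
theorem exists_proper_glue {S P₁ P₂ Y N : Scheme.{u}} (f₁ : P₁ ⟶ S) [IsProper f₁] (f₂ : P₂ ⟶ S)
    [IsProper f₂] (p : Y ⟶ P₁) (q : Y ⟶ P₂) (hpq : p ≫ f₁ = q ≫ f₂)
    [IsClosedImmersion (pullback.lift p q hpq)] (A : Set P₁) (B : Set P₂) (hA : IsClosed A)
    (hB : IsClosed B) (n : N ⟶ Y) (n₁ : N ⟶ P₁) (n₂ : N ⟶ P₂) [IsOpenImmersion n]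
    [IsOpenImmersion n₁] [IsOpenImmersion n₂] (H₁ : IsPullback n (𝟙 N) p n₁)
    (H₂ : IsPullback n (𝟙 N) q n₂) (hN : Set.range n = (p ⁻¹' A ∪ q ⁻¹' B)ᶜ)
    (hpA : ∀ x, x ∈ Set.range p ∨ x ∈ A) (hqB : ∀ x, x ∈ Set.range q ∨ x ∈ B)
    (hAB : ∀ y, p y ∈ A → q y ∉ B) :
    ∃ (X M₁ M₂ : Scheme.{u}) (f : X ⟶ S) (m₁ : M₁ ⟶ X) (m₂ : M₂ ⟶ X) (i₁ : M₁ ⟶ P₁)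
      (i₂ : M₂ ⟶ P₂) (k₁ : N ⟶ M₁) (k₂ : N ⟶ M₂), IsProper f ∧ IsOpenImmersion m₁ ∧
      IsOpenImmersion m₂ ∧ IsOpenImmersion i₁ ∧ IsOpenImmersion i₂ ∧ m₁ ≫ f = i₁ ≫ f₁ ∧
      m₂ ≫ f = i₂ ≫ f₂ ∧ Set.range i₁ = (p '' (q ⁻¹' B))ᶜ ∧ Set.range i₂ = (q '' (p ⁻¹' A))ᶜ ∧
      k₁ ≫ i₁ = n₁ ∧ k₂ ≫ i₂ = n₂ ∧ IsPullback k₁ k₂ m₁ m₂ := by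
  have hY : IsProper (p ≫ f₁) := by
    have : pullback.lift p q hpq ≫ pullback.fst f₁ f₂ = p := pullback.lift_fst _ _ _
    rw [← this]; infer_instance
  have hp : IsProper p := .of_comp p f₁
  have hq : IsProper q := by
    have : IsProper (q ≫ f₂) := hpq ▸ hY
    exact .of_comp q f₂
  have hnp : n ≫ p = n₁ := by rw [H₁.w, Category.id_comp]
  have hnq : n ≫ q = n₂ := by rw [H₂.w, Category.id_comp]
  have hy : ∀ {y}, y ∈ Set.range n ↔ p y ∉ A ∧ q y ∉ B := fun {y} => by
    rw [hN, Set.mem_compl_iff, Set.mem_union, not_or]; rfl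
  let M₁ : P₁.Opens := ⟨(p '' (q ⁻¹' B))ᶜ,
    (p.isClosedMap _ (hB.preimage q.continuous)).isOpen_compl⟩
  let M₂ : P₂.Opens := ⟨(q '' (p ⁻¹' A))ᶜ,
    (q.isClosedMap _ (hA.preimage p.continuous)).isOpen_compl⟩
  have hr₁ : Set.range M₁.ι = (p '' (q ⁻¹' B))ᶜ := M₁.range_ι
  have hr₂ : Set.range M₂.ι = (q '' (p ⁻¹' A))ᶜ := M₂.range_ι
  have hM₁ : ∀ {y}, p y ∈ Set.range M₁.ι → q y ∉ B := fun h hy => by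
    rw [hr₁] at h; exact h ⟨_, hy, rfl⟩
  have hM₂ : ∀ {y}, q y ∈ Set.range M₂.ι → p y ∉ A := fun h hy => by
    rw [hr₂] at h; exact h ⟨_, hy, rfl⟩
  have hn₁ : Set.range n₁ ⊆ Set.range M₁.ι := by
    rintro _ ⟨x, rfl⟩
    rw [hr₁]
    rintro ⟨y, hyB, hyx⟩
    have := (mem_range_of_isPullback H₁ y).mpr ⟨x, hyx.symm⟩
    exact (hy.mp this).2 hyB
  have hn₂ : Set.range n₂ ⊆ Set.range M₂.ι := by
    rintro _ ⟨x, rfl⟩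
    rw [hr₂]
    rintro ⟨y, hyB, hyx⟩
    have := (mem_range_of_isPullback H₂ y).mpr ⟨x, hyx.symm⟩
    exact (hy.mp this).1 hyB
  have hk₁ := IsOpenImmersion.lift_fac M₁.ι n₁ hn₁
  have hk₂ := IsOpenImmersion.lift_fac M₂.ι n₂ hn₂
  set k₁ := IsOpenImmersion.lift M₁.ι n₁ hn₁
  set k₂ := IsOpenImmersion.lift M₂.ι n₂ hn₂
  have hk₁o : IsOpenImmersion k₁ := by
    have : IsOpenImmersion (k₁ ≫ M₁.ι) := hk₁ ▸ inferInstance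
    exact .of_comp k₁ M₁.ι
  have hk₂o : IsOpenImmersion k₂ := by
    have : IsOpenImmersion (k₂ ≫ M₂.ι) := hk₂ ▸ inferInstance
    exact .of_comp k₂ M₂.ι
  obtain ⟨X, m₁, m₂, hm₁, hm₂, H, hc⟩ := exists_pushout k₁ k₂
  obtain ⟨f, hf₁, hf₂⟩ := exists_glue_two H hc (M₁.ι ≫ f₁) (M₂.ι ≫ f₂) (by
    rw [reassoc_of% hk₁, reassoc_of% hk₂, ← hnp, ← hnq, Category.assoc, hpq, Category.assoc])
  have hl₁ : ∀ x, p x ∉ A → q x ∉ B → x ∈ Set.range n := fun x h1 h2 => hy.mpr ⟨h1, h2⟩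
  -- the morphism from `Y`
  have hcY : ∀ y, y ∈ Set.range (pullback.fst p M₁.ι) ∨ y ∈ Set.range (pullback.fst q M₂.ι) := by
    intro y
    rw [mem_range_of_isPullback (IsPullback.of_hasPullback p M₁.ι),
      mem_range_of_isPullback (IsPullback.of_hasPullback q M₂.ι)]
    by_contra! hcon
    rw [hr₁, hr₂, Set.mem_compl_iff, not_not, Set.mem_compl_iff, not_not] at hcon
    obtain ⟨⟨y', hy', e'⟩, ⟨y'', hy'', e''⟩⟩ := hcon
    have h1 : q y ∈ B := by
      by_contra h
      have h2 : p y ∉ A := fun h' => hAB y' (by rw [e']; exact h') hy'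
      obtain ⟨z, hz⟩ := hl₁ y h2 h
      have h3 := (mem_range_of_isPullback H₁ y').mpr
        ⟨z, by rw [← hnp, Hom.comp_apply, hz, e']⟩
      exact (hy.mp h3).2 hy'
    exact hAB y'' hy'' (by rw [e'']; exact h1)
  let a₁ : N ⟶ pullback p M₁.ι := pullback.lift n k₁ (by rw [hk₁, hnp])
  let a₂ : N ⟶ pullback q M₂.ι := pullback.lift n k₂ (by rw [hk₂, hnq])
  have ha₁ : a₁ ≫ pullback.fst p M₁.ι = n := pullback.lift_fst _ _ _
  have ha₂ : a₂ ≫ pullback.fst q M₂.ι = n := pullback.lift_fst _ _ _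
  have ha₁' : a₁ ≫ pullback.snd p M₁.ι = k₁ := pullback.lift_snd _ _ _
  have ha₂' : a₂ ≫ pullback.snd q M₂.ι = k₂ := pullback.lift_snd _ _ _
  have ha₁o : IsOpenImmersion a₁ := by
    have : IsOpenImmersion (a₁ ≫ pullback.fst p M₁.ι) := ha₁ ▸ inferInstance
    exact .of_comp a₁ (pullback.fst p M₁.ι)
  have HY : IsPullback a₁ a₂ (pullback.fst p M₁.ι) (pullback.fst q M₂.ι) := by
    refine isPullback_of_forall _ _ _ _ (ha₁.trans ha₂.symm) fun x y hxy => ?_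
    have h1 := (mem_range_of_isPullback (IsPullback.of_hasPullback p M₁.ι) _).mp ⟨x, rfl⟩
    have h2 := (mem_range_of_isPullback (IsPullback.of_hasPullback q M₂.ι) _).mp ⟨y, rfl⟩
    rw [← hxy] at h2
    obtain ⟨z, hz⟩ := hl₁ _ (hM₂ h2) (hM₁ h1)
    refine ⟨z, (pullback.fst p M₁.ι).isOpenEmbedding.injective ?_⟩
    rw [← hz, ← Hom.comp_apply, ha₁]
  obtain ⟨y, hy₁, hy₂⟩ := exists_glue_two HY hcY (pullback.snd p M₁.ι ≫ m₁)
    (pullback.snd q M₂.ι ≫ m₂) (by rw [reassoc_of% ha₁', reassoc_of% ha₂', H.w])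
  have hyf : y ≫ f = p ≫ f₁ := by
    refine hom_ext_two hcY ?_ ?_
    · rw [reassoc_of% hy₁, hf₁, pullback.condition_assoc]
    · rw [reassoc_of% hy₂, hf₂, hpq, pullback.condition_assoc]
  let Ai := IdealSheafData.vanishingIdeal (X := P₁) ⟨A, hA⟩
  let Bi := IdealSheafData.vanishingIdeal (X := P₂) ⟨B, hB⟩
  have hAr : Set.range Ai.subschemeι = A := by
    rw [IdealSheafData.range_subschemeι, IdealSheafData.coe_support_vanishingIdeal]; rfl
  have hBr : Set.range Bi.subschemeι = B := by
    rw [IdealSheafData.range_subschemeι, IdealSheafData.coe_support_vanishingIdeal]; rfl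
  have hAM : Set.range Ai.subschemeι ⊆ Set.range M₁.ι := by
    rw [hAr, hr₁]
    rintro _ hz ⟨y, hyB, rfl⟩
    exact hAB y hz hyB
  have hBM : Set.range Bi.subschemeι ⊆ Set.range M₂.ι := by
    rw [hBr, hr₂]
    rintro _ hz ⟨y, hyA, rfl⟩
    exact hAB y hyA hz
  have hA' := IsOpenImmersion.lift_fac M₁.ι Ai.subschemeι hAM
  have hB' := IsOpenImmersion.lift_fac M₂.ι Bi.subschemeι hBM
  set a := IsOpenImmersion.lift M₁.ι Ai.subschemeι hAM
  set b := IsOpenImmersion.lift M₂.ι Bi.subschemeι hBM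
  have hfp : IsProper f := by
    refine isProper_of_pushout H hc f₁ f₂ M₁.ι M₂.ι hf₁ hf₂ p q hpq n (hnp.trans hk₁.symm)
      (hnq.trans hk₂.symm) (fun y h1 h2 => hl₁ y (hM₂ h2) (hM₁ h1)) y (a ≫ m₁) (b ≫ m₂) ?_ ?_ ?_ ?_
    · rw [hyf]; infer_instance
    · rw [Category.assoc, hf₁, reassoc_of% hA']; infer_instance
    · rw [Category.assoc, hf₂, reassoc_of% hB']; infer_instance
    · intro x
      rcases hc x with ⟨x, rfl⟩ | ⟨x, rfl⟩
      · rcases hpA (M₁.ι x) with ⟨z, hz⟩ | h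
        · left
          obtain ⟨t, -, ht⟩ := Scheme.Pullback.exists_preimage_pullback z x hz
          exact ⟨pullback.fst p M₁.ι t, by rw [← Hom.comp_apply, hy₁, Hom.comp_apply, ht]⟩
        · right; left
          rw [← hAr] at h
          obtain ⟨t, ht⟩ := h
          refine ⟨t, ?_⟩
          rw [Hom.comp_apply]
          congr 1
          exact M₁.ι.isOpenEmbedding.injective (by rw [← Hom.comp_apply, hA', ht])
      · rcases hqB (M₂.ι x) with ⟨z, hz⟩ | h
        · left
          obtain ⟨t, -, ht⟩ := Scheme.Pullback.exists_preimage_pullback z x hz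
          exact ⟨pullback.fst q M₂.ι t, by rw [← Hom.comp_apply, hy₂, Hom.comp_apply, ht]⟩
        · right; right
          rw [← hBr] at h
          obtain ⟨t, ht⟩ := h
          refine ⟨t, ?_⟩
          rw [Hom.comp_apply]
          congr 1
          exact M₂.ι.isOpenEmbedding.injective (by rw [← Hom.comp_apply, hB', ht])
  exact ⟨X, M₁, M₂, f, m₁, m₂, M₁.ι, M₂.ι, k₁, k₂, hfp, hm₁, hm₂, inferInstance, inferInstance,
    hf₁, hf₂, hr₁, hr₂, hk₁, hk₂, H⟩

theorem isNoetherian_of_proper {P S : Scheme.{u}} (f : P ⟶ S) [IsProper f] [IsNoetherian S] :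
    IsNoetherian P := by
  have h1 : IsLocallyNoetherian P := LocallyOfFiniteType.isLocallyNoetherian f
  have h2 : CompactSpace P := QuasiCompact.compactSpace_of_compactSpace f
  exact { }

theorem isNoetherian_of_isOpenImmersion {U P : Scheme.{u}} (f : U ⟶ P) [IsOpenImmersion f]
    [IsNoetherian P] : IsNoetherian U := by
  have h1 : IsLocallyNoetherian U := isLocallyNoetherian_of_isOpenImmersion f
  have h2 : CompactSpace U := QuasiCompact.compactSpace_of_compactSpace f
  exact { }

theorem eq_of_isPullback_id {W Y P T : Scheme.{u}} {ι : W ⟶ Y} {p : Y ⟶ P} {w : W ⟶ P}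
    (H : IsPullback ι (𝟙 W) p w) (a : T ⟶ Y) (b : T ⟶ W) (h : a ≫ p = b ≫ w) : a = b ≫ ι := by
  have h1 := H.lift_fst a b h
  have h2 := H.lift_snd a b h
  rw [Category.comp_id] at h2
  rw [← h1, h2]

/-- A proper `p : Y → P` which is an isomorphism over the dense open `W ⊆ U` becomes dominated over
an open subscheme `O` with `O ∩ U = W` after a modification of `P` away from `U`. -/
theorem exists_modification_lift {P O U W Y : Scheme.{u}} [IsNoetherian P] [IsNoetherian Y]
    (o : O ⟶ P) (v : U ⟶ P) (w : W ⟶ O) (w' : W ⟶ U) [IsOpenImmersion o] [IsOpenImmersion v]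
    [IsSchemeTheoreticallyDominant v] (H : IsPullback w w' o v) (p : Y ⟶ P) [IsProper p]
    (ι : W ⟶ Y) [IsSchemeTheoreticallyDominant ι] (hι : ι ≫ p = w ≫ o) :
    ∃ (I : O.IdealSheafData) (P' O' : Scheme.{u}) (π : P' ⟶ P) (μ : O' ⟶ O) (o' : O' ⟶ P')
      (v' : U ⟶ P') (w₁ : W ⟶ O') (α : O' ⟶ Y),
      IsProper π ∧ IsOpenImmersion o' ∧ IsOpenImmersion v' ∧ IsSchemeTheoreticallyDominant v' ∧
      IsSchemeTheoreticallyDominant w₁ ∧ IsOpenImmersion w₁ ∧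
      v' ≫ π = v ∧ w₁ ≫ μ = w ∧ IsPullback o' μ π o ∧ IsPullback w₁ w' o' v' ∧ IsBlowup I μ ∧
      IsBlowup (I.map o) π ∧ (I.map o).comap v = ⊤ ∧ α ≫ p = μ ≫ o ∧ w₁ ≫ α = ι := by
  have : IsOpenImmersion w := MorphismProperty.of_isPullback H.flip inferInstance
  have : IsNoetherian O := isNoetherian_of_isOpenImmersion o
  have : IsNoetherian W := isNoetherian_of_isOpenImmersion w
  let ι' : W ⟶ pullback p o := pullback.lift ι w hι
  have hι₁ : ι' ≫ pullback.fst p o = ι := pullback.lift_fst _ _ _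
  have hι₂ : ι' ≫ pullback.snd p o = w := pullback.lift_snd _ _ _
  have h1 : IsSchemeTheoreticallyDominant (ι' ≫ pullback.fst p o) := hι₁ ▸ inferInstance
  have h2 := dominant_of_comp_isOpenImmersion ι' (pullback.fst p o)
  have : IsNoetherian (pullback p o : Scheme.{u}) :=
      isNoetherian_of_isOpenImmersion (pullback.fst p o)
  obtain ⟨I, hI, hl⟩ := exists_lifting_idealSheaf (pullback.snd p o) ι' w hι₂
  have hIw : I.comap w = ⊤ := comap_eq_top_iff.mpr fun x hx => by
    rw [← SetLike.mem_coe, hI] at hx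
    exact hx ⟨x, rfl⟩
  obtain ⟨P', O', π, μ, o', v', w₁, a1, a2, a3, a4, a5, a6, a7, a8, a9, a10, a11, a12, a13⟩ :=
    exists_modification o v w w' H I hIw
  obtain ⟨h, hh⟩ := hl _ μ a11.cartier
  have hα : (h ≫ pullback.fst p o) ≫ p = μ ≫ o := by
    rw [Category.assoc, pullback.condition, reassoc_of% hh]
  refine ⟨I, P', O', π, μ, o', v', w₁, h ≫ pullback.fst p o, a1, a2, a3, a4, a5, a6, a7, a8, a9,
    a10, a11, a12, a13, hα, ?_⟩
  have hL := isPullback_of_dominant ι p (w ≫ o) hι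
  rw [eq_of_isPullback_id hL (w₁ ≫ h ≫ pullback.fst p o) (𝟙 W), Category.id_comp]
  rw [Category.id_comp, Category.assoc, hα, reassoc_of% a8]

/-- After modifying `P₁` away from `U` and `P₂` away from `V`, the rational map between them is
defined over `O₁`, and its inverse over an open part of `O₂`. -/
theorem exists_good_modification {S P₁ P₂ U V W O₁ O₂ : Scheme.{u}} [IsNoetherian S] (f₁ : P₁ ⟶ S)
    (f₂ : P₂ ⟶ S) [IsProper f₁] [IsProper f₂] (v₁ : U ⟶ P₁) (v₂ : V ⟶ P₂) [IsOpenImmersion v₁]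
    [IsOpenImmersion v₂] [IsSchemeTheoreticallyDominant v₁] [IsSchemeTheoreticallyDominant v₂]
    (k₁ : W ⟶ U) (k₂ : W ⟶ V) (o₁ : O₁ ⟶ P₁) (o₂ : O₂ ⟶ P₂) [IsOpenImmersion o₁]
    [IsOpenImmersion o₂] (w₁ : W ⟶ O₁) (w₂ : W ⟶ O₂) (H₁ : IsPullback w₁ k₁ o₁ v₁)
    (H₂ : IsPullback w₂ k₂ o₂ v₂) (hk : k₁ ≫ v₁ ≫ f₁ = k₂ ≫ v₂ ≫ f₂) :
    ∃ (P₁' P₂' O₁' O₂' Ω : Scheme.{u}) (π : P₁' ⟶ P₁) (ρ : P₂' ⟶ P₂) (v₁' : U ⟶ P₁')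
      (v₂' : V ⟶ P₂') (o₁' : O₁' ⟶ P₁') (o₂' : O₂' ⟶ P₂') (π₁ : O₁' ⟶ O₁) (ρ₂ : O₂' ⟶ O₂)
      (w₁' : W ⟶ O₁') (w₂' : W ⟶ O₂') (γ : O₁' ⟶ P₂') (ω : Ω ⟶ O₂') (δ : Ω ⟶ O₁') (t : W ⟶ Ω),
      IsProper π ∧ IsProper ρ ∧ IsOpenImmersion v₁' ∧ IsOpenImmersion v₂' ∧
      IsSchemeTheoreticallyDominant v₁' ∧ IsSchemeTheoreticallyDominant v₂' ∧
      IsOpenImmersion o₁' ∧ IsOpenImmersion o₂' ∧ IsOpenImmersion w₁' ∧ IsOpenImmersion w₂' ∧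
      IsSchemeTheoreticallyDominant w₁' ∧ IsSchemeTheoreticallyDominant w₂' ∧
      IsOpenImmersion ω ∧ IsSchemeTheoreticallyDominant t ∧
      v₁' ≫ π = v₁ ∧ v₂' ≫ ρ = v₂ ∧ IsPullback o₁' π₁ π o₁ ∧ IsPullback o₂' ρ₂ ρ o₂ ∧
      w₁' ≫ o₁' = k₁ ≫ v₁' ∧ w₂' ≫ o₂' = k₂ ≫ v₂' ∧ γ ≫ ρ ≫ f₂ = o₁' ≫ π ≫ f₁ ∧
      w₁' ≫ γ = k₂ ≫ v₂' ∧ t ≫ ω = w₂' ∧ t ≫ δ = w₁' ∧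
      δ ≫ o₁' ≫ π ≫ f₁ = ω ≫ o₂' ≫ ρ ≫ f₂ ∧
      ∀ (Q : Scheme.{u}) (a : Q ⟶ P₁') (b : Q ⟶ O₂') (c : W ⟶ Q) [IsSchemeTheoreticallyDominant c],
        a ≫ π ≫ f₁ = b ≫ o₂' ≫ ρ ≫ f₂ → c ≫ a = k₁ ≫ v₁' → c ≫ b = w₂' →
        ∀ x, a x ∈ Set.range o₁' → b x ∈ Set.range ω := by
  have : IsNoetherian P₁ := isNoetherian_of_proper f₁
  have : IsNoetherian P₂ := isNoetherian_of_proper f₂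
  have : IsNoetherian O₁ := isNoetherian_of_isOpenImmersion o₁
  have : IsOpenImmersion w₁ := MorphismProperty.of_isPullback H₁.flip inferInstance
  have : IsNoetherian W := isNoetherian_of_isOpenImmersion w₁
  have : IsNoetherian (pullback f₁ f₂ : Scheme.{u}) :=
    isNoetherian_of_proper (pullback.fst f₁ f₂ ≫ f₁)
  let g₀ : W ⟶ pullback f₁ f₂ := pullback.lift (k₁ ≫ v₁) (k₂ ≫ v₂)
    (by simpa only [Category.assoc] using hk)
  let p₀ : g₀.image ⟶ P₁ := g₀.imageι ≫ pullback.fst f₁ f₂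
  let q₀ : g₀.image ⟶ P₂ := g₀.imageι ≫ pullback.snd f₁ f₂
  have hpq₀ : p₀ ≫ f₁ = q₀ ≫ f₂ := by
    simp only [p₀, q₀, Category.assoc, pullback.condition]
  have hιp₀ : g₀.toImage ≫ p₀ = k₁ ≫ v₁ := by
    rw [g₀.toImage_imageι_assoc]; exact pullback.lift_fst _ _ _
  have hιq₀ : g₀.toImage ≫ q₀ = k₂ ≫ v₂ := by
    rw [g₀.toImage_imageι_assoc]; exact pullback.lift_snd _ _ _
  have : IsSchemeTheoreticallyDominant g₀.toImage := toImage_dominant g₀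
  have : IsNoetherian g₀.image := isNoetherian_of_proper g₀.imageι
  obtain ⟨-, P, O, π₁, μ₁, o, v, w, α, a1, a2, a3, a4, a5, a6, a7, a8, a9, a10, a11, -, -, a14,
    a15⟩ := exists_modification_lift o₁ v₁ w₁ k₁ H₁ p₀ g₀.toImage (by rw [hιp₀, H₁.w])
  have : IsNoetherian P := isNoetherian_of_proper π₁
  have : IsNoetherian O := isNoetherian_of_isOpenImmersion o
  have : IsNoetherian (pullback (π₁ ≫ f₁) f₂ : Scheme.{u}) :=
    isNoetherian_of_proper (pullback.fst (π₁ ≫ f₁) f₂ ≫ π₁ ≫ f₁)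
  let g₁ : W ⟶ pullback (π₁ ≫ f₁) f₂ := pullback.lift (k₁ ≫ v) (k₂ ≫ v₂)
    (by rw [Category.assoc, Category.assoc, reassoc_of% a7, hk])
  let p₁ : g₁.image ⟶ P := g₁.imageι ≫ pullback.fst (π₁ ≫ f₁) f₂
  let q₁ : g₁.image ⟶ P₂ := g₁.imageι ≫ pullback.snd (π₁ ≫ f₁) f₂
  have hpq₁ : p₁ ≫ π₁ ≫ f₁ = q₁ ≫ f₂ := by
    simp only [p₁, q₁, Category.assoc, pullback.condition]
  have hιp₁ : g₁.toImage ≫ p₁ = k₁ ≫ v := by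
    rw [g₁.toImage_imageι_assoc]; exact pullback.lift_fst _ _ _
  have hιq₁ : g₁.toImage ≫ q₁ = k₂ ≫ v₂ := by
    rw [g₁.toImage_imageι_assoc]; exact pullback.lift_snd _ _ _
  have : IsSchemeTheoreticallyDominant g₁.toImage := toImage_dominant g₁
  have : IsNoetherian g₁.image := isNoetherian_of_proper g₁.imageι
  obtain ⟨K, P₂', O₂', ρ, μ', o₂', v₂', w₂', β, b1, b2, b3, b4, b5, b6, b7, b8, b9, b10, b11, b12,
    b13, b14, b15⟩ := exists_modification_lift o₂ v₂ w₂ k₂ H₂ q₁ g₁.toImage (by rw [hιq₁, H₂.w])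
  have : IsNoetherian P₂' := isNoetherian_of_proper ρ
  have : IsNoetherian O₂' := isNoetherian_of_isOpenImmersion o₂'
  obtain ⟨P₁', O₁', π₂, μ₂, o₁', v₁', w₁', c1, c2, c3, c4, c5, c6, c7, c8, c9, c10, c11, -, -⟩ :=
    exists_modification o v w k₁ a10 ((K.map o₂).comap (α ≫ q₀)) (by
      rw [← IdealSheafData.comap_comp, reassoc_of% a15, hιq₀, IdealSheafData.comap_comp, b13,
        IdealSheafData.comap_top])
  have : IsNoetherian P₁' := isNoetherian_of_proper π₂
  have : IsNoetherian O₁' := isNoetherian_of_isOpenImmersion o₁'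
  obtain ⟨γ, hγ⟩ := b12.lift _ (μ₂ ≫ α ≫ q₀) (by
    rw [IdealSheafData.comap_comp]; exact c11.cartier)
  have hwγ : w₁' ≫ γ = k₂ ≫ v₂' := by
    rw [eq_of_isPullback_id (isPullback_of_dominant v₂' ρ v₂ b7) (w₁' ≫ γ) k₂]
    rw [Category.assoc, hγ, reassoc_of% c8, reassoc_of% a15, hιq₀]
  have hαf : α ≫ q₀ ≫ f₂ = o ≫ π₁ ≫ f₁ := by
    rw [← hpq₀, reassoc_of% a14, ← a9.w_assoc]
  have hβf : β ≫ p₁ ≫ π₁ ≫ f₁ = o₂' ≫ ρ ≫ f₂ := by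
    rw [hpq₁, reassoc_of% b14, ← b9.w_assoc]
  let ω := pullback.fst (β ≫ p₁) o
  let ε := pullback.snd (β ≫ p₁) o
  have hωε : ω ≫ β ≫ p₁ = ε ≫ o := pullback.condition
  let t : W ⟶ pullback (β ≫ p₁) o := pullback.lift w₂' w (by
    rw [reassoc_of% b15, hιp₁, a10.w])
  have htω : t ≫ ω = w₂' := pullback.lift_fst _ _ _
  have htε : t ≫ ε = w := pullback.lift_snd _ _ _
  have ht : IsSchemeTheoreticallyDominant t := by
    have h1 : IsSchemeTheoreticallyDominant (t ≫ ω) := htω ▸ inferInstance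
    exact dominant_of_comp_isOpenImmersion t ω
  have hεω : ε ≫ α ≫ q₀ = ω ≫ β ≫ q₁ := by
    refine ext_of_isSchemeTheoreticallyDominant f₂ ?_ t ?_
    · simp only [Category.assoc]
      rw [hαf, ← hpq₁, ← reassoc_of% hωε]
    · rw [reassoc_of% htε, reassoc_of% htω, reassoc_of% a15, reassoc_of% b15, hιq₀, hιq₁]
  have hε : IsCartier (((K.map o₂).comap (α ≫ q₀)).comap ε) := by
    rw [← IdealSheafData.comap_comp, hεω, b14, ← b9.w, ← Category.assoc ω o₂' ρ,
        IdealSheafData.comap_comp]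
    exact b12.cartier.comap_of_flat _
  obtain ⟨δ, hδ⟩ := c11.lift _ ε hε
  have : IsProper μ₂ := c11.proper
  have htδ : t ≫ δ = w₁' := by
    have := eq_of_isPullback_id (isPullback_of_dominant w₁' μ₂ w c8) (t ≫ δ) (𝟙 W)
      (by rw [Category.assoc, hδ, htε, Category.id_comp])
    rwa [Category.id_comp] at this
  refine ⟨P₁', P₂', O₁', O₂', _, π₂ ≫ π₁, ρ, v₁', v₂', o₁', o₂', μ₂ ≫ μ₁, μ', w₁', w₂', γ, ω, δ, t,
    inferInstance, b1, c3, b3, c4, b4, c2, b2, c6, b6, c5, b5, inferInstance, ht, ?_, b7, ?_, b9,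
    c10.w, b10.w, ?_, hwγ, htω, htδ, ?_, ?_⟩
  · rw [reassoc_of% c7, a7]
  · exact c9.paste_vert a9
  · simp only [Category.assoc]
    rw [reassoc_of% hγ, hαf, c9.w_assoc]
  · simp only [Category.assoc]
    rw [c9.w_assoc, reassoc_of% hδ, ← reassoc_of% hωε, hβf]
  · intro Q a b c hc hab ha hb x hx
    have h : a ≫ π₂ = b ≫ β ≫ p₁ := by
      refine ext_of_isSchemeTheoreticallyDominant (π₁ ≫ f₁) ?_ c ?_
      · simp only [Category.assoc] at hab ⊢
        rw [hab, hβf]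
      · rw [reassoc_of% ha, reassoc_of% hb, reassoc_of% b15, hιp₁, c7]
    rw [mem_range_of_isPullback (IsPullback.of_hasPullback (β ≫ p₁) o)]
    rw [mem_range_of_isPullback c9] at hx
    have h' := congrArg (fun φ : Q ⟶ P => φ x) h
    have h'' : π₂ (a x) = (β ≫ p₁) (b x) := h'
    rwa [← h'']

theorem isOpenImmersion_of_two {X Y U V : Scheme.{u}} (u : U ⟶ X) (v : V ⟶ X) [IsOpenImmersion u]
    [IsOpenImmersion v] (hc : ∀ x, x ∈ Set.range u ∨ x ∈ Set.range v) (j : X ⟶ Y)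
    (hj : Function.Injective j) (hu : IsOpenImmersion (u ≫ j)) (hv : IsOpenImmersion (v ≫ j)) :
    IsOpenImmersion j := by
  have ho : IsOpenMap j := by
    intro O hO
    have : j '' O = (u ≫ j) '' (u ⁻¹' O) ∪ (v ≫ j) '' (v ⁻¹' O) := by
      ext y
      constructor
      · rintro ⟨x, hx, rfl⟩
        rcases hc x with ⟨a, rfl⟩ | ⟨a, rfl⟩
        · exact Or.inl ⟨a, hx, rfl⟩
        · exact Or.inr ⟨a, hx, rfl⟩
      · rintro (⟨a, ha, rfl⟩ | ⟨a, ha, rfl⟩)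
        · exact ⟨_, ha, rfl⟩
        · exact ⟨_, ha, rfl⟩
    rw [this]
    exact ((u ≫ j).isOpenEmbedding.isOpenMap _ (hO.preimage u.continuous)).union
      ((v ≫ j).isOpenEmbedding.isOpenMap _ (hO.preimage v.continuous))
  have hs : ∀ {U : Scheme.{u}} (u : U ⟶ X) [IsOpenImmersion u] (_ : IsOpenImmersion (u ≫ j))
      (x : U),
      IsIso (j.stalkMap (u x)) := by
    intro U u _ h x
    have h1 := Hom.stalkMap_comp u j x
    have h2 : IsIso (j.stalkMap (u x) ≫ u.stalkMap x) := by
      have h3 : IsIso ((u ≫ j).stalkMap x) := inferInstance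
      rwa [h1] at h3
    exact IsIso.of_isIso_comp_right _ (u.stalkMap x)
  have : ∀ x, IsIso (j.stalkMap x) := by
    intro x
    rcases hc x with ⟨a, rfl⟩ | ⟨a, rfl⟩
    · exact hs u hu a
    · exact hs v hv a
  exact IsOpenImmersion.of_isIso_stalkMap j (.of_continuous_injective_isOpenMap j.continuous hj ho)

/-- If the closures of `U \ V` and `V \ U` in given compactifications of `U` and `V` are separated
by the closure of the graph, then `U ∪ V` has a compactification. -/
theorem exists_compactification_of_disjoint {S X P₁ P₂ U V W : Scheme.{u}} [IsNoetherian S]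
    (f : X ⟶ S) (u : U ⟶ X) (v : V ⟶ X) [IsOpenImmersion u] [IsOpenImmersion v]
    (hc : ∀ x, x ∈ Set.range u ∨ x ∈ Set.range v) (k₁ : W ⟶ U) (k₂ : W ⟶ V)
    (H : IsPullback k₁ k₂ u v) (f₁ : P₁ ⟶ S)
    (f₂ : P₂ ⟶ S) [IsProper f₁] [IsProper f₂] (v₁ : U ⟶ P₁) (v₂ : V ⟶ P₂) [IsOpenImmersion v₁]
    [IsOpenImmersion v₂] [IsSchemeTheoreticallyDominant v₁] [IsSchemeTheoreticallyDominant v₂]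
    (hv₁ : v₁ ≫ f₁ = u ≫ f) (hv₂ : v₂ ≫ f₂ = v ≫ f) (A₁ : Set P₁) (B₂ : Set P₂)
    (hA₁ : IsClosed A₁) (hB₂ : IsClosed B₂) (hA : ∀ x, v₁ x ∉ A₁ ↔ x ∈ Set.range k₁)
    (hB : ∀ x, v₂ x ∉ B₂ ↔ x ∈ Set.range k₂) (g : W ⟶ pullback f₁ f₂)
    (hg₁ : g ≫ pullback.fst f₁ f₂ = k₁ ≫ v₁) (hg₂ : g ≫ pullback.snd f₁ f₂ = k₂ ≫ v₂)
    (hAB : ∀ y : g.image, (g.imageι ≫ pullback.fst f₁ f₂) y ∈ A₁ →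
      (g.imageι ≫ pullback.snd f₁ f₂) y ∉ B₂) :
    ∃ (Xb : Scheme.{u}) (fb : Xb ⟶ S) (j : X ⟶ Xb), IsProper fb ∧ IsOpenImmersion j ∧
      j ≫ fb = f := by
  have hk₁o : IsOpenImmersion k₁ := MorphismProperty.of_isPullback H.flip inferInstance
  have hk₂o : IsOpenImmersion k₂ := MorphismProperty.of_isPullback H inferInstance
  let O₁ : P₁.Opens := ⟨A₁ᶜ, hA₁.isOpen_compl⟩
  let O₂ : P₂.Opens := ⟨B₂ᶜ, hB₂.isOpen_compl⟩
  have hO₁ : ∀ x, x ∈ Set.range O₁.ι ↔ x ∉ A₁ := fun x => by rw [O₁.range_ι]; rfl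
  have hO₂ : ∀ x, x ∈ Set.range O₂.ι ↔ x ∉ B₂ := fun x => by rw [O₂.range_ι]; rfl
  have hr₁ : Set.range (k₁ ≫ v₁) ⊆ Set.range O₁.ι := by
    rintro _ ⟨x, rfl⟩
    exact (hO₁ _).mpr ((hA _).mpr ⟨x, rfl⟩)
  have hr₂ : Set.range (k₂ ≫ v₂) ⊆ Set.range O₂.ι := by
    rintro _ ⟨x, rfl⟩
    exact (hO₂ _).mpr ((hB _).mpr ⟨x, rfl⟩)
  have hw₁ := IsOpenImmersion.lift_fac O₁.ι (k₁ ≫ v₁) hr₁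
  have hw₂ := IsOpenImmersion.lift_fac O₂.ι (k₂ ≫ v₂) hr₂
  set w₁ := IsOpenImmersion.lift O₁.ι (k₁ ≫ v₁) hr₁
  set w₂ := IsOpenImmersion.lift O₂.ι (k₂ ≫ v₂) hr₂
  have H₁ : IsPullback w₁ k₁ O₁.ι v₁ := (isPullback_of_forall v₁ O₁.ι k₁ w₁ hw₁.symm
    fun x y hxy => (hA x).mp ((hO₁ _).mp ⟨y, hxy.symm⟩)).flip
  have H₂ : IsPullback w₂ k₂ O₂.ι v₂ := (isPullback_of_forall v₂ O₂.ι k₂ w₂ hw₂.symm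
    fun x y hxy => (hB x).mp ((hO₂ _).mp ⟨y, hxy.symm⟩)).flip
  have hk : k₁ ≫ v₁ ≫ f₁ = k₂ ≫ v₂ ≫ f₂ := by rw [hv₁, hv₂, H.w_assoc]
  obtain ⟨P₁', P₂', O₁', O₂', Ω, π, ρ, v₁', v₂', o₁, o₂, π₁, ρ₂, w₁', w₂', γ, ω, δ, t, a1, a2, a3,
    a4, a5, a6, a7, a8, a9, a10, a11, a12, a13, a14, a15, a16, a17, a18, a19, a20, a21, a22, a23,
    a24, a25, a26⟩ := exists_good_modification f₁ f₂ v₁ v₂ k₁ k₂ O₁.ι O₂.ι w₁ w₂ H₁ H₂ hk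
  have : IsNoetherian P₁' := isNoetherian_of_proper (π ≫ f₁)
  have : IsNoetherian P₂' := isNoetherian_of_proper (ρ ≫ f₂)
  have : IsNoetherian O₁' := isNoetherian_of_isOpenImmersion o₁
  have : IsNoetherian O₂' := isNoetherian_of_isOpenImmersion o₂
  have : IsNoetherian Ω := isNoetherian_of_isOpenImmersion ω
  have : IsNoetherian W := isNoetherian_of_isOpenImmersion w₁'
  have hom₁ : ∀ x, x ∈ Set.range o₁ ↔ π x ∉ A₁ := fun x => by
    rw [mem_range_of_isPullback a17, hO₁]
  have hom₂ : ∀ x, x ∈ Set.range o₂ ↔ ρ x ∉ B₂ := fun x => by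
    rw [mem_range_of_isPullback a18, hO₂]
  let g' : W ⟶ pullback (π ≫ f₁) (ρ ≫ f₂) := pullback.lift (k₁ ≫ v₁') (k₂ ≫ v₂')
    (by rw [Category.assoc, Category.assoc, reassoc_of% a15, reassoc_of% a16, hk])
  let p : g'.image ⟶ P₁' := g'.imageι ≫ pullback.fst _ _
  let q : g'.image ⟶ P₂' := g'.imageι ≫ pullback.snd _ _
  have hpq : p ≫ π ≫ f₁ = q ≫ ρ ≫ f₂ := by
    simp only [p, q, Category.assoc, pullback.condition]
  have hp : IsProper p := by
    have : IsProper (pullback.fst (π ≫ f₁) (ρ ≫ f₂)) := inferInstance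
    infer_instance
  have hq : IsProper q := by
    have : IsProper (pullback.snd (π ≫ f₁) (ρ ≫ f₂)) := inferInstance
    infer_instance
  have hcl : IsClosedImmersion (pullback.lift p q hpq) := by
    have : pullback.lift p q hpq = g'.imageι := by
      apply pullback.hom_ext
      · rw [pullback.lift_fst]
      · rw [pullback.lift_snd]
    rw [this]; infer_instance
  have hιp : g'.toImage ≫ p = k₁ ≫ v₁' := by
    rw [g'.toImage_imageι_assoc]; exact pullback.lift_fst _ _ _
  have hιq : g'.toImage ≫ q = k₂ ≫ v₂' := by
    rw [g'.toImage_imageι_assoc]; exact pullback.lift_snd _ _ _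
  have hdom : IsSchemeTheoreticallyDominant g'.toImage := toImage_dominant g'
  have hLp := isPullback_of_dominant g'.toImage p (k₁ ≫ v₁') hιp
  have hLq := isPullback_of_dominant g'.toImage q (k₂ ≫ v₂') hιq
  -- sections over `O₁'` and `Ω`
  obtain ⟨τ, hτ, hwτ⟩ := exists_lift_image g' w₁' (pullback.lift o₁ γ a21.symm) (by
    apply pullback.hom_ext
    · rw [Category.assoc, pullback.lift_fst, a19, pullback.lift_fst]
    · rw [Category.assoc, pullback.lift_snd, a22, pullback.lift_snd])
  have hτp : τ ≫ p = o₁ := by rw [reassoc_of% hτ]; exact pullback.lift_fst _ _ _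
  obtain ⟨σ, hσ, htσ⟩ := exists_lift_image g' t (pullback.lift (δ ≫ o₁) (ω ≫ o₂)
    (by simpa only [Category.assoc] using a25)) (by
    apply pullback.hom_ext
    · rw [Category.assoc, pullback.lift_fst, reassoc_of% a24, a19, pullback.lift_fst]
    · rw [Category.assoc, pullback.lift_snd, reassoc_of% a23, a20, pullback.lift_snd])
  have hσp : σ ≫ p = δ ≫ o₁ := by rw [reassoc_of% hσ]; exact pullback.lift_fst _ _ _
  have hσq : σ ≫ q = ω ≫ o₂ := by rw [reassoc_of% hσ]; exact pullback.lift_snd _ _ _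
  have hτd : IsSchemeTheoreticallyDominant τ := by
    have : IsSchemeTheoreticallyDominant (w₁' ≫ τ) := hwτ ▸ hdom
    exact dominant_of_comp w₁' τ
  have hσd : IsSchemeTheoreticallyDominant σ := by
    have : IsSchemeTheoreticallyDominant (t ≫ σ) := htσ ▸ hdom
    exact dominant_of_comp t σ
  have hLτ := isPullback_of_dominant τ p o₁ hτp
  have hLσ := isPullback_of_dominant σ q (ω ≫ o₂) hσq
  have hστ : σ = δ ≫ τ := eq_of_isPullback_id hLτ σ δ hσp
  have hτo : IsOpenImmersion τ := MorphismProperty.of_isPullback hLτ.flip inferInstance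
  have hσo : IsOpenImmersion σ := MorphismProperty.of_isPullback hLσ.flip inferInstance
  have hδo : IsOpenImmersion δ := by
    have : IsOpenImmersion (δ ≫ τ) := hστ ▸ hσo
    exact .of_comp δ τ
  have hLσ' : IsPullback σ (𝟙 Ω) p (δ ≫ o₁) := by
    rw [hστ]
    exact (IsPullback.of_vert_isIso ⟨by simp⟩ : IsPullback δ (𝟙 Ω) (𝟙 O₁') δ).paste_horiz hLτ
  have hσr : Set.range σ = (p ⁻¹' (π ⁻¹' A₁) ∪ q ⁻¹' (ρ ⁻¹' B₂))ᶜ := by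
    ext y
    rw [Set.mem_compl_iff, Set.mem_union, not_or]
    constructor
    · rintro ⟨z, rfl⟩
      refine ⟨(hom₁ _).mp ⟨δ z, ?_⟩, (hom₂ _).mp ⟨ω z, ?_⟩⟩
      · exact congrArg (fun φ : Ω ⟶ P₁' => φ z) hσp.symm
      · exact congrArg (fun φ : Ω ⟶ P₂' => φ z) hσq.symm
    · rintro ⟨h1, h2⟩
      obtain ⟨z, hz⟩ := (hom₂ _).mpr h2
      obtain ⟨y', hy', hz'⟩ := exists_preimage_of_isPullback (IsPullback.of_hasPullback q o₂) y z
        hz.symm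
      let c : W ⟶ pullback q o₂ := pullback.lift g'.toImage w₂' (by rw [hιq, a20])
      have hc₁ : c ≫ pullback.fst q o₂ = g'.toImage := pullback.lift_fst _ _ _
      have hc₂ : c ≫ pullback.snd q o₂ = w₂' := pullback.lift_snd _ _ _
      have : IsSchemeTheoreticallyDominant (c ≫ pullback.fst q o₂) := hc₁ ▸ hdom
      have hcd := dominant_of_comp_isOpenImmersion c (pullback.fst q o₂)
      have h3 := a26 _ (pullback.fst q o₂ ≫ p) (pullback.snd q o₂) c
        (by rw [Category.assoc, hpq, pullback.condition_assoc]) (by rw [reassoc_of% hc₁, hιp])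
            hc₂ y'
        (by rw [Hom.comp_apply, hy']; exact (hom₁ _).mpr h1)
      rw [hz'] at h3
      obtain ⟨s, hs⟩ := h3
      rw [mem_range_of_isPullback hLσ]
      exact ⟨s, by rw [Hom.comp_apply, hs, hz]⟩
  have hpA : ∀ x, x ∈ Set.range p ∨ x ∈ π ⁻¹' A₁ := by
    intro x
    by_cases h : π x ∈ A₁
    · exact Or.inr h
    · obtain ⟨z, rfl⟩ := (hom₁ x).mpr h
      exact Or.inl ⟨τ z, congrArg (fun φ : O₁' ⟶ P₁' => φ z) hτp⟩
  have hqB : ∀ x, x ∈ Set.range q ∨ x ∈ ρ ⁻¹' B₂ := by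
    intro x
    by_cases h : ρ x ∈ B₂
    · exact Or.inr h
    · left
      obtain ⟨z, rfl⟩ := (hom₂ x).mpr h
      have h1 : IsClosed (o₂ ⁻¹' (Set.range q)) :=
          q.isClosedMap.isClosed_range.preimage o₂.continuous
      have h2 : Set.range w₂' ⊆ o₂ ⁻¹' (Set.range q) := by
        rintro _ ⟨s, rfl⟩
        refine ⟨g'.toImage s, ?_⟩
        exact congrArg (fun φ : W ⟶ P₂' => φ s) (hιq.trans a20.symm)
      exact h1.closure_subset_iff.mpr h2 (w₂'.denseRange z)
  obtain ⟨l, hl, -⟩ := exists_lift_image g g'.toImage (pullback.lift (p ≫ π) (q ≫ ρ)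
    (by simpa only [Category.assoc] using hpq)) (by
    apply pullback.hom_ext
    · rw [Category.assoc, pullback.lift_fst, hg₁, reassoc_of% hιp, a15]
    · rw [Category.assoc, pullback.lift_snd, hg₂, reassoc_of% hιq, a16])
  have hl₁ : l ≫ g.imageι ≫ pullback.fst f₁ f₂ = p ≫ π := by
    rw [reassoc_of% hl]; exact pullback.lift_fst _ _ _
  have hl₂ : l ≫ g.imageι ≫ pullback.snd f₁ f₂ = q ≫ ρ := by
    rw [reassoc_of% hl]; exact pullback.lift_snd _ _ _
  have hAB' : ∀ y, p y ∈ π ⁻¹' A₁ → q y ∉ ρ ⁻¹' B₂ := by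
    intro y h1 h2
    refine hAB (l y) ?_ ?_
    · exact (congrArg (fun φ : g'.image ⟶ P₁ => φ y) hl₁).symm ▸ h1
    · exact (congrArg (fun φ : g'.image ⟶ P₂ => φ y) hl₂).symm ▸ h2
  obtain ⟨Xb, M₁, M₂, F, m₁, m₂, i₁, i₂, n₁, n₂, d1, d2, d3, d4, d5, d6, d7, d8, d9, d10, d11,
      d12⟩ :=
    exists_proper_glue (π ≫ f₁) (ρ ≫ f₂) p q hpq _ _ (hA₁.preimage π.continuous)
      (hB₂.preimage ρ.continuous) σ (δ ≫ o₁) (ω ≫ o₂) hLσ' hLσ hσr hpA hqB hAB'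
  have e₁ : ∀ x, v₁' x ∈ π ⁻¹' A₁ ↔ x ∉ Set.range k₁ := fun x => by
    rw [← hA, not_not, Set.mem_preimage, ← Hom.comp_apply, a15]
  have e₂ : ∀ x, v₂' x ∈ ρ ⁻¹' B₂ ↔ x ∉ Set.range k₂ := fun x => by
    rw [← hB, not_not, Set.mem_preimage, ← Hom.comp_apply, a16]
  have r₁ : Set.range v₁' ⊆ Set.range i₁ := by
    rintro _ ⟨x, rfl⟩
    rw [d8]
    rintro ⟨y, hy, hyx⟩
    have h1 : x ∈ Set.range k₁ := by
      by_contra h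
      exact hAB' y (by rw [hyx, e₁]; exact h) hy
    obtain ⟨s, rfl⟩ := h1
    obtain ⟨s', hs', -⟩ := exists_preimage_of_isPullback hLp y s hyx
    refine (e₂ (k₂ s')).mp ?_ ⟨s', rfl⟩
    rw [← Hom.comp_apply, ← hιq, Hom.comp_apply, hs']
    exact hy
  have r₂ : Set.range v₂' ⊆ Set.range i₂ := by
    rintro _ ⟨x, rfl⟩
    rw [d9]
    rintro ⟨y, hy, hyx⟩
    have h1 : x ∈ Set.range k₂ := by
      by_contra h
      exact hAB' y hy (by rw [hyx, e₂]; exact h)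
    obtain ⟨s, rfl⟩ := h1
    obtain ⟨s', hs', -⟩ := exists_preimage_of_isPullback hLq y s hyx
    refine (e₁ (k₁ s')).mp ?_ ⟨s', rfl⟩
    rw [← Hom.comp_apply, ← hιp, Hom.comp_apply, hs']
    exact hy
  have hu₁ := IsOpenImmersion.lift_fac i₁ v₁' r₁
  have hu₂ := IsOpenImmersion.lift_fac i₂ v₂' r₂
  set u₁ := IsOpenImmersion.lift i₁ v₁' r₁
  set u₂ := IsOpenImmersion.lift i₂ v₂' r₂
  have hu₁o : IsOpenImmersion u₁ := by
    have : IsOpenImmersion (u₁ ≫ i₁) := hu₁ ▸ a3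
    exact .of_comp u₁ i₁
  have hu₂o : IsOpenImmersion u₂ := by
    have : IsOpenImmersion (u₂ ≫ i₂) := hu₂ ▸ a4
    exact .of_comp u₂ i₂
  have ht₁ : t ≫ n₁ = k₁ ≫ u₁ := by
    rw [← cancel_mono i₁, Category.assoc, Category.assoc, d10, hu₁, reassoc_of% a24, a19]
  have ht₂ : t ≫ n₂ = k₂ ≫ u₂ := by
    rw [← cancel_mono i₂, Category.assoc, Category.assoc, d11, hu₂, reassoc_of% a23, a20]
  obtain ⟨j, hj₁, hj₂⟩ := exists_glue_two H hc (u₁ ≫ m₁) (u₂ ≫ m₂) (by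
    rw [← reassoc_of% ht₁, ← reassoc_of% ht₂, d12.w])
  have hj₁' : ∀ a, j (u a) = m₁ (u₁ a) := fun a => congrArg (fun φ : U ⟶ Xb => φ a) hj₁
  have hj₂' : ∀ a, j (v a) = m₂ (u₂ a) := fun a => congrArg (fun φ : V ⟶ Xb => φ a) hj₂
  have hcross : ∀ a b, j (u a) = j (v b) → u a = v b := by
    intro a b hab
    rw [hj₁', hj₂'] at hab
    obtain ⟨z, hz₁, hz₂⟩ := exists_preimage_of_isPullback d12 _ _ hab
    have h1 : v₁' a = p (σ z) := by
      rw [← hu₁, Hom.comp_apply, ← hz₁, ← Hom.comp_apply, d10, ← hσp, Hom.comp_apply]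
    have h2 : v₂' b = q (σ z) := by
      rw [← hu₂, Hom.comp_apply, ← hz₂, ← Hom.comp_apply, d11, ← hσq, Hom.comp_apply]
    have h3 : a ∈ Set.range k₁ := by
      by_contra h
      rw [← e₁, h1] at h
      have : σ z ∈ Set.range σ := ⟨z, rfl⟩
      rw [hσr] at this
      exact this (Or.inl h)
    obtain ⟨s, rfl⟩ := h3
    obtain ⟨s', hs', hs''⟩ := exists_preimage_of_isPullback hLp (σ z) s h1.symm
    have hs : s' = s := hs''
    subst hs
    have h4 : b = k₂ s' := v₂'.isOpenEmbedding.injective (by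
      rw [h2, ← hs', ← Hom.comp_apply, hιq, Hom.comp_apply])
    rw [h4, ← Hom.comp_apply, H.w, Hom.comp_apply]
  have hinj : Function.Injective j := by
    intro x y hxy
    rcases hc x with ⟨a, rfl⟩ | ⟨a, rfl⟩ <;> rcases hc y with ⟨b, rfl⟩ | ⟨b, rfl⟩
    · rw [hj₁', hj₁'] at hxy
      rw [u₁.isOpenEmbedding.injective (m₁.isOpenEmbedding.injective hxy)]
    · exact hcross a b hxy
    · exact (hcross b a hxy.symm).symm
    · rw [hj₂', hj₂'] at hxy
      rw [u₂.isOpenEmbedding.injective (m₂.isOpenEmbedding.injective hxy)]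
  refine ⟨Xb, F, j, d1, isOpenImmersion_of_two u v hc j hinj (hj₁ ▸ inferInstance)
    (hj₂ ▸ inferInstance), hom_ext_two hc ?_ ?_⟩
  · rw [reassoc_of% hj₁, d6, reassoc_of% hu₁, reassoc_of% a15, hv₁]
  · rw [reassoc_of% hj₂, d7, reassoc_of% hu₂, reassoc_of% a16, hv₂]

/-- The sections over `D` vanishing at the point `x` of `D`. -/
noncomputable def idealOfPoint {X : Scheme.{u}} (D : X.Opens) (x : X) (hx : x ∈ D) :
    Ideal Γ(X, D) :=
  (IsLocalRing.maximalIdeal (X.presheaf.stalk x)).comap (X.presheaf.germ D x hx).hom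

theorem mem_idealOfPoint {X : Scheme.{u}} {D : X.Opens} {x : X} (hx : x ∈ D) {s : Γ(X, D)} :
    s ∈ idealOfPoint D x hx ↔ x ∉ X.basicOpen s := by
  rw [X.mem_basicOpen s x hx, idealOfPoint, Ideal.mem_comap, IsLocalRing.mem_maximalIdeal]
  rfl

theorem idealOfPoint_ne_top {X : Scheme.{u}} {D : X.Opens} {x : X} (hx : x ∈ D) :
    idealOfPoint D x hx ≠ ⊤ :=
  Ideal.comap_ne_top _ (Ideal.IsPrime.ne_top inferInstance)

theorem mem_support_iff_secs_le {X : Scheme.{u}} {E : X.IdealSheafData} {D : X.Opens}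
    (hD : IsAffineOpen D) {x : X} (hx : x ∈ D) :
    x ∈ E.support ↔ secs E D hD ≤ idealOfPoint D x hx := by
  rw [IdealSheafData.mem_support_iff_of_mem (U := ⟨D, hD⟩) hx, mem_zeroLocus_iff]
  exact ⟨fun h r hr => (mem_idealOfPoint hx).mpr (h r hr),
    fun h r hr => (mem_idealOfPoint hx).mp (h hr)⟩

theorem appLE_mem_idealOfPoint {X Y : Scheme.{u}} (f : Y ⟶ X) {U : X.Opens} {V : Y.Opens}
    (h : V ≤ f ⁻¹ᵁ U) {y : Y} (hy : y ∈ V) (hfy : f y ∈ U) {s : Γ(X, U)}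
    (hs : s ∈ idealOfPoint U (f y) hfy) :
    (f.appLE U V h).hom s ∈ idealOfPoint V y hy := by
  rw [mem_idealOfPoint] at hs ⊢
  intro hy'
  have := Scheme.basicOpen_appLE f V U h s
  rw [show (Hom.appLE f U V h).hom s = (Hom.appLE f U V h) s from rfl, this] at hy'
  exact hs hy'.2

/-- Over `D`, the ideal `J` is principal with generator `s`, and `E = s e` with `e` vanishing at
`x`. -/
def StrictAt {X : Scheme.{u}} (J E : X.IdealSheafData) (D : X.Opens) (hD : IsAffineOpen D) (x : X)
    (hx : x ∈ D) : Prop :=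
  ∃ s : Γ(X, D), secs J D hD = Ideal.span {s} ∧ ∃ e : Ideal Γ(X, D),
    secs E D hD ≤ Ideal.span {s} * e ∧ e ≤ idealOfPoint D x hx

theorem StrictAt.comap {X Y : Scheme.{u}} {J E : X.IdealSheafData} (f : Y ⟶ X) {U : X.Opens}
    {hU : IsAffineOpen U} {V : Y.Opens} (hV : IsAffineOpen V) (h : V ≤ f ⁻¹ᵁ U) {y : Y} (hy : y ∈ V)
    (hfy : f y ∈ U) (H : StrictAt J E U hU (f y) hfy) :
        StrictAt (J.comap f) (E.comap f) V hV y hy := by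
  obtain ⟨s, hs, e, he, hev⟩ := H
  refine ⟨(f.appLE U V h).hom s, ?_, e.map (f.appLE U V h).hom, ?_, ?_⟩
  · rw [secs_comap J f hU hV h, hs, Ideal.map_span, Set.image_singleton]
  · rw [secs_comap E f hU hV h]
    refine (Ideal.map_mono he).trans ?_
    rw [Ideal.map_mul, Ideal.map_span, Set.image_singleton]
  · rw [Ideal.map_le_iff_le_comap]
    exact fun r hr => appLE_mem_idealOfPoint f h hy hfy (hev hr)

theorem StrictAt.of_mem_closure {X : Scheme.{u}} {J E : X.IdealSheafData} (hJ : IsCartier J)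
    (hEJ : E ≤ J) (P : Set X) (hPE : ∀ x ∈ P, x ∈ E.support) (hPJ : ∀ x ∈ P, x ∉ J.support) (a : X)
    (ha : a ∈ closure P) :
    ∃ (D : X.Opens) (hD : IsAffineOpen D) (haD : a ∈ D), StrictAt J E D hD a haD := by
  obtain ⟨D, hD, haD, s, -, hs⟩ := hJ a
  refine ⟨D, hD, haD, s, hs, (secs E D hD).colon {s}, ?_, ?_⟩
  · intro x hx
    have h1 : x ∈ secs J D hD := hEJ ⟨D, hD⟩ hx
    rw [hs, Ideal.mem_span_singleton'] at h1
    obtain ⟨r, rfl⟩ := h1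
    rw [mul_comm r s]
    exact Ideal.mul_mem_mul (Ideal.mem_span_singleton_self s) (Submodule.mem_colon_singleton.mpr hx)
  · intro r hr
    rw [mem_idealOfPoint]
    intro har
    obtain ⟨z, hz, hzP⟩ := mem_closure_iff.mp ha _ (X.basicOpen r).2 har
    have hzD : z ∈ D := X.basicOpen_le r hz
    have h1 := (mem_support_iff_secs_le hD hzD).mp (hPE z hzP)
      (Submodule.mem_colon_singleton.mp hr)
    have h2 : z ∈ X.basicOpen s := by
      by_contra h
      refine hPJ z hzP ((mem_support_iff_secs_le hD hzD).mpr ?_)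
      rw [hs, Ideal.span_singleton_le_iff_mem, mem_idealOfPoint]
      exact h
    rw [mem_idealOfPoint, smul_eq_mul, X.basicOpen_mul] at h1
    exact h1 ⟨hz, h2⟩

theorem IsCartier.mem_nonZeroDivisors {X : Scheme.{u}} {J : X.IdealSheafData} (hJ : IsCartier J)
    {D : X.Opens} (hD : IsAffineOpen D) {s : Γ(X, D)} (hs : secs J D hD = Ideal.span {s}) :
    s ∈ nonZeroDivisors Γ(X, D) := by
  rw [mem_nonZeroDivisors_iff_right]
  intro x hx
  refine eq_zero_of_locally D x fun p hp => ?_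
  obtain ⟨-, E, hE, hED, hpE, h1, -⟩ := hJ.exists_generator hD (fun _ : Unit => s)
    (by rw [hs, Set.range_const]) p hp
  refine ⟨E, hED, hpE, ?_⟩
  have h2 := congrArg (X.presheaf.map (homOfLE hED).op).hom hx
  rw [map_mul, map_zero] at h2
  exact (mem_nonZeroDivisors_iff_right.mp h1) _ h2

theorem false_of_strict {R : Type*} [CommRing R] {E F T T' e₁ e₂ m : Ideal R} {s₁ s₂ : R}
    (hs₁ : s₁ ∈ nonZeroDivisors R) (hs₂ : s₂ ∈ nonZeroDivisors R) (h₁ : E ⊔ T = Ideal.span {s₁})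
    (h₂ : F ⊔ T' = Ideal.span {s₂}) (hE : E ≤ Ideal.span {s₁} * e₁) (hF : F ≤ Ideal.span {s₂} * e₂)
    (he₁ : e₁ ≤ m) (he₂ : e₂ ≤ m) (hm : m ≠ ⊤) (hT : T * T' ≤ E * F) : False := by
  have h3 : Ideal.span {s₁ * s₂} ≤ Ideal.span {s₁ * s₂} * m := by
    conv_lhs => rw [← Ideal.span_singleton_mul_span_singleton, ← h₁, ← h₂, Ideal.sup_mul]
    have hEF : E * (F ⊔ T') ≤ Ideal.span {s₁ * s₂} * m := by
      rw [h₂, ← Ideal.span_singleton_mul_span_singleton, mul_right_comm]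
      exact Ideal.mul_mono_left (hE.trans (Ideal.mul_mono_right he₁))
    refine sup_le hEF ?_
    rw [Ideal.mul_sup]
    refine sup_le ?_ (hT.trans ((Ideal.mul_mono_right le_sup_left).trans hEF))
    rw [← Ideal.span_singleton_mul_span_singleton, mul_assoc]
    exact Ideal.mul_mono (le_sup_right.trans h₁.le) (hF.trans (Ideal.mul_mono_right he₂))
  have h4 := h3 (Ideal.mem_span_singleton_self _)
  rw [Ideal.mem_span_singleton_mul] at h4
  obtain ⟨z, hz, h⟩ := h4
  have h5 : z = 1 := by
    have h6 : (z - 1) * (s₁ * s₂) = 0 := by linear_combination h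
    have h7 := mem_nonZeroDivisors_iff_right.mp (mul_mem hs₁ hs₂) _ h6
    exact sub_eq_zero.mp h7
  exact hm ((Ideal.eq_top_iff_one m).mpr (h5 ▸ hz))

theorem exists_pow_le_of_support_le {X : Scheme.{u}} [IsNoetherian X] {J K : X.IdealSheafData}
    (h : K.support ≤ J.support) : ∃ n : ℕ, J ^ n ≤ K := by
  have hJK : J ≤ K.radical := by
    rw [← IdealSheafData.vanishingIdeal_support]
    exact IdealSheafData.le_support_iff_le_vanishingIdeal.mp h
  have h1 : ∀ x : X, ∃ (D : X.Opens) (hD : IsAffineOpen D) (n : ℕ), x ∈ D ∧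
      secs J D hD ^ n ≤ secs K D hD := by
    intro x
    obtain ⟨D, hD, hx, -⟩ := exists_affine_mem_le ⊤ x trivial
    have : IsNoetherianRing Γ(X, D) := IsLocallyNoetherian.component_noetherian ⟨D, hD⟩
    obtain ⟨n, hn⟩ := Ideal.exists_pow_le_of_le_radical_of_fg (hJK ⟨D, hD⟩)
      (IsNoetherian.noetherian (J.ideal ⟨D, hD⟩))
    exact ⟨D, hD, n, hx, hn⟩
  choose D hD n hx hn using h1
  obtain ⟨t, ht⟩ := isCompact_univ.elim_finite_subcover (fun x => (D x : Set X))
    (fun x => (D x).2) (fun x _ => Set.mem_iUnion.mpr ⟨x, hx x⟩)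
  refine ⟨t.sup n, ideal_le fun x => ?_⟩
  obtain ⟨y, hy, hxy⟩ := Set.mem_iUnion₂.mp (ht (Set.mem_univ x))
  exact ⟨D y, hD y, hxy, (Ideal.pow_le_pow_right (Finset.le_sup hy)).trans (hn y)⟩

theorem exists_blowup_away {P U : Scheme.{u}} [IsLocallyNoetherian P] (v : U ⟶ P)
    [IsOpenImmersion v] [IsSchemeTheoreticallyDominant v] (I : P.IdealSheafData)
    (hI : I.comap v = ⊤) :
    ∃ (P' : Scheme.{u}) (π : P' ⟶ P) (v' : U ⟶ P'), IsProper π ∧ IsOpenImmersion v' ∧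
      IsSchemeTheoreticallyDominant v' ∧ v' ≫ π = v ∧ IsCartier (I.comap π) := by
  obtain ⟨P', π, hπ⟩ := exists_blowup P I
  obtain ⟨v', hv', hv'p⟩ := hπ.exists_section v hI
  exact ⟨P', π, v', hπ.proper, MorphismProperty.of_isPullback hv'p.flip inferInstance,
    hπ.dominant_lift v hI v' hv', hv', hπ.cartier⟩

theorem not_strictAt {Y : Scheme.{u}} {E F T T' J₁ J₂ : Y.IdealSheafData} (h₁ : J₁ = E ⊔ T)
    (h₂ : J₂ = F ⊔ T') (C₁ : IsCartier J₁) (C₂ : IsCartier J₂) (hT : T * T' ≤ E * F) {V : Y.Opens}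
    (hV : IsAffineOpen V) {y : Y} (hy : y ∈ V) (H₁ : StrictAt J₁ E V hV y hy)
    (H₂ : StrictAt J₂ F V hV y hy) : False := by
  obtain ⟨s₁, hs₁, e₁, he₁, hm₁⟩ := H₁
  obtain ⟨s₂, hs₂, e₂, he₂, hm₂⟩ := H₂
  have h₁' : secs E V hV ⊔ secs T V hV = Ideal.span {s₁} := by rw [← hs₁, h₁]; rfl
  have h₂' : secs F V hV ⊔ secs T' V hV = Ideal.span {s₂} := by rw [← hs₂, h₂]; rfl
  exact false_of_strict (C₁.mem_nonZeroDivisors hV hs₁) (C₂.mem_nonZeroDivisors hV hs₂) h₁' h₂'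
    he₁ he₂ hm₁ hm₂ (idealOfPoint_ne_top hy) (hT ⟨V, hV⟩)

theorem StrictAt.not_both {Y P Q : Scheme.{u}} {E : P.IdealSheafData} {F : Q.IdealSheafData}
    {J₁ : P.IdealSheafData} {J₂ : Q.IdealSheafData} {T T' : Y.IdealSheafData} (p : Y ⟶ P)
    (q : Y ⟶ Q) (h₁ : J₁.comap p = E.comap p ⊔ T) (h₂ : J₂.comap q = F.comap q ⊔ T')
    (C₁ : IsCartier (J₁.comap p)) (C₂ : IsCartier (J₂.comap q))
    (hT : T * T' ≤ E.comap p * F.comap q) (y : Y)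
    (H₁ : ∃ (D : P.Opens) (hD : IsAffineOpen D) (haD : p y ∈ D), StrictAt J₁ E D hD (p y) haD)
    (H₂ : ∃ (D : Q.Opens) (hD : IsAffineOpen D) (haD : q y ∈ D), StrictAt J₂ F D hD (q y) haD) :
    False := by
  obtain ⟨D, hD, hpD, H₁⟩ := H₁
  obtain ⟨D', hD', hqD, H₂⟩ := H₂
  obtain ⟨V, hV, hy, hle⟩ := exists_affine_mem_le (p ⁻¹ᵁ D ⊓ q ⁻¹ᵁ D') y ⟨hpD, hqD⟩
  exact not_strictAt h₁ h₂ C₁ C₂ hT hV hy (H₁.comap p hV (hle.trans inf_le_left) hy hpD)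
    (H₂.comap q hV (hle.trans inf_le_right) hy hqD)

/-- Points of the closure of the graph lying over `U` and `V` are points of `U ∩ V`. -/
theorem mem_range_toImage {S X P₁ P₂ U V W : Scheme.{u}} (f : X ⟶ S) [IsSeparated f]
    (u : U ⟶ X) (v : V ⟶ X) (k₁ : W ⟶ U) (k₂ : W ⟶ V) [IsOpenImmersion k₁]
    (H : IsPullback k₁ k₂ u v) (f₁ : P₁ ⟶ S)
    (f₂ : P₂ ⟶ S) [IsProper f₁] [IsProper f₂] (v₁ : U ⟶ P₁) (v₂ : V ⟶ P₂) [IsOpenImmersion v₁]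
    [IsOpenImmersion v₂] (hv₁ : v₁ ≫ f₁ = u ≫ f) (hv₂ : v₂ ≫ f₂ = v ≫ f)
    (g : W ⟶ pullback f₁ f₂) [QuasiCompact g] [IsNoetherian W]
    (hg₁ : g ≫ pullback.fst f₁ f₂ = k₁ ≫ v₁) (hg₂ : g ≫ pullback.snd f₁ f₂ = k₂ ≫ v₂)
    (y : g.image) (hy₁ : (g.imageι ≫ pullback.fst f₁ f₂) y ∈ Set.range v₁)
    (hy₂ : (g.imageι ≫ pullback.snd f₁ f₂) y ∈ Set.range v₂) : y ∈ Set.range g.toImage := by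
  let p : g.image ⟶ P₁ := g.imageι ≫ pullback.fst _ _
  let q : g.image ⟶ P₂ := g.imageι ≫ pullback.snd _ _
  have hpq : p ≫ f₁ = q ≫ f₂ := by simp only [p, q, Category.assoc, pullback.condition]
  have hιp : g.toImage ≫ p = k₁ ≫ v₁ := by rw [g.toImage_imageι_assoc]; exact hg₁
  have hιq : g.toImage ≫ q = k₂ ≫ v₂ := by rw [g.toImage_imageι_assoc]; exact hg₂
  have hdom : IsSchemeTheoreticallyDominant g.toImage := toImage_dominant g
  have hp : IsProper p := by
    have : IsProper (pullback.fst f₁ f₂) := inferInstance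
    infer_instance
  have hLp := isPullback_of_dominant g.toImage p (k₁ ≫ v₁) hιp
  let O : g.image.Opens := p ⁻¹ᵁ v₁.opensRange ⊓ q ⁻¹ᵁ v₂.opensRange
  have ha : Set.range (O.ι ≫ p) ⊆ Set.range v₁ := by
    rintro _ ⟨x, rfl⟩
    exact x.2.1
  have hb : Set.range (O.ι ≫ q) ⊆ Set.range v₂ := by
    rintro _ ⟨x, rfl⟩
    exact x.2.2
  have hO : Set.range g.toImage ⊆ Set.range O.ι := by
    rintro _ ⟨x, rfl⟩
    rw [O.range_ι]
    exact ⟨⟨k₁ x, (congrArg (fun φ : _ ⟶ P₁ => φ x) hιp).symm⟩,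
      ⟨k₂ x, (congrArg (fun φ : _ ⟶ P₂ => φ x) hιq).symm⟩⟩
  have ha' := IsOpenImmersion.lift_fac v₁ (O.ι ≫ p) ha
  have hb' := IsOpenImmersion.lift_fac v₂ (O.ι ≫ q) hb
  have hn' := IsOpenImmersion.lift_fac O.ι g.toImage hO
  set a := IsOpenImmersion.lift v₁ (O.ι ≫ p) ha
  set b := IsOpenImmersion.lift v₂ (O.ι ≫ q) hb
  set n := IsOpenImmersion.lift O.ι g.toImage hO
  have hn : IsSchemeTheoreticallyDominant n := by
    have h1 : QuasiCompact (n ≫ O.ι) := hn' ▸ inferInstance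
    have h2 : IsSchemeTheoreticallyDominant (n ≫ O.ι) := hn' ▸ inferInstance
    exact dominant_of_comp_isOpenImmersion n O.ι
  have hna : n ≫ a = k₁ := by
    rw [← cancel_mono v₁, Category.assoc, ha', reassoc_of% hn', hιp]
  have hnb : n ≫ b = k₂ := by
    rw [← cancel_mono v₂, Category.assoc, hb', reassoc_of% hn', hιq]
  have hab : a ≫ u = b ≫ v := by
    refine ext_of_isSchemeTheoreticallyDominant f ?_ n ?_
    · rw [Category.assoc, Category.assoc, ← hv₁, ← hv₂, reassoc_of% ha', reassoc_of% hb', hpq]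
    · rw [reassoc_of% hna, reassoc_of% hnb, H.w]
  have h3 := eq_of_isPullback_id hLp O.ι (H.lift a b hab)
    (by rw [H.lift_fst_assoc, ha'])
  let y' : O := ⟨y, hy₁, hy₂⟩
  exact ⟨H.lift a b hab y', (congrArg (fun φ : _ ⟶ g.image => φ y') h3).symm⟩

/-- The closure of the complement of `k` does not meet `k`. -/
theorem notMem_closure_iff {P U W : Scheme.{u}} (v : U ⟶ P) [IsOpenImmersion v] (k : W ⟶ U)
    [IsOpenImmersion k] (x : U) :
    v x ∉ closure (v '' (Set.range k)ᶜ) ↔ x ∈ Set.range k := by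
  rw [← not_iff_not, not_not, mem_closure_iff]
  constructor
  · intro h hx
    obtain ⟨_, ⟨z, hz, hz'⟩, ⟨t, ht, rfl⟩⟩ := h (v '' Set.range k)
      (v.isOpenEmbedding.isOpenMap _ k.isOpenEmbedding.isOpen_range) ⟨x, hx, rfl⟩
    exact ht (v.isOpenEmbedding.injective hz' ▸ hz)
  · exact fun h => mem_closure_iff.mp (subset_closure ⟨x, h, rfl⟩)

/-- Nagata gluing of two compactifications. -/
theorem exists_compactification_of_two {S X P₁ P₂ U V : Scheme.{u}} [IsNoetherian S] (f : X ⟶ S)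
    [IsSeparated f] (u : U ⟶ X) (v : V ⟶ X) [IsOpenImmersion u] [IsOpenImmersion v]
    (hc : ∀ x, x ∈ Set.range u ∨ x ∈ Set.range v) (f₁ : P₁ ⟶ S)
    (f₂ : P₂ ⟶ S) [IsProper f₁] [IsProper f₂] (v₁ : U ⟶ P₁) (v₂ : V ⟶ P₂) [IsOpenImmersion v₁]
    [IsOpenImmersion v₂] [IsSchemeTheoreticallyDominant v₁] [IsSchemeTheoreticallyDominant v₂]
    (hv₁ : v₁ ≫ f₁ = u ≫ f) (hv₂ : v₂ ≫ f₂ = v ≫ f) :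
    ∃ (Xb : Scheme.{u}) (fb : Xb ⟶ S) (j : X ⟶ Xb), IsProper fb ∧ IsOpenImmersion j ∧
      j ≫ fb = f := by
  have : IsNoetherian P₁ := isNoetherian_of_proper f₁
  have : IsNoetherian P₂ := isNoetherian_of_proper f₂
  have : IsNoetherian U := isNoetherian_of_isOpenImmersion v₁
  have H : IsPullback (pullback.fst u v) (pullback.snd u v) u v := IsPullback.of_hasPullback u v
  generalize pullback.fst u v = k₁ at H
  generalize pullback.snd u v = k₂ at H
  generalize pullback u v = W at k₁ k₂ H
  have hk₁o : IsOpenImmersion k₁ := MorphismProperty.of_isPullback H.flip inferInstance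
  have hk₂o : IsOpenImmersion k₂ := MorphismProperty.of_isPullback H inferInstance
  have : IsNoetherian W := isNoetherian_of_isOpenImmersion k₁
  have hk : k₁ ≫ v₁ ≫ f₁ = k₂ ≫ v₂ ≫ f₂ := by rw [hv₁, hv₂, H.w_assoc]
  let g : W ⟶ pullback f₁ f₂ := pullback.lift (k₁ ≫ v₁) (k₂ ≫ v₂) (by simpa using hk)
  have hg₁ : g ≫ pullback.fst f₁ f₂ = k₁ ≫ v₁ := pullback.lift_fst _ _ _
  have hg₂ : g ≫ pullback.snd f₁ f₂ = k₂ ≫ v₂ := pullback.lift_snd _ _ _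
  let p : g.image ⟶ P₁ := g.imageι ≫ pullback.fst _ _
  let q : g.image ⟶ P₂ := g.imageι ≫ pullback.snd _ _
  have hιp : g.toImage ≫ p = k₁ ≫ v₁ := by rw [g.toImage_imageι_assoc]; exact hg₁
  have hιq : g.toImage ≫ q = k₂ ≫ v₂ := by rw [g.toImage_imageι_assoc]; exact hg₂
  have : IsNoetherian (pullback f₁ f₂) := isNoetherian_of_proper (pullback.fst f₁ f₂ ≫ f₁)
  have : IsNoetherian g.image := isNoetherian_of_proper g.imageι
  let E : P₁.IdealSheafData := IdealSheafData.vanishingIdeal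
    ⟨closure (v₁ '' (Set.range k₁)ᶜ), isClosed_closure⟩
  let F : P₂.IdealSheafData := IdealSheafData.vanishingIdeal
    ⟨closure (v₂ '' (Set.range k₂)ᶜ), isClosed_closure⟩
  let T : P₁.IdealSheafData := IdealSheafData.vanishingIdeal
    ⟨(Set.range v₁)ᶜ, v₁.isOpenEmbedding.isOpen_range.isClosed_compl⟩
  let T' : P₂.IdealSheafData := IdealSheafData.vanishingIdeal
    ⟨(Set.range v₂)ᶜ, v₂.isOpenEmbedding.isOpen_range.isClosed_compl⟩
  have hE : ∀ x, x ∈ E.support ↔ x ∈ closure (v₁ '' (Set.range k₁)ᶜ) := fun x =>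
    Set.ext_iff.mp (IdealSheafData.coe_support_vanishingIdeal _) x
  have hF : ∀ x, x ∈ F.support ↔ x ∈ closure (v₂ '' (Set.range k₂)ᶜ) := fun x =>
    Set.ext_iff.mp (IdealSheafData.coe_support_vanishingIdeal _) x
  have hT : ∀ x, x ∈ T.support ↔ x ∉ Set.range v₁ := fun x =>
    Set.ext_iff.mp (IdealSheafData.coe_support_vanishingIdeal _) x
  have hT' : ∀ x, x ∈ T'.support ↔ x ∉ Set.range v₂ := fun x =>
    Set.ext_iff.mp (IdealSheafData.coe_support_vanishingIdeal _) x
  obtain ⟨M, hM⟩ : ∃ M : ℕ, (T.comap p * T'.comap q) ^ M ≤ E.comap p * F.comap q := by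
    refine exists_pow_le_of_support_le fun y hy => ?_
    rw [IdealSheafData.support_mul, IdealSheafData.support_comap,
      IdealSheafData.support_comap] at hy ⊢
    by_contra hy'
    have hy₁ : p y ∈ Set.range v₁ := by
      by_contra h
      exact hy' (Or.inl ((hT _).mpr h))
    have hy₂ : q y ∈ Set.range v₂ := by
      by_contra h
      exact hy' (Or.inr ((hT' _).mpr h))
    obtain ⟨w, rfl⟩ := mem_range_toImage f u v k₁ k₂ H f₁ f₂ v₁ v₂ hv₁ hv₂ g hg₁ hg₂ y hy₁ hy₂
    rcases hy with hy | hy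
    · have h1 : p (g.toImage w) = v₁ (k₁ w) := congrArg (fun φ : _ ⟶ P₁ => φ w) hιp
      exact (notMem_closure_iff v₁ k₁ (k₁ w)).mpr ⟨w, rfl⟩ (h1 ▸ (hE _).mp hy)
    · have h1 : q (g.toImage w) = v₂ (k₂ w) := congrArg (fun φ : _ ⟶ P₂ => φ w) hιq
      exact (notMem_closure_iff v₂ k₂ (k₂ w)).mpr ⟨w, rfl⟩ (h1 ▸ (hF _).mp hy)
  have hTv : T.comap v₁ = ⊤ := comap_eq_top_iff.mpr fun x h => (hT _).mp h ⟨x, rfl⟩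
  have hTv' : T'.comap v₂ = ⊤ := comap_eq_top_iff.mpr fun x h => (hT' _).mp h ⟨x, rfl⟩
  have hI₁ : (E ⊔ T ^ M).comap v₁ = ⊤ := by
    rw [IdealSheafData.comap_sup, comap_pow, hTv]
    exact top_le_iff.mp (le_sup_of_le_right (by rw [← IdealSheafData.one_eq_top, one_pow]))
  have hI₂ : (F ⊔ T' ^ M).comap v₂ = ⊤ := by
    rw [IdealSheafData.comap_sup, comap_pow, hTv']
    exact top_le_iff.mp (le_sup_of_le_right (by rw [← IdealSheafData.one_eq_top, one_pow]))
  obtain ⟨P₁', π, v₁', hπ, hv₁o, hv₁d, hv₁', hC₁⟩ := exists_blowup_away v₁ _ hI₁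
  obtain ⟨P₂', ρ, v₂', hρ, hv₂o, hv₂d, hv₂', hC₂⟩ := exists_blowup_away v₂ _ hI₂
  have hk' : (k₁ ≫ v₁') ≫ π ≫ f₁ = (k₂ ≫ v₂') ≫ ρ ≫ f₂ := by
    rw [Category.assoc, Category.assoc, reassoc_of% hv₁', reassoc_of% hv₂', hk]
  let g' : W ⟶ pullback (π ≫ f₁) (ρ ≫ f₂) := pullback.lift (k₁ ≫ v₁') (k₂ ≫ v₂') hk'
  have hg₁' : g' ≫ pullback.fst (π ≫ f₁) (ρ ≫ f₂) = k₁ ≫ v₁' := pullback.lift_fst _ _ _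
  have hg₂' : g' ≫ pullback.snd (π ≫ f₁) (ρ ≫ f₂) = k₂ ≫ v₂' := pullback.lift_snd _ _ _
  refine exists_compactification_of_disjoint f u v hc k₁ k₂ H (π ≫ f₁) (ρ ≫ f₂) v₁' v₂'
    (by rw [reassoc_of% hv₁', hv₁]) (by rw [reassoc_of% hv₂', hv₂])
    (closure (v₁' '' (Set.range k₁)ᶜ)) (closure (v₂' '' (Set.range k₂)ᶜ))
    isClosed_closure isClosed_closure (notMem_closure_iff v₁' k₁) (notMem_closure_iff v₂' k₂)
    g' hg₁' hg₂' fun y hy₁ hy₂ => ?_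
  let p' : g'.image ⟶ P₁' := g'.imageι ≫ pullback.fst _ _
  let q' : g'.image ⟶ P₂' := g'.imageι ≫ pullback.snd _ _
  have hιp' : g'.toImage ≫ p' = k₁ ≫ v₁' := by rw [g'.toImage_imageι_assoc]; exact hg₁'
  have hιq' : g'.toImage ≫ q' = k₂ ≫ v₂' := by rw [g'.toImage_imageι_assoc]; exact hg₂'
  have hpq' : (p' ≫ π) ≫ f₁ = (q' ≫ ρ) ≫ f₂ := by
    simp only [p', q', Category.assoc, pullback.condition]
  have hdom : IsSchemeTheoreticallyDominant g'.toImage := toImage_dominant g'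
  obtain ⟨l, hl, -⟩ := exists_lift_image g g'.toImage (pullback.lift (p' ≫ π) (q' ≫ ρ) hpq') (by
    apply pullback.hom_ext
    · rw [Category.assoc, pullback.lift_fst, reassoc_of% hιp', hv₁', hg₁]
    · rw [Category.assoc, pullback.lift_snd, reassoc_of% hιq', hv₂', hg₂])
  have hlp : l ≫ p = p' ≫ π := by rw [reassoc_of% hl]; exact pullback.lift_fst _ _ _
  have hlq : l ≫ q = q' ≫ ρ := by rw [reassoc_of% hl]; exact pullback.lift_snd _ _ _
  refine StrictAt.not_both (E := E.comap π) (F := F.comap ρ) (J₁ := (E ⊔ T ^ M).comap π)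
    (J₂ := (F ⊔ T' ^ M).comap ρ) (T := ((T ^ M).comap π).comap p')
    (T' := ((T' ^ M).comap ρ).comap q') p' q' ?_ ?_ ?_ ?_ ?_ y ?_ ?_
  · rw [IdealSheafData.comap_sup, IdealSheafData.comap_sup]
  · rw [IdealSheafData.comap_sup, IdealSheafData.comap_sup]
  · refine hC₁.comap_of_dominant p' g'.toImage ?_
    rw [hιp', ← IdealSheafData.comap_comp, Category.assoc, hv₁', IdealSheafData.comap_comp, hI₁,
      IdealSheafData.comap_top]
  · refine hC₂.comap_of_dominant q' g'.toImage ?_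
    rw [hιq', ← IdealSheafData.comap_comp, Category.assoc, hv₂', IdealSheafData.comap_comp, hI₂,
      IdealSheafData.comap_top]
  · have h1 := IdealSheafData.comap_mono l hM
    dsimp only at h1
    rw [comap_pow, comap_mul, comap_mul, ← IdealSheafData.comap_comp, ← IdealSheafData.comap_comp,
      ← IdealSheafData.comap_comp, ← IdealSheafData.comap_comp, hlp, hlq, mul_pow, ← comap_pow,
      ← comap_pow] at h1
    rwa [← IdealSheafData.comap_comp, ← IdealSheafData.comap_comp, ← IdealSheafData.comap_comp,
      ← IdealSheafData.comap_comp]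
  · refine StrictAt.of_mem_closure hC₁ (IdealSheafData.comap_mono π le_sup_left)
      (v₁' '' (Set.range k₁)ᶜ) ?_ ?_ _ hy₁
    · rintro _ ⟨x, hx, rfl⟩
      have h1 : π (v₁' x) = v₁ x := congrArg (fun φ : _ ⟶ P₁ => φ x) hv₁'
      rw [IdealSheafData.support_comap]
      exact (hE _).mpr (subset_closure ⟨x, hx, h1.symm⟩)
    · rintro _ ⟨x, hx, rfl⟩
      refine comap_eq_top_iff.mp ?_ x
      rw [← IdealSheafData.comap_comp, hv₁', hI₁]
  · refine StrictAt.of_mem_closure hC₂ (IdealSheafData.comap_mono ρ le_sup_left)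
      (v₂' '' (Set.range k₂)ᶜ) ?_ ?_ _ hy₂
    · rintro _ ⟨x, hx, rfl⟩
      have h1 : ρ (v₂' x) = v₂ x := congrArg (fun φ : _ ⟶ P₂ => φ x) hv₂'
      rw [IdealSheafData.support_comap]
      exact (hF _).mpr (subset_closure ⟨x, hx, h1.symm⟩)
    · rintro _ ⟨x, hx, rfl⟩
      refine comap_eq_top_iff.mp ?_ x
      rw [← IdealSheafData.comap_comp, hv₂', hI₂]

/-- `f` is a scheme-theoretically dense open subscheme of a proper scheme. -/
def HasCompactification {X S : Scheme.{u}} (f : X ⟶ S) : Prop :=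
  ∃ (P : Scheme.{u}) (fP : P ⟶ S) (v : X ⟶ P), IsProper fP ∧ IsOpenImmersion v ∧
    IsSchemeTheoreticallyDominant v ∧ v ≫ fP = f

theorem HasCompactification.of_isImmersion {X S P : Scheme.{u}} (fP : P ⟶ S) [IsProper fP]
    (i : X ⟶ P) [IsImmersion i] [QuasiCompact i] : HasCompactification (i ≫ fP) :=
  ⟨i.image, i.imageι ≫ fP, i.toImage, inferInstance, inferInstance, toImage_dominant i, by
    rw [i.toImage_imageι_assoc]⟩

theorem HasCompactification.of_exists {X S : Scheme.{u}} [IsNoetherian S] {f : X ⟶ S}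
    (h : ∃ (P : Scheme.{u}) (fP : P ⟶ S) (v : X ⟶ P), IsProper fP ∧ IsOpenImmersion v ∧
      v ≫ fP = f) : HasCompactification f := by
  obtain ⟨P, fP, v, hP, hv, rfl⟩ := h
  have : IsNoetherian P := isNoetherian_of_proper fP
  exact .of_isImmersion fP v

theorem HasCompactification.spec {A B : CommRingCat.{u}} (φ : A ⟶ B) (hφ : φ.hom.FiniteType) :
    HasCompactification (Spec.map φ) := by
  algebraize [φ.hom]
  obtain ⟨n, s, hs⟩ := Algebra.FiniteType.iff_quotient_mvPolynomial''.mp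
    (show Algebra.FiniteType A B from hφ)
  let P := projSpace A (n + 1)
  have := P.proper
  have := P.isOpenImmersion
  obtain ⟨a, ha, hat⟩ := P.exists_hom 0 φ (Fin.cons 1 fun i => s (MvPolynomial.X i)) (by simp)
  have hsurj : Function.Surjective a.hom := by
    intro b
    obtain ⟨x, rfl⟩ := hs b
    induction x using MvPolynomial.induction_on with
    | C r =>
      refine ⟨P.alg 0 r, ?_⟩
      rw [← MvPolynomial.algebraMap_eq, AlgHom.commutes]
      exact congrArg (fun ψ : A ⟶ B => ψ r) ha
    | add p q hp hq =>
      obtain ⟨x, hx⟩ := hp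
      obtain ⟨y, hy⟩ := hq
      exact ⟨x + y, by rw [map_add, map_add, hx, hy]⟩
    | mul_X p i hp =>
      obtain ⟨x, hx⟩ := hp
      refine ⟨x * P.t 0 i.succ, ?_⟩
      rw [map_mul, map_mul, hx]
      congr 1
      exact (hat i.succ).trans (by simp)
  have : IsClosedImmersion (Spec.map a) := IsClosedImmersion.spec_of_surjective a hsurj
  have h : Spec.map φ = (Spec.map a ≫ P.chart 0) ≫ P.str := by
    rw [Category.assoc, P.chart_str, ← Spec.map_comp, ha]
  have : QuasiCompact ((Spec.map a ≫ P.chart 0) ≫ P.str) := h ▸ inferInstance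
  have : QuasiCompact (Spec.map a ≫ P.chart 0) := QuasiCompact.of_comp _ P.str
  rw [h]
  exact .of_isImmersion P.str _

theorem HasCompactification.of_iso {X Y S : Scheme.{u}} (e : X ⟶ Y) [IsIso e] {f : Y ⟶ S}
    (h : HasCompactification f) : HasCompactification (e ≫ f) := by
  obtain ⟨P, fP, v, hP, hv, hd, rfl⟩ := h
  exact ⟨P, fP, e ≫ v, hP, inferInstance, inferInstance, by rw [Category.assoc]⟩

theorem HasCompactification.of_isAffine {X : Scheme.{u}} [IsAffine X] {A : CommRingCat.{u}}
    (f : X ⟶ Spec A) [LocallyOfFiniteType f] : HasCompactification f := by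
  obtain ⟨φ, hφ⟩ := Spec.map_surjective (X.isoSpec.inv ≫ f)
  have h : f = X.isoSpec.hom ≫ Spec.map φ := by rw [hφ, Iso.hom_inv_id_assoc]
  have h1 : LocallyOfFiniteType (Spec.map φ) := by rw [hφ]; infer_instance
  rw [h]
  exact (HasCompactification.spec φ
    ((HasRingHomProperty.Spec_iff (P := @LocallyOfFiniteType)).mp h1)).of_iso _

/-- Nagata's compactification theorem over a Noetherian affine base. -/
theorem HasCompactification.of_isSeparated {X : Scheme.{u}} {A : CommRingCat.{u}}
    [IsNoetherianRing A] (f : X ⟶ Spec A) [IsSeparated f] [LocallyOfFiniteType f]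
    [QuasiCompact f] : HasCompactification f := by
  have hN : IsNoetherian (Spec A) := inferInstance
  have hX : CompactSpace X := QuasiCompact.compactSpace_of_compactSpace f
  suffices h : ∀ O : X.Opens, IsCompact (O : Set X) → HasCompactification (O.ι ≫ f) by
    have h1 := (h ⊤ isCompact_univ).of_iso X.topIso.inv
    rwa [← Category.assoc, ← X.topIso_hom, Iso.inv_hom_id, Category.id_comp] at h1
  intro O hO
  refine compact_open_induction_on (P := fun O => HasCompactification (O.ι ≫ f)) O hO ?_ ?_
  · have : IsAffine ((⊥ : X.Opens) : Scheme) := isAffineOpen_bot X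
    exact .of_isAffine _
  · intro O hO D ih
    obtain ⟨P₁, f₁, v₁, h1, h2, h3, h4⟩ := ih
    have : IsAffine (D : X.Opens) := D.2
    obtain ⟨P₂, f₂, v₂, h1', h2', h3', h4'⟩ :=
      HasCompactification.of_isAffine ((D : X.Opens).ι ≫ f)
    refine .of_exists (exists_compactification_of_two ((O ⊔ D).ι ≫ f)
      (X.homOfLE (le_sup_left : O ≤ O ⊔ D)) (X.homOfLE (le_sup_right : (D : X.Opens) ≤ O ⊔ D))
      (fun x => ?_) f₁ f₂ v₁ v₂ ?_ ?_)
    · rcases x.2 with hx | hx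
      · exact Or.inl ⟨⟨x.1, hx⟩, Subtype.ext (X.homOfLE_apply _ _)⟩
      · exact Or.inr ⟨⟨x.1, hx⟩, Subtype.ext (X.homOfLE_apply _ _)⟩
    · rw [h4, X.homOfLE_ι_assoc]
    · rw [h4', X.homOfLE_ι_assoc]

theorem StrictAt.not_both_of_eq_sup {Y : Scheme.{u}} {E F J : Y.IdealSheafData} (h : J = E ⊔ F)
    (C : IsCartier J) (y : Y)
    (H₁ : ∃ (D : Y.Opens) (hD : IsAffineOpen D) (haD : y ∈ D), StrictAt J E D hD y haD)
    (H₂ : ∃ (D : Y.Opens) (hD : IsAffineOpen D) (haD : y ∈ D), StrictAt J F D hD y haD) :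
    False := by
  have hid : ∀ I : Y.IdealSheafData, I.comap (𝟙 Y) = I := IdealSheafData.comap_id
  refine StrictAt.not_both (E := E) (F := F) (J₁ := J) (J₂ := J) (T := F) (T' := E)
    (𝟙 Y) (𝟙 Y) ?_ ?_ ?_ ?_ ?_ y H₁ H₂
  · rw [hid, hid, h]
  · rw [hid, hid, h, sup_comm]
  · rwa [hid]
  · rwa [hid]
  · rw [hid, hid, mul_comm]

theorem mem_of_mem_closure_image {X P : Scheme.{u}} (v : X ⟶ P) [IsOpenImmersion v] {A : Set X}
    (hA : IsClosed A) {x : X} (h : v x ∈ closure (v '' A)) : x ∈ A := by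
  have h1 := v.isOpenEmbedding.isInducing.closure_eq_preimage_closure_image A
  rw [hA.closure_eq] at h1
  rw [h1]
  exact h

/-- Disjoint closed sets have disjoint closures after a blowup away from the open subscheme. -/
theorem exists_disjoint_closure {X P : Scheme.{u}} [IsLocallyNoetherian P] (v : X ⟶ P)
    [IsOpenImmersion v] [IsSchemeTheoreticallyDominant v] {A B : Set X} (hA : IsClosed A)
    (hB : IsClosed B) (hAB : Disjoint A B) :
    ∃ (P' : Scheme.{u}) (π : P' ⟶ P) (v' : X ⟶ P'), IsProper π ∧ IsOpenImmersion v' ∧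
      IsSchemeTheoreticallyDominant v' ∧ v' ≫ π = v ∧
      Disjoint (closure (v' '' A)) (closure (v' '' B)) := by
  let E : P.IdealSheafData := IdealSheafData.vanishingIdeal ⟨closure (v '' A), isClosed_closure⟩
  let F : P.IdealSheafData := IdealSheafData.vanishingIdeal ⟨closure (v '' B), isClosed_closure⟩
  have hE : ∀ x, x ∈ E.support ↔ x ∈ closure (v '' A) := fun x =>
    Set.ext_iff.mp (IdealSheafData.coe_support_vanishingIdeal _) x
  have hF : ∀ x, x ∈ F.support ↔ x ∈ closure (v '' B) := fun x =>
    Set.ext_iff.mp (IdealSheafData.coe_support_vanishingIdeal _) x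
  have hI : (E ⊔ F).comap v = ⊤ := by
    refine comap_eq_top_iff.mpr fun x hx => ?_
    rw [IdealSheafData.support_sup] at hx
    exact Set.disjoint_left.mp hAB (mem_of_mem_closure_image v hA ((hE _).mp hx.1))
      (mem_of_mem_closure_image v hB ((hF _).mp hx.2))
  obtain ⟨P', π, v', hπ, hv'o, hv'd, hv', hC⟩ := exists_blowup_away v _ hI
  have hJ : ∀ x, v' x ∉ ((E ⊔ F).comap π).support := by
    refine comap_eq_top_iff.mp ?_
    rw [← IdealSheafData.comap_comp, hv', hI]
  have key : ∀ (K : P.IdealSheafData) (D : Set X), (∀ x, x ∈ K.support ↔ x ∈ closure (v '' D)) →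
      K ≤ E ⊔ F → ∀ y ∈ closure (v' '' D), ∃ (O : P'.Opens) (hO : IsAffineOpen O) (hy : y ∈ O),
        StrictAt ((E ⊔ F).comap π) (K.comap π) O hO y hy := by
    intro K D hK hle y hy
    refine StrictAt.of_mem_closure hC (IdealSheafData.comap_mono π hle) (v' '' D) ?_ ?_ y hy
    · rintro _ ⟨x, hx, rfl⟩
      have h1 : π (v' x) = v x := congrArg (fun φ : _ ⟶ P => φ x) hv'
      rw [IdealSheafData.support_comap]
      exact (hK _).mpr (subset_closure ⟨x, hx, h1.symm⟩)
    · rintro _ ⟨x, hx, rfl⟩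
      exact hJ x
  refine ⟨P', π, v', hπ, hv'o, hv'd, hv', Set.disjoint_left.mpr fun y hy₁ hy₂ => ?_⟩
  exact StrictAt.not_both_of_eq_sup (IdealSheafData.comap_sup E F π) hC y
    (key E A hE le_sup_left y hy₁) (key F B hF le_sup_right y hy₂)

theorem exists_compactification_disjoint_closure {X S : Scheme.{u}} [IsNoetherian S] {f : X ⟶ S}
    (h : HasCompactification f) {ι : Type*} (s : Finset ι) (A B : ι → Set X)
    (hA : ∀ i, IsClosed (A i)) (hB : ∀ i, IsClosed (B i)) (hAB : ∀ i ∈ s, Disjoint (A i) (B i)) :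
    ∃ (P : Scheme.{u}) (fP : P ⟶ S) (v : X ⟶ P), IsProper fP ∧ IsOpenImmersion v ∧
      IsSchemeTheoreticallyDominant v ∧ v ≫ fP = f ∧
      ∀ i ∈ s, Disjoint (closure (v '' A i)) (closure (v '' B i)) := by
  classical
  induction s using Finset.induction_on with
  | empty =>
    obtain ⟨P, fP, v, h1, h2, h3, h4⟩ := h
    exact ⟨P, fP, v, h1, h2, h3, h4, fun i hi => absurd hi (Finset.notMem_empty i)⟩
  | insert a s ha ih =>
    obtain ⟨P, fP, v, h1, h2, h3, h4, h5⟩ := ih fun i hi => hAB i (Finset.mem_insert_of_mem hi)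
    have : IsNoetherian P := isNoetherian_of_proper fP
    obtain ⟨P', π, v', hπ, hv'o, hv'd, hv', hd⟩ :=
      NagataAux.exists_disjoint_closure v (hA a) (hB a) (hAB a (Finset.mem_insert_self a s))
    refine ⟨P', π ≫ fP, v', inferInstance, hv'o, hv'd, by rw [reassoc_of% hv', h4], ?_⟩
    intro i hi
    rcases Finset.mem_insert.mp hi with rfl | hi
    · exact hd
    · have key : ∀ D : Set X, closure (v' '' D) ⊆ π ⁻¹' closure (v '' D) := by
        intro D
        refine closure_minimal ?_ (isClosed_closure.preimage π.continuous)
        rintro _ ⟨x, hx, rfl⟩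
        exact subset_closure ⟨x, hx, (congrArg (fun φ : _ ⟶ P => φ x) hv').symm⟩
      exact ((h5 i hi).preimage π).mono (key _) (key _)

theorem exists_finset_generic {α : Type*} [TopologicalSpace α] [TopologicalSpace.NoetherianSpace α]
    [QuasiSober α] {O Z : Set α} (hO : IsOpen O) (hZ : IsClosed Z) :
    ∃ G : Finset α, (∀ w ∈ G, w ∈ O ∩ Z) ∧ ∀ x ∈ O ∩ Z, ∃ w ∈ G, w ⤳ x := by
  classical
  rcases isEmpty_or_nonempty α with hα | hα
  · exact ⟨∅, fun w => isEmptyElim w, fun x => isEmptyElim x⟩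
  obtain ⟨S, hS, hcl, hirr, hZS⟩ :=
    TopologicalSpace.NoetherianSpace.exists_finite_set_isClosed_irreducible hZ
  have hmem : ∀ x, x ∈ Z ↔ ∃ t ∈ S, x ∈ t := fun x => by rw [hZS, Set.mem_sUnion]
  choose! w hw using fun t (ht : t ∈ S) => QuasiSober.sober (hirr t ht) (hcl t ht)
  refine ⟨(hS.toFinset.image w).filter (· ∈ O), ?_, ?_⟩
  · intro x hx
    rw [Finset.mem_filter, Finset.mem_image] at hx
    obtain ⟨⟨t, ht, rfl⟩, hx⟩ := hx
    have ht' := hS.mem_toFinset.mp ht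
    exact ⟨hx, (hmem _).mpr ⟨t, ht', (hw t ht').mem⟩⟩
  · rintro x ⟨hxO, hxZ⟩
    obtain ⟨t, ht, hxt⟩ := (hmem x).mp hxZ
    have h := (hw t ht).specializes hxt
    refine ⟨w t, Finset.mem_filter.mpr ⟨Finset.mem_image.mpr ⟨t, hS.mem_toFinset.mpr ht, rfl⟩, ?_⟩,
      h⟩
    exact h.mem_open hO hxO

/-- If `c` is proper over `U` and `c ⁻¹ U` is dense, then the points of an extension `cb` of `c`
lying over `U` are points of `C`. -/
theorem exists_of_mem_image {C X Cb Xb : Scheme.{u}} (c : C ⟶ X) (U : X.Opens)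
    (hU : IsProper (c ∣_ U)) (hc : Dense (c ⁻¹' (U : Set X))) (j : X ⟶ Xb) [IsOpenImmersion j]
    (jC : C ⟶ Cb) (hjC : DenseRange jC) (cb : Cb ⟶ Xb) [IsSeparated cb]
    (h : jC ≫ cb = c ≫ j) {y : Cb} (hy : cb y ∈ j '' U) : ∃ x, c x ∈ U ∧ jC x = y := by
  let O : Cb.Opens := cb ⁻¹ᵁ (j ''ᵁ U)
  have h1 : Set.range (O.ι ≫ cb) ⊆ Set.range (U.ι ≫ j) := by
    rintro _ ⟨x, rfl⟩
    obtain ⟨z, hz, hzx⟩ := x.2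
    exact ⟨⟨z, hz⟩, hzx⟩
  have h2 : Set.range ((c ⁻¹ᵁ U).ι ≫ jC) ⊆ Set.range O.ι := by
    rintro _ ⟨x, rfl⟩
    rw [O.range_ι]
    exact ⟨c x.1, x.2, (congrArg (fun φ : _ ⟶ Xb => φ x.1) h).symm⟩
  have hm := IsOpenImmersion.lift_fac (U.ι ≫ j) (O.ι ≫ cb) h1
  have hn := IsOpenImmersion.lift_fac O.ι ((c ⁻¹ᵁ U).ι ≫ jC) h2
  set m := IsOpenImmersion.lift (U.ι ≫ j) (O.ι ≫ cb) h1
  set n := IsOpenImmersion.lift O.ι ((c ⁻¹ᵁ U).ι ≫ jC) h2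
  have hnm : n ≫ m = c ∣_ U := by
    rw [← cancel_mono (U.ι ≫ j), Category.assoc, hm, reassoc_of% hn, h, morphismRestrict_ι_assoc]
  have h3 : IsSeparated (m ≫ U.ι ≫ j) := hm ▸ inferInstance
  have h4 : IsSeparated m := IsSeparated.of_comp m (U.ι ≫ j)
  have h5 : IsProper (n ≫ m) := hnm ▸ hU
  have h6 : IsProper n := IsProper.of_comp n m
  have h7 : IsClosed (Set.range n) := n.isClosedMap.isClosed_range
  let y' : O := ⟨y, by obtain ⟨z, hz, hzy⟩ := hy; exact ⟨z, hz, hzy⟩⟩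
  have hn' : ∀ x, O.ι (n x) = jC x.1 := fun x => congrArg (fun φ : _ ⟶ Cb => φ x) hn
  by_cases hy' : y' ∈ Set.range n
  · obtain ⟨x, hx⟩ := hy'
    exact ⟨x.1, x.2, by rw [← hn' x, hx]; rfl⟩
  · exfalso
    have h8 : IsOpen (O.ι '' (Set.range n)ᶜ) := O.ι.isOpenEmbedding.isOpenMap _ h7.isOpen_compl
    obtain ⟨x₀, hx₀⟩ := hjC.exists_mem_open h8 ⟨_, y', hy', rfl⟩
    obtain ⟨x, hx, t, ht, htx⟩ := hc.exists_mem_open (h8.preimage jC.continuous) ⟨x₀, hx₀⟩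
    have hx' : x ∈ c ⁻¹ᵁ U := hx
    exact ht ⟨⟨x, hx'⟩, O.ι.isOpenEmbedding.injective ((hn' ⟨x, hx'⟩).trans htx.symm)⟩

end NagataAux

open NagataAux Limits

/-- Let `c = (c₁, c₂) : C → X × X` be a correspondence of separated schemes of
finite type over a field `k`, and `U ⊆ X` open with `c₁⁻¹(U)` dense in `C`,
`c₁|_{c₁⁻¹(U)} : c₁⁻¹(U) → U` proper, and `X \ U` locally c-invariant. Then `c` admits a
compactification `c̄ : C̄ → X̄ × X̄` (with `X̄`, `C̄` proper over `k` and `X ⊆ X̄`, `C ⊆ C̄`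
open) such that `X̄ \ U` is locally c̄-invariant. -/
theorem stmt4 (k : Type*) [Field k] (X C : Scheme)
    (πX : X ⟶ Spec (CommRingCat.of k)) (πC : C ⟶ Spec (CommRingCat.of k))
    [IsSeparated πX] [IsSeparated πC]
    [LocallyOfFiniteType πX] [QuasiCompact πX]
    [LocallyOfFiniteType πC] [QuasiCompact πC]
    (c₁ c₂ : C ⟶ X) (hc₁ : c₁ ≫ πX = πC) (hc₂ : c₂ ≫ πX = πC)
    (U : X.Opens)
    (hdense : Dense (c₁.base ⁻¹' (U : Set X)))
    (hproper : IsProper (c₁ ∣_ U))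
    (hlocinv : ∀ x ∈ ((U : Set X))ᶜ, ∃ V : Set X, IsOpen V ∧ x ∈ V ∧
      c₁.base '' (c₂.base ⁻¹' ((U : Set X)ᶜ ∩ V)) ⊆ (U : Set X)ᶜ ∪ Vᶜ) :
    ∃ (Xb Cb : Scheme) (πXb : Xb ⟶ Spec (CommRingCat.of k))
      (πCb : Cb ⟶ Spec (CommRingCat.of k)) (j : X ⟶ Xb) (jC : C ⟶ Cb)
      (cb₁ cb₂ : Cb ⟶ Xb),
      IsProper πXb ∧ IsProper πCb ∧
      IsOpenImmersion j ∧ IsOpenImmersion jC ∧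
      j ≫ πXb = πX ∧ jC ≫ πCb = πC ∧
      cb₁ ≫ πXb = πCb ∧ cb₂ ≫ πXb = πCb ∧
      jC ≫ cb₁ = c₁ ≫ j ∧ jC ≫ cb₂ = c₂ ≫ j ∧
      (∀ x ∈ (j.base '' (U : Set X))ᶜ, ∃ V : Set Xb, IsOpen V ∧ x ∈ V ∧
        cb₁.base '' (cb₂.base ⁻¹' ((j.base '' (U : Set X))ᶜ ∩ V)) ⊆
          (j.base '' (U : Set X))ᶜ ∪ Vᶜ) := by
  have hS : IsNoetherian (Spec (CommRingCat.of k)) := by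
    have : IsNoetherianRing (CommRingCat.of k) := inferInstanceAs (IsNoetherianRing k)
    infer_instance
  have hk : IsNoetherianRing (CommRingCat.of k) := inferInstanceAs (IsNoetherianRing k)
  have hC : IsNoetherian C :=
    { toIsLocallyNoetherian := LocallyOfFiniteType.isLocallyNoetherian πC
      toCompactSpace := QuasiCompact.compactSpace_of_compactSpace πC }
  obtain ⟨G, hG, hGW⟩ := exists_finset_generic (U.2.preimage c₁.continuous)
    (U.2.isClosed_compl.preimage c₂.continuous)
  have hdisj : ∀ w ∈ G, Disjoint (closure {c₁ w}) (closure {c₂ w}) := by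
    refine fun w hw => Set.disjoint_left.mpr fun x hx₁ hx₂ => ?_
    have hw' := hG w hw
    have hw₂ : c₂ w ∈ (U : Set X)ᶜ := hw'.2
    have hxU : x ∈ (U : Set X)ᶜ := closure_minimal (Set.singleton_subset_iff.mpr hw₂)
      U.2.isClosed_compl hx₂
    obtain ⟨V, hV, hxV, hVU⟩ := hlocinv x hxU
    have h₁ : c₁ w ∈ V := (specializes_iff_mem_closure.mpr hx₁).mem_open hV hxV
    have h₂ : c₂ w ∈ V := (specializes_iff_mem_closure.mpr hx₂).mem_open hV hxV
    rcases hVU ⟨w, ⟨hw'.2, h₂⟩, rfl⟩ with h | h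
    · exact h hw'.1
    · exact h h₁
  obtain ⟨Xb, πXb, j, hXb, hj, -, hjX, hsep⟩ := exists_compactification_disjoint_closure
    (HasCompactification.of_isSeparated πX) G (fun w => closure {c₁ w}) (fun w => closure {c₂ w})
    (fun _ => isClosed_closure) (fun _ => isClosed_closure) hdisj
  obtain ⟨C', πC', jC', hC', hjC', -, hjCC⟩ := HasCompactification.of_isSeparated πC
  let Q := pullback πXb πXb
  let πQ : Q ⟶ Spec (CommRingCat.of k) := pullback.fst πXb πXb ≫ πXb
  let c : C ⟶ Q := pullback.lift (c₁ ≫ j) (c₂ ≫ j)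
    (by rw [Category.assoc, Category.assoc, hjX, hc₁, hc₂])
  have hcQ : c ≫ πQ = πC := by
    rw [pullback.lift_fst_assoc, Category.assoc, hjX, hc₁]
  let i : C ⟶ pullback πC' πQ := pullback.lift jC' c (by rw [hjCC, hcQ])
  have hi₁ : i ≫ pullback.fst πC' πQ = jC' := pullback.lift_fst _ _ _
  have hi₂ : i ≫ pullback.snd πC' πQ = c := pullback.lift_snd _ _ _
  have h1 : IsImmersion (i ≫ pullback.fst πC' πQ) := hi₁ ▸ inferInstance
  have h2 : IsImmersion i := IsImmersion.of_comp i (pullback.fst πC' πQ)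
  let r : i.image ⟶ Q := i.imageι ≫ pullback.snd πC' πQ
  have hr : i.toImage ≫ r = c := by rw [i.toImage_imageι_assoc, hi₂]
  have hr₁ : i.toImage ≫ r ≫ pullback.fst πXb πXb = c₁ ≫ j := by
    rw [reassoc_of% hr]; exact pullback.lift_fst _ _ _
  have hr₂ : i.toImage ≫ r ≫ pullback.snd πXb πXb = c₂ ≫ j := by
    rw [reassoc_of% hr]; exact pullback.lift_snd _ _ _
  have hQ : IsProper πQ := inferInstance
  have hdom : IsSchemeTheoreticallyDominant i.toImage := toImage_dominant i
  have hlift : ∀ y, (r ≫ pullback.fst πXb πXb) y ∈ j '' (U : Set X) →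
      ∃ x, c₁ x ∈ U ∧ i.toImage x = y := fun y =>
    exists_of_mem_image c₁ U hproper hdense j i.toImage i.toImage.denseRange _ hr₁
  refine ⟨Xb, i.image, πXb, r ≫ πQ, j, i.toImage, r ≫ pullback.fst _ _, r ≫ pullback.snd _ _,
    hXb, inferInstance, hj, inferInstance, hjX, by rw [reassoc_of% hr, hcQ],
    Category.assoc _ _ _, by rw [Category.assoc, ← pullback.condition], hr₁, hr₂, fun x hx => ?_⟩
  refine ⟨⋂ w ∈ G, {z | (x ∉ closure (j '' closure {c₁ w}) → z ∉ closure (j '' closure {c₁ w})) ∧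
    (x ∉ closure (j '' closure {c₂ w}) → z ∉ closure (j '' closure {c₂ w}))}, ?_, ?_, ?_⟩
  · have key : ∀ D : Set Xb, IsOpen {z | x ∉ closure D → z ∉ closure D} := by
      intro D
      by_cases hD : x ∈ closure D
      · simp [hD]
      · simp only [hD, not_false_eq_true, forall_const]
        exact isClosed_closure.isOpen_compl
    exact isOpen_biInter_finset fun w _ => (key _).inter (key _)
  · exact Set.mem_iInter₂.mpr fun w _ => ⟨id, id⟩
  · rintro _ ⟨y, ⟨hyU, hyV⟩, rfl⟩
    by_contra hcon
    rw [Set.mem_union, not_or, Set.notMem_compl_iff, Set.notMem_compl_iff] at hcon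
    obtain ⟨hy₁, hyV₁⟩ := hcon
    obtain ⟨z, hzU, rfl⟩ := hlift y hy₁
    have hz₁ : (r ≫ pullback.fst πXb πXb) (i.toImage z) = j (c₁ z) :=
      congrArg (fun φ : _ ⟶ Xb => φ z) hr₁
    have hz₂ : (r ≫ pullback.snd πXb πXb) (i.toImage z) = j (c₂ z) :=
      congrArg (fun φ : _ ⟶ Xb => φ z) hr₂
    have hz : z ∈ c₁ ⁻¹' (U : Set X) ∩ c₂ ⁻¹' (U : Set X)ᶜ :=
      ⟨hzU, fun h => hyU ⟨c₂ z, h, hz₂.symm⟩⟩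
    obtain ⟨w, hw, hwz⟩ := hGW z hz
    have hA : j (c₁ z) ∈ closure (j '' closure {c₁ w}) :=
      subset_closure ⟨_, (hwz.map c₁.continuous).mem_closure, rfl⟩
    have hB : j (c₂ z) ∈ closure (j '' closure {c₂ w}) :=
      subset_closure ⟨_, (hwz.map c₂.continuous).mem_closure, rfl⟩
    have hV₁ := Set.mem_iInter₂.mp hyV₁ w hw
    have hV₂ := Set.mem_iInter₂.mp hyV w hw
    by_cases hx₁ : x ∈ closure (j '' closure {c₁ w})
    · have hx₂ := Set.disjoint_left.mp (hsep w hw) hx₁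
      exact hV₂.2 hx₂ (hz₂ ▸ hB)
    · exact hV₁.1 hx₁ (hz₁ ▸ hA)
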